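/- Assume every singular point of C has multiplicity 2, let P be a singular point of C and let m ≥ 1. Then: (1) P is an A_{2m−1} singularity if and only if G_P is not the square of a linear form and the length of X_2 at [G_P] equals m; (2) P is an A_{2m} singularity if and only if G_P is the square of a linear form and the length of X_2 at [G_P] equals m. -/

import Mathlib

open MvPolynomial

noncomputable section

/-- The coefficient `a_i` of `s^(n-i) t^i` in a binary form `f` of degree `n`. -/
def bcoeff {K : Type*} [Field K] (n : ℕ) (f : MvPolynomial (Fin 2) K) (i : Fin (n + 1)) : K :=
  MvPolynomial.coeff (Finsupp.single 0 (n - (i : ℕ)) + Finsupp.single 1 (i : ℕ)) f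

/-- The binary form of degree `k` with coefficient vector `x`. -/
def formOf {K : Type*} [Field K] (k : ℕ) (x : Fin (k + 1) → K) : MvPolynomial (Fin 2) K :=
  ∑ i : Fin (k + 1),
    MvPolynomial.C (x i) * MvPolynomial.X 0 ^ (k - (i : ℕ)) * MvPolynomial.X 1 ^ (i : ℕ)

/-- The matrix `M_k` associated to the parameterization `f`: the first `n-k+1` rows contain
the variables `x_0, …, x_k` in staircase position, the last three rows are the coefficient
vectors of `f_0, f_1, f_2`. -/
def Mmat {K : Type*} [Field K] (n k : ℕ) (f : Fin 3 → MvPolynomial (Fin 2) K) :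
    Matrix (Fin (n - k + 4)) (Fin (n + 1)) (MvPolynomial (Fin (k + 1)) K) :=
  fun j c =>
    if hj : (j : ℕ) ≤ n - k then
      if h : (j : ℕ) ≤ (c : ℕ) ∧ (c : ℕ) ≤ (j : ℕ) + k then
        MvPolynomial.X ⟨(c : ℕ) - (j : ℕ), by omega⟩
      else 0
    else
      MvPolynomial.C (bcoeff n (f ⟨(j : ℕ) - (n - k + 1), by have := j.isLt; omega⟩) c)

/-- The set of `(n-k+3) × (n-k+3)` minors of the matrix `M_k`; it generates the ideal
`I_{X_k}`. -/
def minorsSet {K : Type*} [Field K] (n k : ℕ) (f : Fin 3 → MvPolynomial (Fin 2) K) :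
    Set (MvPolynomial (Fin (k + 1)) K) :=
  { g | ∃ (r : Fin (n - k + 3) → Fin (n - k + 4)) (c : Fin (n - k + 3) → Fin (n + 1)),
      Function.Injective r ∧ Function.Injective c ∧
      g = ((Mmat n k f).submatrix r c).det }

/-- The projective zero locus `X_k(K) ⊆ ℙ^k(K)` of the ideal of minors of `M_k`. -/
def XkSet {K : Type*} [Field K] (n k : ℕ) (f : Fin 3 → MvPolynomial (Fin 2) K) :
    Set (Projectivization K (Fin (k + 1) → K)) :=
  { P | ∀ g ∈ minorsSet n k f, MvPolynomial.eval P.rep g = 0 }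

/-- Evaluation of the parameterization at a vector `v ∈ K²`. -/
def evalVec {K : Type*} [Field K] (f : Fin 3 → MvPolynomial (Fin 2) K) (v : Fin 2 → K) :
    Fin 3 → K :=
  fun u => MvPolynomial.eval v (f u)

/-- The induced map `f : ℙ¹(K) → ℙ²(K)` (with a junk value where undefined). -/
def projMap {K : Type*} [Field K] (f : Fin 3 → MvPolynomial (Fin 2) K)
    (P : Projectivization K (Fin 2 → K)) : Projectivization K (Fin 3 → K) :=
  haveI := Classical.propDecidable (evalVec f P.rep ≠ 0)
  if h : evalVec f P.rep ≠ 0 then Projectivization.mk K _ h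
  else Projectivization.mk K (fun _ => 1) (fun hc => one_ne_zero (congrFun hc 0))

/-- `f = (f_0, f_1, f_2)` is a proper parameterization of degree `n`: the `f_u` are
homogeneous of degree `n`, have no common zero outside the origin, and the induced map
`ℙ¹(K) → ℙ²(K)` is injective outside some finite set. -/
structure IsProperParam {K : Type*} [Field K] (n : ℕ)
    (f : Fin 3 → MvPolynomial (Fin 2) K) : Prop where
  homog : ∀ u, (f u).IsHomogeneous n
  no_common_zero : ∀ v : Fin 2 → K, v ≠ 0 → evalVec f v ≠ 0
  gen_injective : ∃ S : Set (Projectivization K (Fin 2 → K)), S.Finite ∧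
    Set.InjOn (projMap f) Sᶜ

/-- The homogeneous vanishing ideal of the point `p ∈ ℙ²(K)`. -/
def pointIdeal {K : Type*} [Field K] (p : Fin 3 → K) : Ideal (MvPolynomial (Fin 3) K) :=
  Ideal.span { L | L.IsHomogeneous 1 ∧ MvPolynomial.eval p L = 0 }

/-- The multiplicity of the curve `{F = 0}` at the point `p`:
the largest `m` with `F ∈ I(p)^m`. -/
def multAt {K : Type*} [Field K] (F : MvPolynomial (Fin 3) K) (p : Fin 3 → K) : ℕ :=
  sSup { m | F ∈ pointIdeal p ^ m }

/-- The cross difference `p_i f_j - p_j f_i`. -/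
def crossDiff {K : Type*} [Field K] (f : Fin 3 → MvPolynomial (Fin 2) K) (p : Fin 3 → K)
    (i j : Fin 3) : MvPolynomial (Fin 2) K :=
  MvPolynomial.C (p i) * f j - MvPolynomial.C (p j) * f i

/-- `G` is a greatest common divisor of the three cross differences `p_i f_j - p_j f_i`,
`0 ≤ i < j ≤ 2`. -/
def IsGcdOfCross {K : Type*} [Field K] (f : Fin 3 → MvPolynomial (Fin 2) K) (p : Fin 3 → K)
    (G : MvPolynomial (Fin 2) K) : Prop :=
  (∀ i j : Fin 3, i < j → G ∣ crossDiff f p i j) ∧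
  (∀ D : MvPolynomial (Fin 2) K, (∀ i j : Fin 3, i < j → D ∣ crossDiff f p i j) → D ∣ G)

/-- The linear binary form with root `v = (v 0 : v 1)`. -/
def linFormOf {K : Type*} [Field K] (v : Fin 2 → K) : MvPolynomial (Fin 2) K :=
  MvPolynomial.C (v 1) * MvPolynomial.X 0 - MvPolynomial.C (v 0) * MvPolynomial.X 1

/-- The multiplicity of `v` as a root of the binary form `h`. -/
def ordAt {K : Type*} [Field K] (v : Fin 2 → K) (h : MvPolynomial (Fin 2) K) : ℕ :=
  sSup { e | linFormOf v ^ e ∣ h }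

/-- The point `x ∈ ℙ²` lies on the conic `4 x₀ x₂ - x₁² = 0`. -/
def onConic {K : Type*} [Field K] (x : Fin 3 → K) : Prop :=
  4 * x 0 * x 2 - x 1 ^ 2 = 0

/-- The embedding of chart indices: the two coordinates other than `c`. -/
def chartEmb (c : Fin 3) (i : Fin 2) : Fin 3 :=
  if (i : ℕ) < (c : ℕ) then ⟨(i : ℕ), by have := i.isLt; omega⟩
  else ⟨(i : ℕ) + 1, by have := i.isLt; omega⟩

/-- Dehomogenization substitution for the affine chart `{x_c ≠ 0}` of `ℙ²`:
the variable `x_c` is sent to `1`, the other two variables to the affine coordinates. -/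
def dehomMap {K : Type*} [Field K] (c : Fin 3) (j : Fin 3) : MvPolynomial (Fin 2) K :=
  if j = c then 1
  else if h2 : (j : ℕ) < (c : ℕ) then MvPolynomial.X ⟨(j : ℕ), by have := c.isLt; omega⟩
  else MvPolynomial.X ⟨(j : ℕ) - 1, by have := j.isLt; omega⟩

/-- The affine coordinates, in the chart `{x_c ≠ 0}`, of the projective point with
homogeneous coordinates `q`. -/
def affOf {K : Type*} [Field K] (q : Fin 3 → K) (c : Fin 3) : Fin 2 → K :=
  fun i => q (chartEmb c i) / q c

/-- The dehomogenization of a homogeneous ideal of `K[x_0,x_1,x_2]` in the chart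
`{x_c ≠ 0}`. -/
def dehomIdeal {K : Type*} [Field K] (c : Fin 3) (I : Ideal (MvPolynomial (Fin 3) K)) :
    Ideal (MvPolynomial (Fin 2) K) :=
  I.map (MvPolynomial.aeval (dehomMap c) : MvPolynomial (Fin 3) K →ₐ[K] MvPolynomial (Fin 2) K)

instance kerEvalMaximal {K : Type*} [Field K] (a : Fin 2 → K) :
    (RingHom.ker (MvPolynomial.eval a : MvPolynomial (Fin 2) K →+* K)).IsMaximal :=
  RingHom.ker_isMaximal_of_surjective _ (fun r => ⟨MvPolynomial.C r, by simp⟩)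

/-- The local ring at the point `a ∈ 𝔸²` of the subscheme of the affine plane defined by the
ideal `I`: the localization, at (the image of) the maximal ideal of `a`, of the quotient of
the affine coordinate ring `K[x,y]` by `I`. -/
def LocalRingAt {K : Type*} [Field K] (I : Ideal (MvPolynomial (Fin 2) K))
    (a : Fin 2 → K) : Type _ :=
  Localization
    (((RingHom.ker (MvPolynomial.eval a : MvPolynomial (Fin 2) K →+* K)).primeCompl).map
      (Ideal.Quotient.mk I))

noncomputable instance {K : Type*} [Field K] (I : Ideal (MvPolynomial (Fin 2) K))
    (a : Fin 2 → K) : CommRing (LocalRingAt I a) :=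
  inferInstanceAs (CommRing (Localization _))

noncomputable instance {K : Type*} [Field K] (I : Ideal (MvPolynomial (Fin 2) K))
    (a : Fin 2 → K) : Algebra K (LocalRingAt I a) :=
  inferInstanceAs (Algebra K (Localization _))

noncomputable instance {K : Type*} [Field K] (I : Ideal (MvPolynomial (Fin 2) K))
    (a : Fin 2 → K) : Algebra (MvPolynomial (Fin 2) K) (LocalRingAt I a) :=
  inferInstanceAs (Algebra (MvPolynomial (Fin 2) K) (Localization _))

/-- The length at the point `a` of the subscheme of `𝔸²` defined by `I`: the `K`-dimension
of the local ring of the subscheme at `a`. -/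
noncomputable def lengthAt {K : Type*} [Field K] (I : Ideal (MvPolynomial (Fin 2) K))
    (a : Fin 2 → K) : ℕ :=
  Module.finrank K (LocalRingAt I a)

/-- The delta invariant `dim_K (Ō/O)` of the local ring `O` at `a` of the plane curve defined
by `I`, computed in a field of fractions `L` of `O`. -/
noncomputable def deltaAt {K : Type*} [Field K] (I : Ideal (MvPolynomial (Fin 2) K))
    (a : Fin 2 → K) (L : Type*) [Field L] [Algebra (LocalRingAt I a) L]
    [IsFractionRing (LocalRingAt I a) L] [Algebra K L]
    [IsScalarTower K (LocalRingAt I a) L] : ℕ :=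
  Module.finrank K
    ((integralClosure (LocalRingAt I a) L) ⧸
      LinearMap.range ((Algebra.linearMap (LocalRingAt I a)
        (integralClosure (LocalRingAt I a) L)).restrictScalars K))

/-- The completion of the local ring at `a` of the plane subscheme defined by `I`, with
respect to its maximal ideal. -/
def LocalCompletion {K : Type*} [Field K] (I : Ideal (MvPolynomial (Fin 2) K))
    (a : Fin 2 → K) : Type _ :=
  AdicCompletion
    ((RingHom.ker (MvPolynomial.eval a : MvPolynomial (Fin 2) K →+* K)).map
      (algebraMap (MvPolynomial (Fin 2) K) (LocalRingAt I a)))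
    (LocalRingAt I a)

noncomputable instance {K : Type*} [Field K] (I : Ideal (MvPolynomial (Fin 2) K))
    (a : Fin 2 → K) : CommRing (LocalCompletion I a) :=
  inferInstanceAs (CommRing (AdicCompletion _ _))

noncomputable instance {K : Type*} [Field K] (I : Ideal (MvPolynomial (Fin 2) K))
    (a : Fin 2 → K) : Algebra (LocalRingAt I a) (LocalCompletion I a) :=
  inferInstanceAs (Algebra _ (AdicCompletion _ _))

/-- `p` is an `A_s` singularity of the projective plane curve `{F = 0}`: in every affine chart
containing `p`, the completion of the local ring of the curve at `p` is isomorphic, as a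
`K`-algebra, to `K[[u,v]]/(v² - u^(s+1))`. -/
def IsAsSing {K : Type*} [Field K] (F : MvPolynomial (Fin 3) K) (p : Fin 3 → K)
    (s : ℕ) : Prop :=
  ∀ c : Fin 3, p c ≠ 0 →
    ∃ e : LocalCompletion (Ideal.span {MvPolynomial.aeval (dehomMap c) F}) (affOf p c) ≃+*
        (MvPowerSeries (Fin 2) K ⧸ Ideal.span
          {(MvPowerSeries.X 1 : MvPowerSeries (Fin 2) K) ^ 2 - MvPowerSeries.X 0 ^ (s + 1)}),
      ∀ r : K,
        e (algebraMap (LocalRingAt (Ideal.span {MvPolynomial.aeval (dehomMap c) F}) (affOf p c))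
            (LocalCompletion (Ideal.span {MvPolynomial.aeval (dehomMap c) F}) (affOf p c))
            (algebraMap K _ r))
          = algebraMap K _ r

section

namespace LocalRingAt

variable {K : Type*} [Field K] (J : Ideal (MvPolynomial (Fin 2) K)) (a : Fin 2 → K)

/-- The quotient ring whose localization is `LocalRingAt J a` maps to it. -/
theorem algebraMap_eq_zero_iff (y : MvPolynomial (Fin 2) K) :
    algebraMap (MvPolynomial (Fin 2) K) (LocalRingAt J a) y = 0 ↔
      ∃ s, eval a s ≠ 0 ∧ s * y ∈ J := by
  set M := ((RingHom.ker (MvPolynomial.eval a : MvPolynomial (Fin 2) K →+* K)).primeCompl).map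
      (Ideal.Quotient.mk J) with hM
  have : algebraMap (MvPolynomial (Fin 2) K) (LocalRingAt J a) y
      = algebraMap (MvPolynomial (Fin 2) K ⧸ J) (Localization M) (Ideal.Quotient.mk J y) := rfl
  refine (Eq.congr_left this).trans ((IsLocalization.map_eq_zero_iff M (Localization M) _).trans ?_)
  constructor
  · rintro ⟨⟨_, s, hs, rfl⟩, h⟩
    refine ⟨s, fun h0 => hs (by simpa using h0), ?_⟩
    rw [← Ideal.Quotient.eq_zero_iff_mem, map_mul]; exact h
  · rintro ⟨s, hs, h⟩
    refine ⟨⟨Ideal.Quotient.mk J s, s, fun h0 => hs (by simpa using h0), rfl⟩, ?_⟩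
    rw [← Ideal.Quotient.eq_zero_iff_mem, map_mul] at h; exact h

theorem isUnit_algebraMap {s : MvPolynomial (Fin 2) K} (hs : eval a s ≠ 0) :
    IsUnit (algebraMap (MvPolynomial (Fin 2) K) (LocalRingAt J a) s) := by
  set M := ((RingHom.ker (MvPolynomial.eval a : MvPolynomial (Fin 2) K →+* K)).primeCompl).map
      (Ideal.Quotient.mk J) with hM
  exact IsLocalization.map_units (Localization M)
    (⟨Ideal.Quotient.mk J s, s, fun h0 => hs (by simpa using h0), rfl⟩ : M)

theorem exists_mul_eq (x : LocalRingAt J a) :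
    ∃ y s, eval a s ≠ 0 ∧ x * algebraMap (MvPolynomial (Fin 2) K) (LocalRingAt J a) s
      = algebraMap (MvPolynomial (Fin 2) K) (LocalRingAt J a) y := by
  set M := ((RingHom.ker (MvPolynomial.eval a : MvPolynomial (Fin 2) K →+* K)).primeCompl).map
      (Ideal.Quotient.mk J) with hM
  obtain ⟨⟨y, ⟨_, s, hs, rfl⟩⟩, h⟩ := IsLocalization.surj M (S := Localization M) x
  obtain ⟨y, rfl⟩ := Ideal.Quotient.mk_surjective y
  exact ⟨y, s, fun h0 => hs (by simpa using h0), h⟩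

theorem algebraMap_C (c : K) :
    algebraMap (MvPolynomial (Fin 2) K) (LocalRingAt J a) (C c) = algebraMap K _ c := rfl

end LocalRingAt

section
variable {K : Type*} [Field K] (a : Fin 2 → K)

/-- The maximal ideal of the point `a` of the affine plane. -/
abbrev mAt : Ideal (MvPolynomial (Fin 2) K) :=
  RingHom.ker (MvPolynomial.eval a : MvPolynomial (Fin 2) K →+* K)

theorem sub_C_eval_mem_span (y : MvPolynomial (Fin 2) K) :
    y - C (eval a y) ∈ Ideal.span {X 0 - C (a 0), (X 1 - C (a 1) : MvPolynomial (Fin 2) K)} := by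
  rw [← Ideal.Quotient.eq]
  set I := Ideal.span {X 0 - C (a 0), (X 1 - C (a 1) : MvPolynomial (Fin 2) K)}
  have : Ideal.Quotient.mk I = (Ideal.Quotient.mk I).comp (C.comp (eval a)) := by
    apply MvPolynomial.ringHom_ext
    · intro r; simp
    · intro i
      simp only [RingHom.comp_apply, eval_X]
      rw [Ideal.Quotient.eq]
      fin_cases i
      · exact Ideal.subset_span (by simp)
      · exact Ideal.subset_span (by simp)
  exact congrArg (fun φ => φ y) this

theorem mAt_eq_span :
    mAt a = Ideal.span {X 0 - C (a 0), (X 1 - C (a 1) : MvPolynomial (Fin 2) K)} := by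
  apply le_antisymm
  · intro y hy
    have := sub_C_eval_mem_span a y
    rw [RingHom.mem_ker] at hy
    simpa [hy] using this
  · rw [Ideal.span_le]
    rintro y (rfl | rfl) <;> simp [RingHom.mem_ker]

theorem exists_linear_part {y : MvPolynomial (Fin 2) K} (hy : y ∈ mAt a) :
    ∃ l₀ l₁ : K, y - (C l₀ * (X 0 - C (a 0)) + C l₁ * (X 1 - C (a 1))) ∈ mAt a ^ 2 := by
  have h := hy
  rw [mAt_eq_span, Ideal.mem_span_pair] at h
  obtain ⟨g, h, rfl⟩ := h
  refine ⟨eval a g, eval a h, ?_⟩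
  have : g * (X 0 - C (a 0)) + h * (X 1 - C (a 1)) -
      (C (eval a g) * (X 0 - C (a 0)) + C (eval a h) * (X 1 - C (a 1)))
      = (g - C (eval a g)) * (X 0 - C (a 0)) + (h - C (eval a h)) * (X 1 - C (a 1)) := by ring
  rw [this, pow_two]
  refine add_mem (Ideal.mul_mem_mul ?_ ?_) (Ideal.mul_mem_mul ?_ ?_) <;> simp [RingHom.mem_ker]

theorem C_mul_mem_iff {I : Ideal (MvPolynomial (Fin 2) K)} {c : K} (hc : c ≠ 0)
    {y : MvPolynomial (Fin 2) K} : C c * y ∈ I ↔ y ∈ I := by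
  constructor
  · intro h
    have := I.mul_mem_left (C c⁻¹) h
    rwa [← mul_assoc, ← C_mul, inv_mul_cancel₀ hc, C_1, one_mul] at this
  · exact I.mul_mem_left _

/-- A local parameter `z` on the smooth curve germ `b = 0` generates `m` modulo `b` and `m²`. -/
theorem mAt_le_of_arc {b z : MvPolynomial (Fin 2) K} (hb : b ∈ mAt a) (hb2 : b ∉ mAt a ^ 2)
    (hz : z ∈ mAt a) (hbz : ∀ l : K, z - C l * b ∉ mAt a ^ 2)
    {y : MvPolynomial (Fin 2) K} (hy : y ∈ mAt a) :
    ∃ c : K, y - C c * z ∈ Ideal.span {b} ⊔ mAt a ^ 2 := by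
  obtain ⟨b₀, b₁, hb'⟩ := exists_linear_part a hb
  obtain ⟨z₀, z₁, hz'⟩ := exists_linear_part a hz
  obtain ⟨y₀, y₁, hy'⟩ := exists_linear_part a hy
  have hdet : b₀ * z₁ - b₁ * z₀ ≠ 0 := by
    intro hd
    by_cases h0 : b₀ = 0
    · have h1 : b₁ ≠ 0 := by
        rintro rfl; apply hb2; simpa [h0] using hb'
      have hz0 : z₀ = 0 := by subst h0; simpa [h1] using hd
      apply hbz (z₁ / b₁)
      have := sub_mem hz' (Ideal.mul_mem_left _ (C (z₁ / b₁)) hb')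
      have e : C (z₁ / b₁) * C b₁ = (C z₁ : MvPolynomial (Fin 2) K) := by
        rw [← C_mul, div_mul_cancel₀ _ h1]
      convert this using 1
      simp only [h0, hz0, C_0]
      linear_combination (-(X 1 - C (a 1)) : MvPolynomial (Fin 2) K) * e
    · apply hbz (z₀ / b₀)
      have := sub_mem hz' (Ideal.mul_mem_left _ (C (z₀ / b₀)) hb')
      have e : C (z₀ / b₀) * C b₀ = (C z₀ : MvPolynomial (Fin 2) K) := by
        rw [← C_mul, div_mul_cancel₀ _ h0]
      have e' : C (z₀ / b₀) * C b₁ = (C z₁ : MvPolynomial (Fin 2) K) := by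
        rw [← C_mul]; congr 1; field_simp; linear_combination -hd
      convert this using 1
      linear_combination (-(X 0 - C (a 0)) : MvPolynomial (Fin 2) K) * e
        + (-(X 1 - C (a 1)) : MvPolynomial (Fin 2) K) * e'
  set d := b₀ * z₁ - b₁ * z₀ with hd
  refine ⟨(b₀ * y₁ - b₁ * y₀) / d, ?_⟩
  set c := (b₀ * y₁ - b₁ * y₀) / d with hc
  set e := (y₀ * z₁ - y₁ * z₀) / d with he
  have e0 : c * z₀ + e * b₀ = y₀ := by rw [hc, he]; field_simp; rw [hd]; ring
  have e1 : c * z₁ + e * b₁ = y₁ := by rw [hc, he]; field_simp; rw [hd]; ring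
  rw [Submodule.mem_sup]
  refine ⟨C e * b, Ideal.mul_mem_left _ _ (Ideal.mem_span_singleton_self b),
    y - C c * z - C e * b, ?_, by ring⟩
  have := sub_mem (sub_mem hy' (Ideal.mul_mem_left _ (C c) hz')) (Ideal.mul_mem_left _ (C e) hb')
  convert this using 1
  rw [← e0, ← e1]
  simp only [C_add, C_mul]
  ring

theorem mAt_pow_le_of_arc {b z : MvPolynomial (Fin 2) K}
    (h : ∀ y ∈ mAt a, ∃ c : K, y - C c * z ∈ Ideal.span {b} ⊔ mAt a ^ 2) (hz : z ∈ mAt a)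
    (i : ℕ) {y : MvPolynomial (Fin 2) K} (hy : y ∈ mAt a ^ i) :
    ∃ c : K, y - C c * z ^ i ∈ Ideal.span {b} ⊔ mAt a ^ (i + 1) := by
  induction i generalizing y with
  | zero =>
    refine ⟨eval a y, Ideal.mem_sup_right ?_⟩
    simp [RingHom.mem_ker]
  | succ i ih =>
    rw [pow_succ] at hy
    induction hy using Submodule.mul_induction_on' with
    | mem_mul_mem g hg l hl =>
      obtain ⟨c, hc⟩ := ih hg
      obtain ⟨e, he⟩ := h l hl
      refine ⟨c * e, ?_⟩
      have h1 := Ideal.mul_mem_mul hc hl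
      have h2 := Ideal.mul_mem_mul (Ideal.mul_mem_left _ (C c) (Ideal.pow_mem_pow hz i)) he
      have k1 : (Ideal.span {b} ⊔ mAt a ^ (i + 1)) * mAt a ≤
          Ideal.span {b} ⊔ mAt a ^ (i + 1 + 1) := by
        rw [Ideal.sup_mul, ← pow_succ]
        exact sup_le_sup_right Ideal.mul_le_left _
      have k2 : mAt a ^ i * (Ideal.span {b} ⊔ mAt a ^ 2) ≤
          Ideal.span {b} ⊔ mAt a ^ (i + 1 + 1) := by
        rw [Ideal.mul_sup, ← pow_add]
        exact sup_le_sup_right Ideal.mul_le_right _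
      have := add_mem (k1 h1) (k2 h2)
      convert this using 1
      simp only [C_mul]
      ring
    | add y₁ _ y₂ _ h1 h2 =>
      obtain ⟨c, hc⟩ := h1
      obtain ⟨e, he⟩ := h2
      refine ⟨c + e, ?_⟩
      convert add_mem hc he using 1
      simp only [C_add]
      ring

theorem exists_expansion_of_arc {b z : MvPolynomial (Fin 2) K}
    (h : ∀ y ∈ mAt a, ∃ c : K, y - C c * z ∈ Ideal.span {b} ⊔ mAt a ^ 2) (hz : z ∈ mAt a)
    (N : ℕ) (y : MvPolynomial (Fin 2) K) :
    ∃ c : ℕ → K, y - ∑ i ∈ Finset.range N, C (c i) * z ^ i ∈ Ideal.span {b} ⊔ mAt a ^ N := by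
  induction N with
  | zero => exact ⟨0, by simp⟩
  | succ N ih =>
    obtain ⟨c, hc⟩ := ih
    obtain ⟨g, hg, l, hl, e⟩ := Submodule.mem_sup.1 hc
    obtain ⟨d, hd⟩ := mAt_pow_le_of_arc a h hz N hl
    refine ⟨fun i => if i = N then d else c i, ?_⟩
    have h1 : ∑ i ∈ Finset.range N, C (if i = N then d else c i) * z ^ i
        = ∑ i ∈ Finset.range N, C (c i) * z ^ i := by
      refine Finset.sum_congr rfl fun i hi => ?_
      rw [if_neg (Finset.mem_range.1 hi).ne]
    simp only [Finset.sum_range_succ, h1, if_true]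
    convert add_mem (Ideal.mem_sup_left hg : g ∈ Ideal.span {b} ⊔ mAt a ^ (N + 1)) hd using 1
    linear_combination -e

theorem coeff_eq_zero_of_dvd {ω : PowerSeries K} (hω : PowerSeries.constantCoeff ω ≠ 0)
    (c : ℕ → K) {N j : ℕ} (hj : j ≤ N)
    (h : PowerSeries.X ^ (2 * j) ∣
      ∑ i ∈ Finset.range N, PowerSeries.C (c i) * (PowerSeries.X ^ 2 * ω) ^ i) :
    ∀ i < j, c i = 0 := by
  induction j with
  | zero => simp
  | succ j ih =>
    have h0 := ih (by omega) (dvd_trans (pow_dvd_pow _ (by omega)) h)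
    intro i hi
    rcases Nat.lt_succ_iff_lt_or_eq.1 hi with hi | rfl
    · exact h0 i hi
    · have e : ∑ j ∈ Finset.range N, PowerSeries.C (c j) * (PowerSeries.X ^ 2 * ω) ^ j
          = PowerSeries.X ^ (2 * i) * (PowerSeries.C (c i) * ω ^ i) + PowerSeries.X ^ (2 * i + 2) *
            ∑ j ∈ Finset.range (N - (i + 1)), PowerSeries.C (c (i + 1 + j)) *
              (PowerSeries.X ^ (2 * j) * ω ^ (i + 1 + j)) := by
        conv_lhs => rw [show N = (i + 1) + (N - (i + 1)) by omega]
        rw [Finset.sum_range_add, Finset.sum_range_succ, Finset.sum_eq_zero, Finset.mul_sum]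
        · congr 1
          · ring
          · refine Finset.sum_congr rfl fun j _ => ?_
            ring
        · intro l hl
          rw [h0 l (Finset.mem_range.1 hl)]; simp
      rw [e, show 2 * (i + 1) = 2 * i + 2 by ring] at h
      rw [dvd_add_left (dvd_mul_right _ _), pow_add,
        mul_dvd_mul_iff_left (pow_ne_zero _ PowerSeries.X_ne_zero)] at h
      have h' := dvd_trans (dvd_pow_self _ two_ne_zero) h
      rw [PowerSeries.X_dvd_iff] at h'
      simpa [hω] using h'

/-- The length of a plane scheme contained in a smooth germ `b₁ = 0` parameterized by an arc. -/
theorem lengthAt_eq_of_arc (J : Ideal (MvPolynomial (Fin 2) K))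
    (θ : MvPolynomial (Fin 2) K →ₐ[K] PowerSeries K)
    (hθ : ∀ y ∈ mAt a, PowerSeries.X ^ 2 ∣ θ y)
    {z b₁ b₂ : MvPolynomial (Fin 2) K} (hz : z ∈ mAt a) {ω ω' : PowerSeries K}
    (hω : PowerSeries.constantCoeff ω ≠ 0) (hθz : θ z = PowerSeries.X ^ 2 * ω)
    (hb₁ : b₁ ∈ J) (hb₁m : b₁ ∈ mAt a) (hb₁2 : b₁ ∉ mAt a ^ 2) (hθb₁ : θ b₁ = 0)
    {k : ℕ} (hJ : ∀ j ∈ J, PowerSeries.X ^ (2 * k) ∣ θ j)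
    (hb₂ : b₂ ∈ J) (hω' : PowerSeries.constantCoeff ω' ≠ 0)
    (hθb₂ : θ b₂ = PowerSeries.X ^ (2 * k) * ω') :
    lengthAt J a = k := by
  have hθpow : ∀ (i : ℕ), ∀ y ∈ mAt a ^ i, PowerSeries.X ^ (2 * i) ∣ θ y := by
    intro i y hy
    have : mAt a ^ i ≤ (Ideal.span {(PowerSeries.X : PowerSeries K) ^ (2 * i)}).comap θ := by
      have h1 : mAt a ≤ (Ideal.span {(PowerSeries.X : PowerSeries K) ^ 2}).comap θ := by
        intro y hy
        rw [Ideal.mem_comap, Ideal.mem_span_singleton]; exact hθ y hy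
      refine (Ideal.pow_right_mono h1 i).trans ((Ideal.le_comap_pow _ _).trans ?_)
      rw [Ideal.span_singleton_pow, ← pow_mul]
    have := this hy
    rwa [Ideal.mem_comap, Ideal.mem_span_singleton] at this
  have hθC : ∀ c, θ (C c) = PowerSeries.C c := fun c => θ.commutes c
  have hbz : ∀ l : K, z - C l * b₁ ∉ mAt a ^ 2 := by
    intro l hl
    have := hθpow 2 _ hl
    rw [map_sub, map_mul, hθb₁, mul_zero, sub_zero, hθz, show 2 * 2 = 2 + 2 from rfl, pow_add,
      mul_dvd_mul_iff_left (pow_ne_zero _ PowerSeries.X_ne_zero)] at this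
    have := dvd_trans (dvd_pow_self _ two_ne_zero) this
    rw [PowerSeries.X_dvd_iff] at this
    exact hω this
  have hgen := fun y (hy : y ∈ mAt a) => mAt_le_of_arc a hb₁m hb₁2 hz hbz hy
  -- the power `z ^ k` lies in `J + m ^ (k+1)`
  have hzk : z ^ k ∈ J ⊔ mAt a ^ (k + 1) := by
    obtain ⟨c, hc⟩ := exists_expansion_of_arc a hgen hz (k + 1) b₂
    obtain ⟨g, hg, l, hl, e⟩ := Submodule.mem_sup.1 hc
    obtain ⟨g', rfl⟩ := Ideal.mem_span_singleton'.1 hg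
    have e' := congrArg θ e
    simp only [map_add, map_mul, hθb₁, mul_zero, zero_add, map_sub, hθb₂, map_sum, hθC, map_pow,
      hθz] at e'
    have hl' := hθpow _ _ hl
    have hd : PowerSeries.X ^ (2 * k) ∣
        ∑ i ∈ Finset.range (k + 1), PowerSeries.C (c i) * (PowerSeries.X ^ 2 * ω) ^ i := by
      have e'' := sub_eq_iff_eq_add.1 e'.symm
      rw [← dvd_add_right (dvd_trans (pow_dvd_pow _ (by omega)) hl'), ← e'']
      exact dvd_mul_right _ _
    have h0 := coeff_eq_zero_of_dvd hω c (Nat.le_succ k) hd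
    have hck : c k ≠ 0 := by
      intro h0k
      rw [Finset.sum_eq_zero, sub_zero] at e'
      · rw [e', show 2 * (k + 1) = 2 * k + 2 by ring, pow_add,
          mul_dvd_mul_iff_left (pow_ne_zero _ PowerSeries.X_ne_zero)] at hl'
        have := dvd_trans (dvd_pow_self _ two_ne_zero) hl'
        rw [PowerSeries.X_dvd_iff] at this
        exact hω' this
      · intro i hi
        rcases Nat.lt_succ_iff_lt_or_eq.1 (Finset.mem_range.1 hi) with hi | rfl
        · simp [h0 i hi]
        · simp [h0k]
    rw [Finset.sum_range_succ, Finset.sum_eq_zero, zero_add] at e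
    · rw [← C_mul_mem_iff hck]
      have : C (c k) * z ^ k = (b₂ - g' * b₁) - l := by linear_combination e
      rw [this]
      exact sub_mem (Ideal.mem_sup_left (sub_mem hb₂ (J.mul_mem_left _ hb₁)))
        (Ideal.mem_sup_right hl)
    · intro i hi
      simp [h0 i (Finset.mem_range.1 hi)]
  have hmk : mAt a ^ k ≤ J ⊔ mAt a ^ (k + 1) := by
    intro y hy
    obtain ⟨c, hc⟩ := mAt_pow_le_of_arc a hgen hz k hy
    have hc' : y - C c * z ^ k ∈ J ⊔ mAt a ^ (k + 1) :=
      (sup_le_sup_right ((Ideal.span_singleton_le_iff_mem J).2 hb₁) (mAt a ^ (k + 1))) hc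
    have := add_mem hc' (Ideal.mul_mem_left _ (C c) hzk)
    simpa using this
  set ι := algebraMap (MvPolynomial (Fin 2) K) (LocalRingAt J a) with hι
  have hιJ : ∀ y ∈ J, ι y = 0 := fun y hy =>
    (LocalRingAt.algebraMap_eq_zero_iff J a y).2 ⟨1, by simp, by simpa using hy⟩
  -- Nakayama
  have hnil : (mAt a ^ k).map ι = ⊥ := by
    apply Submodule.eq_bot_of_le_smul_of_le_jacobson_bot ((mAt a).map ι)
    · exact ((Ideal.fg_of_isNoetherianRing _).map _)
    · rw [smul_eq_mul, ← Ideal.map_mul, ← pow_succ']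
      refine (Ideal.map_mono hmk).trans ?_
      rw [Ideal.map_sup, sup_le_iff]
      refine ⟨?_, le_rfl⟩
      rw [Ideal.map_le_iff_le_comap]
      intro y hy
      rw [Ideal.mem_comap, hιJ y hy]
      exact zero_mem _
    · rw [Ideal.map_le_iff_le_comap]
      intro y hy
      rw [Ideal.mem_comap, Ideal.mem_jacobson_bot]
      intro x
      obtain ⟨g, s, hs, e⟩ := LocalRingAt.exists_mul_eq J a x
      have hu := LocalRingAt.isUnit_algebraMap J a hs
      have hu' := LocalRingAt.isUnit_algebraMap J a (s := y * g + s) (by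
        rw [RingHom.mem_ker] at hy
        simpa [hy] using hs)
      rw [← hι] at hu hu' e
      have : (ι y * x + 1) * ι s = ι (y * g + s) := by
        rw [map_add, map_mul, ← e]; ring
      exact isUnit_of_mul_isUnit_left (this ▸ hu')
  have hιk : ∀ y ∈ mAt a ^ k, ι y = 0 := fun y hy => by
    have := Ideal.mem_map_of_mem ι hy
    rwa [hnil, Ideal.mem_bot] at this
  let Φ : (Fin k → K) →ₗ[K] LocalRingAt J a :=
    { toFun := fun c => ι (∑ i : Fin k, C (c i) * z ^ (i : ℕ))
      map_add' := by
        intro c d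
        rw [← map_add, ← Finset.sum_add_distrib]
        congr 1
        refine Finset.sum_congr rfl fun i _ => ?_
        simp only [Pi.add_apply, C_add]; ring
      map_smul' := by
        intro c d
        rw [RingHom.id_apply, Algebra.smul_def (A := LocalRingAt J a),
          ← LocalRingAt.algebraMap_C, ← map_mul,
          Finset.mul_sum]
        congr 1
        refine Finset.sum_congr rfl fun i _ => ?_
        simp only [Pi.smul_apply, smul_eq_mul, C_mul]; ring }
  have hΦinj : Function.Injective Φ := by
    rw [injective_iff_map_eq_zero]
    intro c hc
    obtain ⟨s, hs, hsJ⟩ := (LocalRingAt.algebraMap_eq_zero_iff J a _).1 hc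
    have h1 := hJ _ hsJ
    have hsu : IsUnit (θ s) := by
      rw [PowerSeries.isUnit_iff_constantCoeff, isUnit_iff_ne_zero]
      have h2 := hθ (s - C (eval a s)) (by simp [RingHom.mem_ker])
      have h3 := dvd_trans (dvd_pow_self _ two_ne_zero) h2
      rw [PowerSeries.X_dvd_iff, map_sub, hθC, map_sub, PowerSeries.constantCoeff_C,
        sub_eq_zero] at h3
      rwa [h3]
    rw [map_mul, hsu.dvd_mul_left] at h1
    let c' : ℕ → K := fun i => if h : i < k then c ⟨i, h⟩ else 0
    have h4 : θ (∑ i : Fin k, C (c i) * z ^ (i : ℕ)) =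
        ∑ i ∈ Finset.range k, PowerSeries.C (c' i) * (PowerSeries.X ^ 2 * ω) ^ i := by
      rw [Finset.sum_range, map_sum]
      refine Finset.sum_congr rfl fun i _ => ?_
      simp [c', hθC, hθz]
    rw [h4] at h1
    have h5 := coeff_eq_zero_of_dvd hω c' le_rfl h1
    funext i
    simpa [c'] using h5 i i.2
  have hrange : ∀ y, ∃ c, Φ c = ι y := by
    intro y
    obtain ⟨c, hc⟩ := exists_expansion_of_arc a hgen hz k y
    obtain ⟨g, hg, l, hl, e⟩ := Submodule.mem_sup.1 hc
    refine ⟨fun i => c i, ?_⟩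
    have hg' : ι g = 0 := hιJ g ((Ideal.span_singleton_le_iff_mem J).2 hb₁ hg)
    have e' := congrArg ι e
    rw [map_add, hg', hιk l hl, map_sub, Finset.sum_range] at e'
    change ι (∑ i : Fin k, C (c i) * z ^ (i : ℕ)) = ι y
    linear_combination e'
  have hΦsurj : Function.Surjective Φ := by
    intro x
    obtain ⟨y, s, hs, e⟩ := LocalRingAt.exists_mul_eq J a x
    -- invert `s` up to the nilpotent ideal
    set w : MvPolynomial (Fin 2) K := 1 - C (eval a s)⁻¹ * s with hw
    have hwm : w ∈ mAt a := by
      rw [RingHom.mem_ker]; simp [hw, hs]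
    have hgeom := mul_neg_geom_sum w k
    have hwk : ι (w ^ k) = 0 := hιk _ (Ideal.pow_mem_pow hwm k)
    have h1 : ι s * ι (C (eval a s)⁻¹ * ∑ i ∈ Finset.range k, w ^ i) = 1 := by
      rw [← map_mul, show s * (C (eval a s)⁻¹ * ∑ i ∈ Finset.range k, w ^ i)
        = 1 - w ^ k by rw [← hgeom, hw]; ring, map_sub, hwk, map_one, sub_zero]
    obtain ⟨c, hc⟩ := hrange (y * (C (eval a s)⁻¹ * ∑ i ∈ Finset.range k, w ^ i))
    refine ⟨c, ?_⟩
    rw [hc, map_mul, hι, ← e, mul_assoc, ← hι, h1, mul_one]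
  have := (LinearEquiv.ofBijective Φ ⟨hΦinj, hΦsurj⟩).finrank_eq
  rw [lengthAt, ← this, Module.finrank_fin_fun]

end

end

section

section
variable {K : Type*} [Field K]

/-- The ring isomorphism `K[[u,v]] ≃ K[[u]][[v]]`. -/
def bivariateEquiv (K : Type*) [Field K] :
    MvPowerSeries (Fin 2) K ≃+* PowerSeries (PowerSeries K) :=
  ((MvPowerSeries.renameEquiv K (Equiv.swap (0 : Fin 2) 1)).trans
    (MvPowerSeries.finSuccEquiv K 1)).toRingEquiv.trans
  (RingEquiv.ofRingHom
    (PowerSeries.map (MvPowerSeries.renameEquiv K (Equiv.ofUnique (Fin 1) Unit)).toRingHom)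
    (PowerSeries.map (MvPowerSeries.renameEquiv K (Equiv.ofUnique (Fin 1) Unit)).symm.toRingHom)
    (by ext; simp) (by ext; simp))

theorem bivariateEquiv_X_zero :
    bivariateEquiv K (MvPowerSeries.X 0) = PowerSeries.C PowerSeries.X := by
  have : MvPowerSeries.finSuccEquiv K 1 (MvPowerSeries.X 1) = .C (MvPowerSeries.X 0) :=
    MvPowerSeries.finSuccEquiv_X_succ (0 : Fin 1)
  simp [bivariateEquiv, this]
  rfl

theorem bivariateEquiv_X_one :
    bivariateEquiv K (MvPowerSeries.X 1) = PowerSeries.X := by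
  simp [bivariateEquiv]

theorem bivariateEquiv_C (c : K) :
    bivariateEquiv K (MvPowerSeries.C c) = PowerSeries.C (PowerSeries.C c) := by
  simp [bivariateEquiv]
  rfl

/-- The ideal of the `A_{a-1}` singularity in `K[[u]][[v]]`. -/
abbrev cuspIdeal (K : Type*) [Field K] (a : ℕ) : Ideal (PowerSeries (PowerSeries K)) :=
  Ideal.span {PowerSeries.X ^ 2 - PowerSeries.C (PowerSeries.X ^ a)}

namespace PowerSeries

/-- A bivariate power series without constant term is a combination of the variables. -/
theorem exists_eq_of_constantCoeff_eq_zero {W : PowerSeries (PowerSeries K)}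
    (h : constantCoeff (constantCoeff W) = 0) :
    ∃ g h : PowerSeries (PowerSeries K), W = C X * g + X * h := by
  obtain ⟨h₁, e₁⟩ := PowerSeries.X_dvd_iff.2 h
  have : constantCoeff (W - C (constantCoeff W)) = 0 := by simp
  obtain ⟨h₂, e₂⟩ := PowerSeries.X_dvd_iff.2 this
  refine ⟨C h₁, h₂, ?_⟩
  rw [← e₂, ← map_mul, ← e₁]; ring

theorem isUnit_bivariate_iff {W : PowerSeries (PowerSeries K)} :
    IsUnit W ↔ constantCoeff (constantCoeff W) ≠ 0 := by
  rw [PowerSeries.isUnit_iff_constantCoeff, PowerSeries.isUnit_iff_constantCoeff,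
    isUnit_iff_ne_zero]

theorem isUnit_mk_cuspIdeal_iff {a : ℕ} (ha : 2 ≤ a) {W : PowerSeries (PowerSeries K)} :
    IsUnit (Ideal.Quotient.mk (cuspIdeal K a) W) ↔ constantCoeff (constantCoeff W) ≠ 0 := by
  constructor
  · intro h h0
    obtain ⟨y, hy⟩ := h.exists_right_inv
    obtain ⟨y, rfl⟩ := Ideal.Quotient.mk_surjective y
    rw [← map_mul, ← map_one (Ideal.Quotient.mk (cuspIdeal K a)), Ideal.Quotient.eq,
      Ideal.mem_span_singleton] at hy
    obtain ⟨g, hg⟩ := hy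
    have := congrArg (fun x => constantCoeff (constantCoeff x)) hg
    simp [h0, show a ≠ 0 by omega] at this
  · intro h
    exact (isUnit_bivariate_iff.2 h).map _

theorem linear_coeffs_mul {g W : PowerSeries (PowerSeries K)}
    (hW : constantCoeff (constantCoeff W) = 0) :
    coeff 1 (coeff 0 (g * W)) = constantCoeff (constantCoeff g) * coeff 1 (coeff 0 W) ∧
    coeff 0 (coeff 1 (g * W)) = constantCoeff (constantCoeff g) * coeff 0 (coeff 1 W) := by
  constructor
  · simp [coeff_one_mul, hW, mul_comm]
  · simp [coeff_one_mul, hW, mul_comm]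

theorem linear_coeffs_relation {b : ℕ} (hb : 2 ≤ b) (w : PowerSeries (PowerSeries K)) :
    coeff 1 (coeff 0 ((X ^ 2 - C (X ^ b)) * w)) = 0 ∧
    coeff 0 (coeff 1 ((X ^ 2 - C (X ^ b)) * w)) = 0 := by
  obtain ⟨b, rfl⟩ := Nat.exists_eq_add_of_le hb
  constructor
  · simp [coeff_one_mul, pow_add, coeff_X_pow]
  · rw [sub_mul, map_sub, coeff_C_mul, coeff_X_pow_mul']
    simp

/-- The images of the coordinates under an isomorphism have independent linear parts. -/
theorem linear_parts_independent {a b : ℕ} (ha : 2 ≤ a) (hb : 2 ≤ b)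
    (e : (PowerSeries (PowerSeries K) ⧸ cuspIdeal K a) ≃+*
      (PowerSeries (PowerSeries K) ⧸ cuspIdeal K b)) {U V : PowerSeries (PowerSeries K)}
    (hU : Ideal.Quotient.mk _ U = e (Ideal.Quotient.mk _ (C X)))
    (hV : Ideal.Quotient.mk _ V = e (Ideal.Quotient.mk _ X)) :
    constantCoeff (constantCoeff U) = 0 ∧ constantCoeff (constantCoeff V) = 0 ∧
    coeff 1 (coeff 0 U) * coeff 0 (coeff 1 V) - coeff 1 (coeff 0 V) * coeff 0 (coeff 1 U) ≠ 0 := by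
  have hU0 : constantCoeff (constantCoeff U) = 0 := by
    by_contra h
    rw [← ne_eq, ← isUnit_mk_cuspIdeal_iff hb, hU, MulEquiv.isUnit_map,
      isUnit_mk_cuspIdeal_iff ha] at h
    simp at h
  have hV0 : constantCoeff (constantCoeff V) = 0 := by
    by_contra h
    rw [← ne_eq, ← isUnit_mk_cuspIdeal_iff hb, hV, MulEquiv.isUnit_map,
      isUnit_mk_cuspIdeal_iff ha] at h
    simp at h
  have key : ∀ W : PowerSeries (PowerSeries K), constantCoeff (constantCoeff W) = 0 →
      ∃ g h : K, coeff 1 (coeff 0 W) = g * coeff 1 (coeff 0 U) + h * coeff 1 (coeff 0 V) ∧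
        coeff 0 (coeff 1 W) = g * coeff 0 (coeff 1 U) + h * coeff 0 (coeff 1 V) := by
    intro W hW
    obtain ⟨x, hx⟩ := e.surjective (Ideal.Quotient.mk _ W)
    obtain ⟨x, rfl⟩ := Ideal.Quotient.mk_surjective x
    have hx0 : constantCoeff (constantCoeff x) = 0 := by
      by_contra h
      rw [← ne_eq, ← isUnit_mk_cuspIdeal_iff ha, ← MulEquiv.isUnit_map e, hx,
        isUnit_mk_cuspIdeal_iff hb] at h
      exact h hW
    obtain ⟨g, h, rfl⟩ := exists_eq_of_constantCoeff_eq_zero hx0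
    obtain ⟨g', hg'⟩ := Ideal.Quotient.mk_surjective (e (Ideal.Quotient.mk _ g))
    obtain ⟨h', hh'⟩ := Ideal.Quotient.mk_surjective (e (Ideal.Quotient.mk _ h))
    rw [map_add, map_mul, map_mul, map_add, map_mul, map_mul, ← hU, ← hV, ← hg', ← hh', ← map_mul,
      ← map_mul, ← map_add, eq_comm, Ideal.Quotient.eq, Ideal.mem_span_singleton] at hx
    obtain ⟨w, hw⟩ := hx
    have hw' : W = g' * U + h' * V + (X ^ 2 - C (X ^ b)) * w := by rw [← hw]; ring
    refine ⟨constantCoeff (constantCoeff g'), constantCoeff (constantCoeff h'), ?_, ?_⟩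
    · rw [hw']
      simp only [map_add, (linear_coeffs_mul hU0).1, (linear_coeffs_mul hV0).1,
        (linear_coeffs_relation hb w).1, add_zero]
    · rw [hw']
      simp only [map_add, (linear_coeffs_mul hU0).2, (linear_coeffs_mul hV0).2,
        (linear_coeffs_relation hb w).2, add_zero]
  refine ⟨hU0, hV0, fun hdet => ?_⟩
  obtain ⟨g, h, h1, h2⟩ := key (C X) (by simp)
  obtain ⟨g', h', h1', h2'⟩ := key X (by simp)
  simp [coeff_X] at h1 h2 h1' h2'
  set l' := coeff 1 (constantCoeff U)
  set l := coeff 1 (constantCoeff V)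
  set μ' := constantCoeff (coeff 1 U)
  set m := constantCoeff (coeff 1 V)
  have hdet' : l' * m - l * μ' = 0 := by simpa using hdet
  have h2'' : 0 = g * μ' + h * m := by simpa [coeff_C] using h2
  have : (g * h' - h * g') * (l' * m - l * μ') = 1 := by
    linear_combination (-(g' * μ' + h' * m)) * h1 + (g' * l' + h' * l) * h2'' - h2'
  rw [hdet'] at this
  simp at this

theorem cusp_exponent_not_lt [CharZero K] {a b : ℕ} (ha : 2 ≤ a) (hab : a < b)
    (e : (PowerSeries (PowerSeries K) ⧸ cuspIdeal K a) ≃+*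
      (PowerSeries (PowerSeries K) ⧸ cuspIdeal K b)) : False := by
  obtain ⟨U, hU⟩ := Ideal.Quotient.mk_surjective (e (Ideal.Quotient.mk _ (C X)))
  obtain ⟨V, hV⟩ := Ideal.Quotient.mk_surjective (e (Ideal.Quotient.mk _ X))
  obtain ⟨hU0, hV0, hdet⟩ := linear_parts_independent ha (by omega) e hU hV
  have hrel : V ^ 2 - U ^ a ∈ cuspIdeal K b := by
    rw [← Ideal.Quotient.eq, map_pow, map_pow, hU, hV, ← map_pow, ← map_pow, ← map_pow, ← map_pow]
    congr 1
    rw [Ideal.Quotient.eq, ← map_pow]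
    exact Ideal.mem_span_singleton_self _
  obtain ⟨w, hw⟩ := Ideal.mem_span_singleton.1 hrel
  have c0 := congrArg (coeff 0) hw
  have c1 := congrArg (coeff 1) hw
  obtain ⟨a, rfl⟩ := Nat.exists_eq_add_of_le' ha
  set U₀ := coeff 0 U with hU₀
  set V₀ := coeff 0 V with hV₀
  set U₁ := coeff 1 U with hU₁
  set V₁ := coeff 1 V with hV₁
  have hpow : ∀ (N : ℕ), coeff 1 (U ^ (N + 1)) = (N + 1 : ℕ) * U₀ ^ N * U₁ := by
    intro N
    induction N with
    | zero => simp [hU₁]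
    | succ N ih =>
      rw [pow_succ, coeff_one_mul, ih, ← coeff_zero_eq_constantCoeff_apply, map_pow,
        coeff_zero_eq_constantCoeff_apply]
      push_cast
      simp only [hU₀, hU₁, coeff_zero_eq_constantCoeff_apply]
      ring
  have e0 : V₀ ^ 2 = U₀ ^ (a + 2) - X ^ b * coeff 0 w := by
    have : V₀ ^ 2 - U₀ ^ (a + 2) = - (X ^ b * coeff 0 w) := by
      simpa [hU₀, hV₀] using c0
    linear_combination this
  have e1 : 2 * V₀ * V₁ = ((a + 2 : ℕ) : PowerSeries K) * U₀ ^ (a + 1) * U₁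
      - X ^ b * coeff 1 w := by
    have h2 : coeff 1 (V ^ 2) = 2 * V₀ * V₁ := by
      rw [pow_two, coeff_one_mul, hV₀, hV₁, coeff_zero_eq_constantCoeff_apply]; ring
    have h3 : coeff 1 ((X ^ 2 - C (X ^ b)) * w) = - (X ^ b * coeff 1 w) := by
      rw [sub_mul, map_sub, coeff_C_mul, coeff_X_pow_mul']; simp
    rw [map_sub, h2, h3, hpow] at c1
    linear_combination c1
  have hU₀0 : constantCoeff U₀ = 0 := by simpa [hU₀] using hU0
  have hV₀0 : constantCoeff V₀ = 0 := by simpa [hV₀] using hV0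
  obtain ⟨U', hU'⟩ := PowerSeries.X_dvd_iff.2 hU₀0
  obtain ⟨V', hV'⟩ := PowerSeries.X_dvd_iff.2 hV₀0
  have hd : constantCoeff U' * constantCoeff V₁ - constantCoeff V' * constantCoeff U₁ ≠ 0 := by
    simpa [hU', hV', coeff_one_mul] using hdet
  obtain ⟨d, rfl⟩ := Nat.exists_eq_add_of_lt hab
  have e0' : V' ^ 2 = X ^ a * U' ^ (a + 2) - X ^ (a + d + 1) * coeff 0 w := by
    apply mul_left_cancel₀ (pow_ne_zero 2 (X_ne_zero (R := K)))
    rw [hU', hV'] at e0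
    linear_combination e0
  have e1' : 2 * V' * V₁ = ((a + 2 : ℕ) : PowerSeries K) * X ^ a * U' ^ (a + 1) * U₁
      - X ^ (a + d + 2) * coeff 1 w := by
    apply mul_left_cancel₀ (X_ne_zero (R := K))
    rw [hU', hV'] at e1
    linear_combination e1
  rcases Nat.eq_zero_or_pos a with rfl | hapos
  · have f0 := congrArg constantCoeff e0'
    have f1 := congrArg constantCoeff e1'
    have h2 : constantCoeff (2 : PowerSeries K) = 2 := map_ofNat _ 2
    simp [h2] at f0 f1
    set l := constantCoeff U'
    set m := constantCoeff V'
    have f1' : m * constantCoeff V₁ = l * constantCoeff U₁ := by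
      apply mul_left_cancel₀ (two_ne_zero (α := K)); linear_combination f1
    have hm : m = 0 := by
      apply (mul_eq_zero.1 _).resolve_left hd
      linear_combination l * f1' - constantCoeff U₁ * f0
    have hl : l = 0 := by
      rw [hm] at f0
      exact pow_eq_zero_iff two_ne_zero |>.1 (by simpa using f0.symm)
    apply hd
    rw [hm, hl]; ring
  · have f0 := congrArg constantCoeff e0'
    simp [hapos.ne'] at f0
    rw [f0, zero_mul, sub_zero] at hd
    have hV₁u : IsUnit (2 * V₁) := by
      rw [PowerSeries.isUnit_iff_constantCoeff, isUnit_iff_ne_zero]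
      have := right_ne_zero_of_mul hd
      have h2 : constantCoeff (2 : PowerSeries K) = 2 := map_ofNat _ 2
      simpa [h2] using this
    have hdvd : X ^ a ∣ V' := by
      rw [← hV₁u.dvd_mul_right, show V' * (2 * V₁) = 2 * V' * V₁ by ring, e1']
      refine dvd_sub (Dvd.intro (((a + 2 : ℕ) : PowerSeries K) * U' ^ (a + 1) * U₁) (by ring)) ?_
      exact Dvd.dvd.mul_right (pow_dvd_pow _ (by omega)) _
    have h2 : X ^ (a + 1) ∣ V' ^ 2 := by
      refine dvd_trans (pow_dvd_pow _ (by omega : a + 1 ≤ a * 2)) ?_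
      rw [pow_mul]; exact pow_dvd_pow_of_dvd hdvd 2
    rw [e0', dvd_sub_left (Dvd.dvd.mul_right (pow_dvd_pow _ (by omega)) _), pow_add,
      mul_dvd_mul_iff_left (pow_ne_zero _ X_ne_zero), pow_one, PowerSeries.X_dvd_iff, map_pow,
      pow_eq_zero_iff (by omega)] at h2
    exact left_ne_zero_of_mul hd h2

end PowerSeries

theorem cusp_exponent_unique [CharZero K] {a b : ℕ} (ha : 2 ≤ a) (hb : 2 ≤ b)
    (e : (PowerSeries (PowerSeries K) ⧸ cuspIdeal K a) ≃+*
      (PowerSeries (PowerSeries K) ⧸ cuspIdeal K b)) : a = b := by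
  rcases lt_trichotomy a b with h | h | h
  · exact (PowerSeries.cusp_exponent_not_lt ha h e).elim
  · exact h
  · exact (PowerSeries.cusp_exponent_not_lt hb h e.symm).elim

/-- The local algebra of the `A_s` singularity, written in `K[[u]][[v]]`. -/
def cuspQuotientEquiv (K : Type*) [Field K] (a : ℕ) :
    (MvPowerSeries (Fin 2) K ⧸ Ideal.span
          {(MvPowerSeries.X 1 : MvPowerSeries (Fin 2) K) ^ 2 - MvPowerSeries.X 0 ^ a}) ≃+*
      (PowerSeries (PowerSeries K) ⧸ cuspIdeal K a) :=
  Ideal.quotientEquiv _ _ (bivariateEquiv K) (by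
    rw [Ideal.map_span, Set.image_singleton]
    simp [cuspIdeal, bivariateEquiv_X_zero, bivariateEquiv_X_one])

theorem IsAsSing.unique [CharZero K] {F : MvPolynomial (Fin 3) K} {p : Fin 3 → K} (hp : p ≠ 0)
    {s s' : ℕ} (hs : 1 ≤ s) (hs' : 1 ≤ s') (h : IsAsSing F p s) (h' : IsAsSing F p s') :
    s = s' := by
  obtain ⟨c, hc⟩ := Function.ne_iff.1 hp
  obtain ⟨e, -⟩ := h c hc
  obtain ⟨e', -⟩ := h' c hc
  have := cusp_exponent_unique (by omega) (by omega)
    ((cuspQuotientEquiv K (s + 1)).symm.trans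
      ((e.symm.trans e').trans (cuspQuotientEquiv K (s' + 1))))
  omega

end

end

section

/-- A ring homomorphism that is dense and strict for adic topologies, with complete target,
identifies the adic completion of its source with its target. -/
theorem exists_adicCompletion_equiv {R T : Type*} [CommRing R] [CommRing T] (I : Ideal R)
    (N : Ideal T) [IsAdicComplete N T] (ψ : R →+* T) (hI : ∀ x ∈ I, ψ x ∈ N)
    (hdense : ∀ (n : ℕ) (t : T), ∃ x, t - ψ x ∈ N ^ n)
    (hstrict : ∀ (n : ℕ) (x : R), ψ x ∈ N ^ n → x ∈ I ^ n) :
    ∃ e : AdicCompletion I R ≃+* T, ∀ x, e (algebraMap R _ x) = ψ x := by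
  have hcomap (n : ℕ) : I ^ n ≤ (N ^ n).comap ψ := by
    rw [← Ideal.map_le_iff_le_comap, Ideal.map_pow]
    exact Ideal.pow_right_mono (Ideal.map_le_iff_le_comap.mpr hI) n
  let f (n : ℕ) : AdicCompletion I R →+* T ⧸ N ^ n :=
    (Ideal.quotientMap (N ^ n) ψ (hcomap n)).comp (AdicCompletion.evalₐ I n : _ →+* R ⧸ I ^ n)
  have hfmk (n : ℕ) (x : AdicCompletion.AdicCauchySequence I R) :
      f n (AdicCompletion.mk I R x) = Ideal.Quotient.mk _ (ψ (x n)) := by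
    simp only [f, RingHom.comp_apply]
    erw [AdicCompletion.evalₐ_mk]
    simp
  have hf {m n : ℕ} (hle : m ≤ n) : (Ideal.Quotient.factorPow N hle).comp (f n) = f m := by
    ext x
    obtain ⟨x, rfl⟩ := AdicCompletion.mk_surjective I R x
    rw [RingHom.comp_apply, hfmk, hfmk]
    have h := x.2 hle
    rw [SModEq.sub_mem] at h
    have h' : x.1 m - x.1 n ∈ I ^ m := by simpa using h
    have h2 := hcomap m h'
    rw [Ideal.mem_comap, map_sub] at h2
    have h3 := (Ideal.Quotient.eq (I := N ^ m)).2 h2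
    exact h3.symm
  let e := IsAdicComplete.liftRingHom N f hf
  have he (n : ℕ) (x) : Ideal.Quotient.mk (N ^ n) (e x) = f n x :=
    IsAdicComplete.mk_liftRingHom N f hf n x
  have hext {s t : T} (h : ∀ n, Ideal.Quotient.mk (N ^ n) s = Ideal.Quotient.mk (N ^ n) t) :
      s = t := by
    rw [← sub_eq_zero]
    refine IsHausdorff.haus (I := N) inferInstance _ fun n => ?_
    rw [SModEq.zero]
    simpa using Ideal.Quotient.eq.1 (h n)
  have hinj : Function.Injective e := by
    rw [injective_iff_map_eq_zero]
    intro x hx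
    obtain ⟨x, rfl⟩ := AdicCompletion.mk_surjective I R x
    refine AdicCompletion.ext_evalₐ fun n => ?_
    have h := he n (AdicCompletion.mk I R x)
    rw [hx, map_zero, hfmk, eq_comm, Ideal.Quotient.eq_zero_iff_mem] at h
    have h' := hstrict n _ h
    rw [AdicCompletion.evalₐ_mk, map_zero]
    exact Ideal.Quotient.eq_zero_iff_mem.2 h'
  have hsurj : Function.Surjective e := by
    intro t
    choose x hx using fun n => hdense n t
    have hc (n : ℕ) : x n ≡ x (n + 1) [SMOD (I ^ n • ⊤ : Submodule R R)] := by
      rw [SModEq.sub_mem]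
      have : x n - x (n + 1) ∈ I ^ n := by
        apply hstrict
        have h1 := (N ^ n).sub_mem (Ideal.pow_le_pow_right (Nat.le_succ n) (hx (n + 1))) (hx n)
        rw [map_sub]
        convert h1 using 1
        ring
      simpa using this
    refine ⟨AdicCompletion.mk I R (AdicCompletion.AdicCauchySequence.mk I R x hc), hext fun n => ?_⟩
    rw [he, hfmk]
    exact ((Ideal.Quotient.eq (I := N ^ n)).2 (hx n)).symm
  refine ⟨RingEquiv.ofBijective e ⟨hinj, hsurj⟩, fun x => hext fun n => ?_⟩
  refine (he n _).trans ?_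
  simp [f, AdicCompletion.algebraMap_apply]

/-- A quotient of a Noetherian ring complete for an ideal in its Jacobson radical is complete. -/
theorem isAdicComplete_quotient {P : Type*} [CommRing P] [IsNoetherianRing P] (M c : Ideal P)
    [IsAdicComplete M P] :
    IsAdicComplete (M.map (Ideal.Quotient.mk c)) (P ⧸ c) := by
  have hsurj : Function.Surjective (Submodule.mkQ c) := Submodule.mkQ_surjective c
  have hpre : IsPrecomplete M (P ⧸ c) := by
    rw [← AdicCompletion.of_surjective_iff]
    intro y
    obtain ⟨x, rfl⟩ := AdicCompletion.map_surjective M hsurj y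
    obtain ⟨x, rfl⟩ := AdicCompletion.of_surjective M P x
    exact ⟨_, (AdicCompletion.map_of M _ x).symm⟩
  have hhaus : IsHausdorff M (P ⧸ c) :=
    IsHausdorff.of_le_jacobson M _ (IsAdicComplete.le_jacobson_bot M)
  have : IsAdicComplete M (P ⧸ c) := ⟨⟩
  exact (IsAdicComplete.map_algebraMap_iff M (P ⧸ c) (S := P ⧸ c)).2 this

variable {K : Type*} [Field K]

/-- The maximal ideal of `K⟦u⟧⟦v⟧`. -/
abbrev bivariateIdeal (K : Type*) [Field K] : Ideal (PowerSeries (PowerSeries K)) :=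
  Ideal.span {PowerSeries.C PowerSeries.X, PowerSeries.X}

theorem map_bivariateEquiv_span_range_X :
    (Ideal.span (Set.range MvPowerSeries.X)).map (bivariateEquiv K) = bivariateIdeal K := by
  rw [Ideal.map_span]
  congr 1
  ext x
  simp [Fin.exists_fin_two, bivariateEquiv_X_zero, bivariateEquiv_X_one, eq_comm]

instance : IsAdicComplete (bivariateIdeal K) (PowerSeries (PowerSeries K)) := by
  rw [← map_bivariateEquiv_span_range_X]
  exact (IsAdicComplete.congr_ringEquiv _ (bivariateEquiv K)).2 inferInstance

instance (b : ℕ) : IsAdicComplete ((bivariateIdeal K).map (Ideal.Quotient.mk (cuspIdeal K b)))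
    (PowerSeries (PowerSeries K) ⧸ cuspIdeal K b) :=
  isAdicComplete_quotient _ _

end

section

section Graded

variable {K R : Type*} [Field K] [CommRing R] (κ : K →+* R) {I : Ideal R} {x : Fin 2 → R}

/-- Leading forms: if `I = (x₀, x₁) + I²` modulo constants, then elements of `I ^ i` are, modulo
`I ^ (i + 1)`, values at `x` of binary forms of degree `i`. -/
theorem exists_leading_form (hκ : ∀ y : R, ∃ c : K, y - κ c ∈ I) (hx : ∀ j, x j ∈ I)
    (hI : ∀ y ∈ I, ∃ c d : K, y - (κ c * x 0 + κ d * x 1) ∈ I ^ 2) (i : ℕ) :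
    ∀ y ∈ I ^ i, ∃ h : MvPolynomial (Fin 2) K, h.IsHomogeneous i ∧
      y - MvPolynomial.eval₂ κ x h ∈ I ^ (i + 1) := by
  induction i with
  | zero =>
    intro y _
    obtain ⟨c, hc⟩ := hκ y
    exact ⟨MvPolynomial.C c, MvPolynomial.isHomogeneous_C _ _, by simpa using hc⟩
  | succ i ih =>
    intro y hy
    rw [pow_succ] at hy
    refine Submodule.mul_induction_on hy ?_ ?_
    · intro y₁ hy₁ y₂ hy₂
      obtain ⟨h, hh, hy₁'⟩ := ih y₁ hy₁
      obtain ⟨c, d, hy₂'⟩ := hI y₂ hy₂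
      refine ⟨h * (MvPolynomial.C c * MvPolynomial.X 0 + MvPolynomial.C d * MvPolynomial.X 1),
        hh.mul (((MvPolynomial.isHomogeneous_C_mul_X _ _)).add
          (MvPolynomial.isHomogeneous_C_mul_X _ _)), ?_⟩
      simp only [MvPolynomial.eval₂_mul, MvPolynomial.eval₂_add, MvPolynomial.eval₂_C,
        MvPolynomial.eval₂_X]
      have e : y₁ * y₂ - MvPolynomial.eval₂ κ x h * (κ c * x 0 + κ d * x 1)
          = y₁ * (y₂ - (κ c * x 0 + κ d * x 1))
            + (y₁ - MvPolynomial.eval₂ κ x h) * (κ c * x 0 + κ d * x 1) := by ring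
      rw [e]
      refine Ideal.add_mem _ ?_ ?_
      · have := Ideal.mul_mem_mul hy₁ hy₂'
        rwa [← pow_add] at this
      · rw [pow_succ _ (i + 1)]
        exact Ideal.mul_mem_mul hy₁'
          (I.add_mem (I.mul_mem_left _ (hx 0)) (I.mul_mem_left _ (hx 1)))
    · rintro y₁ y₂ ⟨h₁, hh₁, h1⟩ ⟨h₂, hh₂, h2⟩
      refine ⟨h₁ + h₂, hh₁.add hh₂, ?_⟩
      rw [MvPolynomial.eval₂_add, add_sub_add_comm]
      exact Ideal.add_mem _ h1 h2

theorem pow_sub_pow_mem_pow_succ {a b : R} (ha : a ∈ I) (hb : b ∈ I) (hab : a - b ∈ I ^ 2)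
    (j : ℕ) : a ^ j - b ^ j ∈ I ^ (j + 1) := by
  induction j with
  | zero => simp
  | succ j ih =>
    have e : a ^ (j + 1) - b ^ (j + 1) = (a ^ j - b ^ j) * a + b ^ j * (a - b) := by ring
    rw [e]
    refine Ideal.add_mem _ ?_ ?_
    · rw [pow_succ _ (j + 1)]
      exact Ideal.mul_mem_mul ih ha
    · have := Ideal.mul_mem_mul (Ideal.pow_mem_pow hb j) hab
      rwa [← pow_add] at this

/-- Changing the arguments of a form of degree `i` to second order changes its value to order
`i + 1`. -/
theorem eval₂_sub_eval₂_mem {x' : Fin 2 → R} (hx : ∀ j, x j ∈ I) (hx' : ∀ j, x' j ∈ I)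
    (hxx' : ∀ j, x j - x' j ∈ I ^ 2) {i : ℕ} {h : MvPolynomial (Fin 2) K}
    (hh : h.IsHomogeneous i) :
    MvPolynomial.eval₂ κ x h - MvPolynomial.eval₂ κ x' h ∈ I ^ (i + 1) := by
  rw [MvPolynomial.eval₂_eq', MvPolynomial.eval₂_eq', ← Finset.sum_sub_distrib]
  refine Ideal.sum_mem _ fun d hd => ?_
  have hdeg : d 0 + d 1 = i := by
    have := hh (MvPolynomial.mem_support_iff.1 hd)
    simpa [Finsupp.weight_apply, Finsupp.sum_fintype] using this
  rw [Fin.prod_univ_two, Fin.prod_univ_two, ← mul_sub]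
  refine Ideal.mul_mem_left _ _ ?_
  have e : x 0 ^ d 0 * x 1 ^ d 1 - x' 0 ^ d 0 * x' 1 ^ d 1
      = (x 0 ^ d 0 - x' 0 ^ d 0) * x 1 ^ d 1 + x' 0 ^ d 0 * (x 1 ^ d 1 - x' 1 ^ d 1) := by ring
  rw [e]
  refine Ideal.add_mem _ ?_ ?_
  · have := Ideal.mul_mem_mul (pow_sub_pow_mem_pow_succ (hx 0) (hx' 0) (hxx' 0) (d 0))
      (Ideal.pow_mem_pow (hx 1) (d 1))
    rwa [← pow_add, show d 0 + 1 + d 1 = i + 1 by omega] at this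
  · have := Ideal.mul_mem_mul (Ideal.pow_mem_pow (hx' 0) (d 0))
      (pow_sub_pow_mem_pow_succ (hx 1) (hx' 1) (hxx' 1) (d 1))
    rwa [← pow_add, show d 0 + (d 1 + 1) = i + 1 by omega] at this

end Graded

variable {K : Type*} [Field K]


/-- Constants in `K⟦u⟧⟦v⟧`. -/
abbrev bivariateC (K : Type*) [Field K] : K →+* PowerSeries (PowerSeries K) :=
  (PowerSeries.C (R := PowerSeries K)).comp (PowerSeries.C (R := K))

/-- The coordinates of `K⟦u⟧⟦v⟧`. -/
abbrev bivariateVars (K : Type*) [Field K] : Fin 2 → PowerSeries (PowerSeries K) :=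
  ![PowerSeries.C PowerSeries.X, PowerSeries.X]

theorem bivariateVars_mem (j : Fin 2) : bivariateVars K j ∈ bivariateIdeal K := by
  fin_cases j
  · exact Ideal.subset_span (by simp)
  · exact Ideal.subset_span (by simp)

theorem mem_bivariateIdeal_iff {W : PowerSeries (PowerSeries K)} :
    W ∈ bivariateIdeal K ↔ PowerSeries.constantCoeff (PowerSeries.constantCoeff W) = 0 := by
  constructor
  · intro h
    rw [Ideal.mem_span_pair] at h
    obtain ⟨g, h, rfl⟩ := h
    simp
  · intro h
    obtain ⟨g, h, rfl⟩ := PowerSeries.exists_eq_of_constantCoeff_eq_zero h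
    exact Ideal.add_mem _ (Ideal.mul_mem_right _ _ (bivariateVars_mem 0))
      (Ideal.mul_mem_right _ _ (bivariateVars_mem 1))

theorem coeff_coeff_eq_zero_of_mem_pow {i : ℕ} {W : PowerSeries (PowerSeries K)}
    (hW : W ∈ bivariateIdeal K ^ i) :
    ∀ j l : ℕ, j + l < i → PowerSeries.coeff j (PowerSeries.coeff l W) = 0 := by
  induction i generalizing W with
  | zero => intro j l h; omega
  | succ i ih =>
    rw [pow_succ] at hW
    refine Submodule.mul_induction_on hW ?_ ?_
    · intro y₁ hy₁ y₂ hy₂ j l hjl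
      obtain ⟨g, h, rfl⟩ := PowerSeries.exists_eq_of_constantCoeff_eq_zero
        (mem_bivariateIdeal_iff.1 hy₂)
      have hg := ih (Ideal.mul_mem_right g _ hy₁)
      have hh := ih (Ideal.mul_mem_right h _ hy₁)
      have e : y₁ * (PowerSeries.C PowerSeries.X * g + PowerSeries.X * h)
        = PowerSeries.C PowerSeries.X * (y₁ * g) + PowerSeries.X * (y₁ * h) := by ring
      rw [e, map_add, map_add, PowerSeries.coeff_C_mul]
      have h1 : PowerSeries.coeff j (PowerSeries.X * PowerSeries.coeff l (y₁ * g)) = 0 := by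
        cases j with
        | zero => simp
        | succ j => rw [PowerSeries.coeff_succ_X_mul]; exact hg _ _ (by omega)
      have h2 : PowerSeries.coeff j (PowerSeries.coeff l (PowerSeries.X * (y₁ * h))) = 0 := by
        cases l with
        | zero => simp
        | succ l => rw [PowerSeries.coeff_succ_X_mul]; exact hh _ _ (by omega)
      rw [h1, h2, add_zero]
    · intro y₁ y₂ h1 h2 j l hjl
      rw [map_add, map_add, h1 j l hjl, h2 j l hjl, add_zero]

theorem coeff_coeff_eval₂_vars (h : MvPolynomial (Fin 2) K) (d : Fin 2 →₀ ℕ) :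
    PowerSeries.coeff (d 0) (PowerSeries.coeff (d 1)
      (MvPolynomial.eval₂ (bivariateC K) (bivariateVars K) h)) = MvPolynomial.coeff d h := by
  induction h using MvPolynomial.induction_on' with
  | monomial e c =>
    have h1 : MvPolynomial.eval₂ (bivariateC K) (bivariateVars K) (MvPolynomial.monomial e c)
        = PowerSeries.C (PowerSeries.C c * PowerSeries.X ^ e 0) * PowerSeries.X ^ e 1 := by
      rw [MvPolynomial.eval₂_monomial, Finsupp.prod_fintype _ _ (by simp), Fin.prod_univ_two]
      simp [mul_assoc]
    rw [h1, PowerSeries.coeff_C_mul, PowerSeries.coeff_X_pow, MvPolynomial.coeff_monomial]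
    have hed : e = d ↔ d 0 = e 0 ∧ d 1 = e 1 := by
      constructor
      · rintro rfl; simp
      · rintro ⟨h0, h1⟩; ext i; fin_cases i <;> simp [h0, h1]
    by_cases h1 : d 1 = e 1
    · by_cases h0 : d 0 = e 0
      · simp [hed, h0, h1, PowerSeries.coeff_X_pow]
      · simp [hed, h0, h1, PowerSeries.coeff_X_pow]
    · simp [hed, h1]
  | add p q hp hq => rw [MvPolynomial.eval₂_add, map_add, map_add, hp, hq, MvPolynomial.coeff_add]

theorem exists_linear_bivariate {W : PowerSeries (PowerSeries K)} (hW : W ∈ bivariateIdeal K) :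
    ∃ c d : K, W - (bivariateC K c * bivariateVars K 0 + bivariateC K d * bivariateVars K 1)
      ∈ bivariateIdeal K ^ 2 := by
  obtain ⟨g, h, rfl⟩ := PowerSeries.exists_eq_of_constantCoeff_eq_zero (mem_bivariateIdeal_iff.1 hW)
  refine ⟨PowerSeries.constantCoeff (PowerSeries.constantCoeff g),
    PowerSeries.constantCoeff (PowerSeries.constantCoeff h), ?_⟩
  have hsub (g : PowerSeries (PowerSeries K)) :
      g - bivariateC K (PowerSeries.constantCoeff (PowerSeries.constantCoeff g))
        ∈ bivariateIdeal K := by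
    rw [mem_bivariateIdeal_iff]; simp
  have e := Ideal.add_mem _ (Ideal.mul_mem_mul (hsub g) (bivariateVars_mem 0))
    (Ideal.mul_mem_mul (hsub h) (bivariateVars_mem 1))
  rw [← pow_two] at e
  convert e using 1
  simp only [bivariateVars, Matrix.cons_val_zero, Matrix.cons_val_one]
  ring

theorem exists_sub_bivariateC_mem (W : PowerSeries (PowerSeries K)) :
    ∃ c : K, W - bivariateC K c ∈ bivariateIdeal K :=
  ⟨PowerSeries.constantCoeff (PowerSeries.constantCoeff W), by
    rw [mem_bivariateIdeal_iff]; simp⟩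

section Chart

variable {a : Fin 2 → K} (Ψ : MvPolynomial (Fin 2) K →+* PowerSeries (PowerSeries K))
  {y : Fin 2 → MvPolynomial (Fin 2) K}

theorem map_eval₂_sub_mem
    (hC : ∀ c, Ψ (MvPolynomial.C c) = PowerSeries.C (PowerSeries.C c))
    (hm : ∀ y ∈ mAt a, Ψ y ∈ bivariateIdeal K) (hy : ∀ j, y j ∈ mAt a)
    (hΨy : ∀ j, Ψ (y j) - bivariateVars K j ∈ bivariateIdeal K ^ 2)
    {i : ℕ} {h : MvPolynomial (Fin 2) K} (hh : h.IsHomogeneous i) :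
    Ψ (MvPolynomial.eval₂ MvPolynomial.C y h)
      - MvPolynomial.eval₂ (bivariateC K) (bivariateVars K) h ∈ bivariateIdeal K ^ (i + 1) := by
  have e : Ψ (MvPolynomial.eval₂ MvPolynomial.C y h)
      = MvPolynomial.eval₂ (bivariateC K) (fun j => Ψ (y j)) h := by
    rw [MvPolynomial.hom_eval₂]
    congr 1
    ext c : 1
    exact hC c
  rw [e]
  exact eval₂_sub_eval₂_mem _ (fun j => hm _ (hy j)) bivariateVars_mem hΨy hh

theorem exists_sub_map_mem
    (hC : ∀ c, Ψ (MvPolynomial.C c) = PowerSeries.C (PowerSeries.C c))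
    (hm : ∀ y ∈ mAt a, Ψ y ∈ bivariateIdeal K) (hy : ∀ j, y j ∈ mAt a)
    (hΨy : ∀ j, Ψ (y j) - bivariateVars K j ∈ bivariateIdeal K ^ 2)
    (N : ℕ) (W : PowerSeries (PowerSeries K)) :
    ∃ z, W - Ψ z ∈ bivariateIdeal K ^ N := by
  induction N with
  | zero => exact ⟨0, by simp⟩
  | succ N ih =>
    obtain ⟨z, hz⟩ := ih
    obtain ⟨h, hh, hW⟩ := exists_leading_form (bivariateC K) exists_sub_bivariateC_mem
      bivariateVars_mem (fun _ => exists_linear_bivariate) N _ hz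
    refine ⟨z + MvPolynomial.eval₂ MvPolynomial.C y h, ?_⟩
    have := Ideal.sub_mem _ hW (map_eval₂_sub_mem Ψ hC hm hy hΨy hh)
    convert this using 1
    rw [map_add]
    ring

theorem mAt_linear
    (hC : ∀ c, Ψ (MvPolynomial.C c) = PowerSeries.C (PowerSeries.C c))
    (hm : ∀ y ∈ mAt a, Ψ y ∈ bivariateIdeal K) (hy : ∀ j, y j ∈ mAt a)
    (hΨy : ∀ j, Ψ (y j) - bivariateVars K j ∈ bivariateIdeal K ^ 2)
    {z : MvPolynomial (Fin 2) K} (hz : z ∈ mAt a) :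
    ∃ c d : K, z - (MvPolynomial.C c * y 0 + MvPolynomial.C d * y 1) ∈ mAt a ^ 2 := by
  have hm2 : ∀ z ∈ mAt a ^ 2, Ψ z ∈ bivariateIdeal K ^ 2 := by
    have : (mAt a ^ 2).map Ψ ≤ bivariateIdeal K ^ 2 := by
      rw [Ideal.map_pow]
      exact Ideal.pow_right_mono (Ideal.map_le_iff_le_comap.mpr hm) 2
    exact fun z hz => this (Ideal.mem_map_of_mem _ hz)
  have key (c d : K) (h : MvPolynomial.C c * y 0 + MvPolynomial.C d * y 1 ∈ mAt a ^ 2) :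
      c = 0 ∧ d = 0 := by
    have h1 := hm2 _ h
    have h2 := Ideal.sub_mem _ h1 (Ideal.add_mem _
      (Ideal.mul_mem_left _ (Ψ (MvPolynomial.C c)) (hΨy 0))
      (Ideal.mul_mem_left _ (Ψ (MvPolynomial.C d)) (hΨy 1)))
    have h3 := coeff_coeff_eq_zero_of_mem_pow h2
    simp only [map_add, map_mul, hC] at h3
    have e0 := h3 1 0 (by norm_num)
    have e1 := h3 0 1 (by norm_num)
    simp [mul_sub] at e0 e1
    exact ⟨e0, e1⟩
  obtain ⟨d, hd⟩ := mAt_le_of_arc a (b := y 0) (z := y 1) (hy 0)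
    (fun h => one_ne_zero (key 1 0 (by simpa using h)).1) (hy 1)
    (fun l h => one_ne_zero (key (-l) 1 (by
      convert h using 1
      rw [map_neg, map_one]; ring)).2) hz
  obtain ⟨w, hw, t, ht, hwt⟩ := Submodule.mem_sup.1 hd
  obtain ⟨g, rfl⟩ := Ideal.mem_span_singleton'.1 hw
  refine ⟨MvPolynomial.eval a g, d, ?_⟩
  have hg : g - MvPolynomial.C (MvPolynomial.eval a g) ∈ mAt a := by
    rw [RingHom.mem_ker]; simp
  have h4 := Ideal.mul_mem_mul hg (hy 0)
  rw [← pow_two] at h4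
  have := Ideal.add_mem _ h4 ht
  convert this using 1
  linear_combination -hwt

theorem mem_mAt_pow_of_map_mem
    (hC : ∀ c, Ψ (MvPolynomial.C c) = PowerSeries.C (PowerSeries.C c))
    (hm : ∀ y ∈ mAt a, Ψ y ∈ bivariateIdeal K) (hy : ∀ j, y j ∈ mAt a)
    (hΨy : ∀ j, Ψ (y j) - bivariateVars K j ∈ bivariateIdeal K ^ 2)
    (N : ℕ) {z : MvPolynomial (Fin 2) K}
    (hz : Ψ z ∈ bivariateIdeal K ^ N) : z ∈ mAt a ^ N := by
  induction N with
  | zero => simp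
  | succ N ih =>
    obtain ⟨h, hh, hzh⟩ := exists_leading_form (I := mAt a) (x := y) MvPolynomial.C
      (fun w => ⟨MvPolynomial.eval a w, by rw [RingHom.mem_ker]; simp⟩) hy
      (fun _ => mAt_linear Ψ hC hm hy hΨy) N z (ih (Ideal.pow_le_pow_right N.le_succ hz))
    have hmN : Ψ (z - MvPolynomial.eval₂ MvPolynomial.C y h) ∈ bivariateIdeal K ^ (N + 1) := by
      have : (mAt a ^ (N + 1)).map Ψ ≤ bivariateIdeal K ^ (N + 1) := by
        rw [Ideal.map_pow]
        exact Ideal.pow_right_mono (Ideal.map_le_iff_le_comap.mpr hm) _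
      exact this (Ideal.mem_map_of_mem _ hzh)
    have h1 : MvPolynomial.eval₂ (bivariateC K) (bivariateVars K) h
        ∈ bivariateIdeal K ^ (N + 1) := by
      have := Ideal.sub_mem _ (Ideal.sub_mem _ hz hmN) (map_eval₂_sub_mem Ψ hC hm hy hΨy hh)
      convert this using 1
      rw [map_sub]
      ring
    have h0 : h = 0 := by
      ext d
      by_contra hd
      have hdeg : d 0 + d 1 = N := by
        have := hh hd
        simpa [Finsupp.weight_apply, Finsupp.sum_fintype] using this
      apply hd
      rw [← coeff_coeff_eval₂_vars, coeff_coeff_eq_zero_of_mem_pow h1 _ _ (by omega),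
        MvPolynomial.coeff_zero]
    simpa [h0] using hzh

theorem exists_localCompletion_equiv
    (hC : ∀ c, Ψ (MvPolynomial.C c) = PowerSeries.C (PowerSeries.C c))
    (hm : ∀ y ∈ mAt a, Ψ y ∈ bivariateIdeal K) (hy : ∀ j, y j ∈ mAt a)
    (hΨy : ∀ j, Ψ (y j) - bivariateVars K j ∈ bivariateIdeal K ^ 2)
    {F : MvPolynomial (Fin 2) K} {b : ℕ}
    {q : PowerSeries (PowerSeries K)} (hq : IsUnit q)
    (hF : Ψ F = q * (PowerSeries.X ^ 2 - PowerSeries.C (PowerSeries.X ^ b))) :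
    ∃ e : LocalCompletion (Ideal.span {F}) a ≃+* (PowerSeries (PowerSeries K) ⧸ cuspIdeal K b),
      ∀ r : K, e (algebraMap (LocalRingAt (Ideal.span {F}) a) _ (algebraMap K _ r))
        = Ideal.Quotient.mk _ (bivariateC K r) := by
  set J := Ideal.span {F}
  let Mn := ((RingHom.ker (MvPolynomial.eval a : MvPolynomial (Fin 2) K →+* K)).primeCompl).map
      (Ideal.Quotient.mk J)
  let π := Ideal.Quotient.mk (cuspIdeal K b)
  have hπF : π (Ψ F) = 0 := by
    rw [Ideal.Quotient.eq_zero_iff_mem, hF]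
    exact Ideal.mul_mem_left _ _ (Ideal.subset_span rfl)
  let g : MvPolynomial (Fin 2) K ⧸ J →+* PowerSeries (PowerSeries K) ⧸ cuspIdeal K b :=
    Ideal.Quotient.lift J (π.comp Ψ) (by
      intro z hz
      obtain ⟨w, rfl⟩ := Ideal.mem_span_singleton'.1 hz
      rw [map_mul, RingHom.comp_apply _ _ F, hπF, mul_zero])
  have hunit {s : MvPolynomial (Fin 2) K} (hs : MvPolynomial.eval a s ≠ 0) : IsUnit (Ψ s) := by
    rw [PowerSeries.isUnit_bivariate_iff]
    have : s - MvPolynomial.C (MvPolynomial.eval a s) ∈ mAt a := by rw [RingHom.mem_ker]; simp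
    have h := mem_bivariateIdeal_iff.1 (hm _ this)
    rw [map_sub, hC, map_sub, map_sub, sub_eq_zero] at h
    rw [h]
    simpa using hs
  have hg (s : Mn) : IsUnit (g s) := by
    obtain ⟨_, s, hs, rfl⟩ := s
    have : IsUnit (π (Ψ s)) := (hunit (fun h0 => hs (by simpa using h0))).map π
    simpa [g] using this
  let ψ : LocalRingAt J a →+* PowerSeries (PowerSeries K) ⧸ cuspIdeal K b :=
    IsLocalization.lift (M := Mn) (S := Localization Mn) hg
  have hψ (z : MvPolynomial (Fin 2) K) : ψ (algebraMap _ _ z) = π (Ψ z) :=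
    IsLocalization.lift_eq (M := Mn) (S := Localization Mn) hg (Ideal.Quotient.mk J z)
  have hNpow (n : ℕ) : (bivariateIdeal K).map π ^ n = (bivariateIdeal K ^ n).map π :=
    (Ideal.map_pow _ _ _).symm
  suffices h : ∃ e : AdicCompletion
      ((mAt a).map (algebraMap (MvPolynomial (Fin 2) K) (LocalRingAt J a))) (LocalRingAt J a)
        ≃+* (PowerSeries (PowerSeries K) ⧸ cuspIdeal K b), ∀ x, e (algebraMap (LocalRingAt J a) _ x)
            = ψ x by
    obtain ⟨e, he⟩ := h
    refine ⟨e, fun r => ?_⟩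
    refine (he _).trans ?_
    rw [← LocalRingAt.algebraMap_C, hψ, hC]
    rfl
  refine exists_adicCompletion_equiv
    ((mAt a).map (algebraMap (MvPolynomial (Fin 2) K) (LocalRingAt J a)))
    ((bivariateIdeal K).map π) ψ ?_ ?_ ?_
  · have : (mAt a).map (algebraMap (MvPolynomial (Fin 2) K) (LocalRingAt J a))
        ≤ ((bivariateIdeal K).map π).comap ψ := by
      rw [Ideal.map_le_iff_le_comap]
      intro z hz
      rw [Ideal.mem_comap, Ideal.mem_comap, hψ]
      exact Ideal.mem_map_of_mem _ (hm z hz)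
    exact fun x hx => this hx
  · intro n t
    obtain ⟨W, rfl⟩ := Ideal.Quotient.mk_surjective t
    obtain ⟨z, hz⟩ := exists_sub_map_mem Ψ hC hm hy hΨy n W
    refine ⟨algebraMap _ _ z, ?_⟩
    rw [hψ, hNpow]
    exact Ideal.mem_map_of_mem π hz
  · intro n x hx
    obtain ⟨z, s, hs, hxs⟩ := LocalRingAt.exists_mul_eq J a x
    have h1 : π (Ψ z) ∈ (bivariateIdeal K ^ n).map π := by
      rw [← hψ, ← hxs, map_mul, ← hNpow]
      exact Ideal.mul_mem_right _ _ hx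
    obtain ⟨w, hw, hwz⟩ := (Ideal.mem_map_iff_of_surjective π Ideal.Quotient.mk_surjective).1 h1
    obtain ⟨g', hg'⟩ := Ideal.mem_span_singleton'.1 (Ideal.Quotient.eq.1 hwz)
    obtain ⟨qi, hqi⟩ := hq.exists_right_inv
    obtain ⟨z', hz'⟩ := exists_sub_map_mem Ψ hC hm hy hΨy n (-(g' * qi))
    have h2 : Ψ (z - z' * F) ∈ bivariateIdeal K ^ n := by
      have := Ideal.add_mem _ hw (Ideal.mul_mem_right (Ψ F) _ hz')
      convert this using 1
      rw [map_sub, map_mul]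
      have : g' * qi * Ψ F = w - Ψ z := by
        rw [← hg', hF]
        linear_combination g' * (PowerSeries.X ^ 2 - PowerSeries.C (PowerSeries.X ^ b)) * hqi
      linear_combination this
    have h3 := mem_mAt_pow_of_map_mem Ψ hC hm hy hΨy n h2
    have h4 : algebraMap (MvPolynomial (Fin 2) K) (LocalRingAt J a) z
        = algebraMap (MvPolynomial (Fin 2) K) (LocalRingAt J a) (z - z' * F) := by
      rw [map_sub, eq_comm, sub_eq_self, LocalRingAt.algebraMap_eq_zero_iff]
      exact ⟨1, by simp, by
        rw [one_mul]; exact Ideal.mul_mem_left _ _ (Ideal.subset_span rfl)⟩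
    obtain ⟨si, hsi⟩ := (LocalRingAt.isUnit_algebraMap J a hs).exists_right_inv
    have h5 : x = algebraMap (MvPolynomial (Fin 2) K) (LocalRingAt J a) (z - z' * F) * si := by
      rw [← h4, ← hxs, mul_assoc, hsi, mul_one]
    rw [h5, ← Ideal.map_pow]
    exact Ideal.mul_mem_right _ _ (Ideal.mem_map_of_mem _ h3)

end Chart

end

section

variable {K : Type*} [Field K]

theorem dehomMap_self (c : Fin 3) : dehomMap (K := K) c c = 1 := by simp [dehomMap]

theorem dehomMap_chartEmb (c : Fin 3) (i : Fin 2) :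
    dehomMap (K := K) c (chartEmb c i) = MvPolynomial.X i := by
  fin_cases c <;> fin_cases i <;> simp [dehomMap, chartEmb]

theorem eq_or_exists_chartEmb (c j : Fin 3) : j = c ∨ ∃ i, j = chartEmb c i := by
  revert c j
  decide

/-- Evaluating the dehomogenization of a polynomial at a point of the chart. -/
theorem eval₂_dehomMap {R : Type*} [CommRing R] (κ : K →+* R) {w : Fin 3 → R} {c : Fin 3} {wi : R}
    (hw : w c * wi = 1) (j : Fin 3) :
    MvPolynomial.eval₂ κ (fun i => w (chartEmb c i) * wi) (dehomMap c j) = w j * wi := by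
  obtain rfl | ⟨i, rfl⟩ := eq_or_exists_chartEmb c j
  · simp [dehomMap_self, hw]
  · simp [dehomMap_chartEmb]

theorem eval₂_aeval_dehomMap {R : Type*} [CommRing R] (κ : K →+* R) {w : Fin 3 → R} {c : Fin 3}
    {wi : R} (hw : w c * wi = 1) (F : MvPolynomial (Fin 3) K) :
    MvPolynomial.eval₂ κ (fun i => w (chartEmb c i) * wi)
        (MvPolynomial.aeval (dehomMap c) F)
      = MvPolynomial.eval₂ κ (fun j => w j * wi) F := by
  have h := MvPolynomial.hom_eval₂ F MvPolynomial.C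
    (MvPolynomial.eval₂Hom κ (fun i => w (chartEmb c i) * wi)) (dehomMap c)
  have hκ : (MvPolynomial.eval₂Hom κ (fun i => w (chartEmb c i) * wi)).comp MvPolynomial.C = κ := by
    ext; simp
  rw [hκ] at h
  refine h.trans (congrArg (fun v => MvPolynomial.eval₂ κ v F) ?_)
  funext j
  exact eval₂_dehomMap κ hw j

theorem eval₂_mul_of_isHomogeneous {σ K R : Type*} [Fintype σ] [CommRing K] [CommRing R]
    (κ : K →+* R)
    {F : MvPolynomial σ K} {n : ℕ} (hF : F.IsHomogeneous n) (w : σ → R) (r : R) :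
    MvPolynomial.eval₂ κ (fun j => w j * r) F = r ^ n * MvPolynomial.eval₂ κ w F := by
  rw [MvPolynomial.eval₂_eq', MvPolynomial.eval₂_eq', Finset.mul_sum]
  refine Finset.sum_congr rfl fun d hd => ?_
  have hdeg : ∑ i, d i = n := by
    have := hF (MvPolynomial.mem_support_iff.1 hd)
    simpa [Finsupp.weight_apply, Finsupp.sum_fintype] using this
  simp only [mul_pow, Finset.prod_mul_distrib, Finset.prod_pow_eq_pow_sum, hdeg]
  ring

theorem isAsSing_of_expansion {n : ℕ} {F : MvPolynomial (Fin 3) K} (hF : F.IsHomogeneous n)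
    {p e₁ e₂ ℓ₁ ℓ₂ : Fin 3 → K}
    (h1p : ∑ j, ℓ₁ j * p j = 0) (h11 : ∑ j, ℓ₁ j * e₁ j = 1) (h12 : ∑ j, ℓ₁ j * e₂ j = 0)
    (h2p : ∑ j, ℓ₂ j * p j = 0) (h21 : ∑ j, ℓ₂ j * e₁ j = 0) (h22 : ∑ j, ℓ₂ j * e₂ j = 1)
    {α η : PowerSeries K} (hα : PowerSeries.constantCoeff α = 0)
    (hη : PowerSeries.constantCoeff η ≠ 0) {s : ℕ} {q : PowerSeries (PowerSeries K)}
    (hq : IsUnit q)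
    (hFw : MvPolynomial.eval₂ (bivariateC K) (fun j => bivariateC K (p j)
      + bivariateC K (e₁ j) * PowerSeries.C PowerSeries.X
      + bivariateC K (e₂ j) * (PowerSeries.C α + PowerSeries.C η * PowerSeries.X)) F
        = q * (PowerSeries.X ^ 2 - PowerSeries.C (PowerSeries.X ^ (s + 1)))) :
    IsAsSing F p s := by
  intro c hc
  set w : Fin 3 → PowerSeries (PowerSeries K) := fun j => bivariateC K (p j)
      + bivariateC K (e₁ j) * PowerSeries.C PowerSeries.X
      + bivariateC K (e₂ j) * (PowerSeries.C α + PowerSeries.C η * PowerSeries.X) with hw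
  have hcw (j : Fin 3) : PowerSeries.constantCoeff (PowerSeries.constantCoeff (w j)) = p j := by
    simp [hw, hα]
  obtain ⟨wi, hwi⟩ := (PowerSeries.isUnit_bivariate_iff.2 (by rw [hcw]; exact hc)).exists_right_inv
  have hcwi : p c * PowerSeries.constantCoeff (PowerSeries.constantCoeff wi) = 1 := by
    rw [← hcw c, ← map_mul, ← map_mul, hwi, map_one, map_one]
  set Ψ := MvPolynomial.eval₂Hom (bivariateC K) (fun i => w (chartEmb c i) * wi) with hΨ
  have hC (r : K) : Ψ (MvPolynomial.C r) = PowerSeries.C (PowerSeries.C r) := by simp [hΨ]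
  have hcΨ (z : MvPolynomial (Fin 2) K) :
      PowerSeries.constantCoeff (PowerSeries.constantCoeff (Ψ z))
        = MvPolynomial.eval (affOf p c) z := by
    have : ((PowerSeries.constantCoeff (R := K)).comp
        (PowerSeries.constantCoeff (R := PowerSeries K))).comp Ψ
        = MvPolynomial.eval (affOf p c) := by
      apply MvPolynomial.ringHom_ext
      · intro r; simp [hC]
      · intro i
        have : PowerSeries.constantCoeff (PowerSeries.constantCoeff wi) = (p c)⁻¹ :=
          eq_inv_of_mul_eq_one_right hcwi
        simp [hΨ, hcw, affOf, this, div_eq_mul_inv]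
    exact RingHom.congr_fun this z
  have hmem (z : MvPolynomial (Fin 2) K) : Ψ z ∈ bivariateIdeal K ↔ z ∈ mAt (affOf p c) := by
    rw [mem_bivariateIdeal_iff, hcΨ, RingHom.mem_ker]
  let L (ℓ : Fin 3 → K) : MvPolynomial (Fin 2) K := ∑ j, MvPolynomial.C (ℓ j) * dehomMap c j
  have hL (ℓ : Fin 3 → K) : Ψ (L ℓ) = (bivariateC K (∑ j, ℓ j * p j)
      + bivariateC K (∑ j, ℓ j * e₁ j) * PowerSeries.C PowerSeries.X
      + bivariateC K (∑ j, ℓ j * e₂ j) * (PowerSeries.C α + PowerSeries.C η * PowerSeries.X))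
        * wi := by
    have hd (j : Fin 3) : Ψ (dehomMap c j) = w j * wi := eval₂_dehomMap _ hwi j
    simp only [L, Fin.sum_univ_three, map_add, map_mul, hd, hC]
    simp only [hw, RingHom.comp_apply]
    ring
  have hX0 : PowerSeries.C PowerSeries.X ∈ bivariateIdeal K := bivariateVars_mem 0
  have hX1 : PowerSeries.X ∈ bivariateIdeal K := bivariateVars_mem 1
  let α₁ := PowerSeries.coeff 1 α
  let η₀ := PowerSeries.constantCoeff η
  have hα2 : ∃ g, α = PowerSeries.C α₁ * PowerSeries.X + PowerSeries.X ^ 2 * g := by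
    have : PowerSeries.X ^ 2 ∣ α - PowerSeries.C α₁ * PowerSeries.X := by
      rw [PowerSeries.X_pow_dvd_iff]
      intro m hm
      interval_cases m
      · simp [hα]
      · simp [α₁]
    obtain ⟨g, hg⟩ := this
    exact ⟨g, by linear_combination hg⟩
  obtain ⟨g, hg⟩ := hα2
  let y : Fin 2 → MvPolynomial (Fin 2) K := ![MvPolynomial.C (p c) * L ℓ₁,
    MvPolynomial.C (p c * η₀⁻¹) * (L ℓ₂ - MvPolynomial.C α₁ * L ℓ₁)]
  have hΨy (j : Fin 2) : Ψ (y j) - bivariateVars K j ∈ bivariateIdeal K ^ 2 := by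
    fin_cases j
    · simp only [y, Fin.zero_eta, Matrix.cons_val_zero, map_mul, hL, h1p, h11, h12, hC]
      have h : (PowerSeries.C (PowerSeries.C (p c)) * wi - 1) * PowerSeries.C PowerSeries.X
          ∈ bivariateIdeal K ^ 2 := by
        rw [pow_two]
        refine Ideal.mul_mem_mul ?_ hX0
        rw [mem_bivariateIdeal_iff]
        simp [hcwi]
      convert h using 1
      simp
      ring
    · change Ψ (MvPolynomial.C (p c * η₀⁻¹) * (L ℓ₂ - MvPolynomial.C α₁ * L ℓ₁))
        - PowerSeries.X ∈ _
      simp only [map_mul, map_sub, hL, h1p, h11, h12, h2p, h21, h22, hC]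
      have h : (PowerSeries.C (PowerSeries.C (p c)) * PowerSeries.C (PowerSeries.C η₀⁻¹)
            * wi * PowerSeries.C η - 1) * PowerSeries.X
          + (PowerSeries.C (PowerSeries.C (p c)) * PowerSeries.C (PowerSeries.C η₀⁻¹)
            * wi * PowerSeries.C g) * PowerSeries.C PowerSeries.X ^ 2
          ∈ bivariateIdeal K ^ 2 := by
        refine Ideal.add_mem _ ?_ (Ideal.mul_mem_left _ _ (Ideal.pow_mem_pow hX0 2))
        rw [pow_two]
        refine Ideal.mul_mem_mul ?_ hX1
        rw [mem_bivariateIdeal_iff]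
        have : p c * η₀⁻¹ * PowerSeries.constantCoeff (PowerSeries.constantCoeff wi) * η₀ = 1 := by
          rw [mul_right_comm, mul_assoc (p c), inv_mul_cancel₀ hη, mul_one, hcwi]
        simp only [map_sub, map_mul, map_one, PowerSeries.constantCoeff_C, this, sub_self, η₀]
      convert h using 1
      rw [hg]
      simp
      ring
  have hy (j : Fin 2) : y j ∈ mAt (affOf p c) := by
    rw [← hmem]
    have := Ideal.add_mem _ (Ideal.pow_le_self two_ne_zero (hΨy j)) (bivariateVars_mem j)
    rwa [sub_add_cancel] at this
  obtain ⟨e, he⟩ := exists_localCompletion_equiv Ψ hC (fun z hz => (hmem z).2 hz) hy hΨy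
    (F := MvPolynomial.aeval (dehomMap c) F) (b := s + 1) (q := wi ^ n * q)
    (((isUnit_iff_exists_inv'.2 ⟨_, hwi⟩).pow n).mul hq) (by
      refine (eval₂_aeval_dehomMap _ hwi F).trans ?_
      rw [eval₂_mul_of_isHomogeneous _ hF, hFw, mul_assoc])
  refine ⟨e.trans (cuspQuotientEquiv K (s + 1)).symm, fun r => ?_⟩
  rw [RingEquiv.trans_apply, he, RingEquiv.symm_apply_eq]
  refine Eq.symm ((Ideal.quotientEquiv_mk _ _ _ _ _).trans ?_)
  exact congrArg _ (bivariateEquiv_C r)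

end

section

variable {K : Type*} [Field K]

/-- The restriction of a ternary form to the line `p + y e`, as a polynomial in `y`. -/
abbrev lineRestrict (F : MvPolynomial (Fin 3) K) (p e : Fin 3 → K) : Polynomial K :=
  MvPolynomial.eval₂ Polynomial.C
    (fun j => Polynomial.C (p j) + Polynomial.C (e j) * Polynomial.X) F

theorem exists_cusp_factorization [CharZero K] {F : MvPolynomial (Fin 3) K} {p e₁ e₂ : Fin 3 → K}
    (hF2 : (lineRestrict F p e₂).coeff 2 ≠ 0) {α η : PowerSeries K}
    (hα : PowerSeries.constantCoeff α = 0) (hη : PowerSeries.constantCoeff η ≠ 0) {b : ℕ}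
    (hb : 1 ≤ b)
    (hroot : ∀ ε : PowerSeries K, ε ^ 2 = 1 →
      MvPolynomial.eval₂ PowerSeries.C (fun j => PowerSeries.C (p j)
        + PowerSeries.C (e₁ j) * PowerSeries.X ^ 2
        + PowerSeries.C (e₂ j) * (PowerSeries.expand 2 two_ne_zero α
          + ε * PowerSeries.X ^ b * PowerSeries.expand 2 two_ne_zero η)) F = 0) :
    ∃ q : PowerSeries (PowerSeries K), IsUnit q ∧
      MvPolynomial.eval₂ (bivariateC K) (fun j => bivariateC K (p j)
      + bivariateC K (e₁ j) * PowerSeries.C PowerSeries.X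
      + bivariateC K (e₂ j) * (PowerSeries.C α + PowerSeries.C η * PowerSeries.X)) F
        = q * (PowerSeries.X ^ 2 - PowerSeries.C (PowerSeries.X ^ b)) := by
  let κ : K →+* Polynomial (PowerSeries K) := Polynomial.C.comp PowerSeries.C
  let w : Fin 3 → Polynomial (PowerSeries K) := fun j => κ (p j)
      + κ (e₁ j) * Polynomial.C PowerSeries.X
      + κ (e₂ j) * (Polynomial.C α + Polynomial.C η * Polynomial.X)
  obtain ⟨H, hH⟩ : ∃ H, H = MvPolynomial.eval₂ κ w F := ⟨_, rfl⟩
  let D : Polynomial (PowerSeries K) :=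
    Polynomial.X ^ 2 - Polynomial.C (PowerSeries.X ^ b)
  have hD : D.Monic := Polynomial.monic_X_pow_sub_C _ two_ne_zero
  have hDdeg : D.natDegree = 2 := Polynomial.natDegree_X_pow_sub_C
  let ι : PowerSeries K →+* PowerSeries K := (PowerSeries.expand 2 two_ne_zero).toRingHom
  have hιinj : Function.Injective ι := by
    rw [injective_iff_map_eq_zero]
    intro g hg
    ext m
    have := congrArg (PowerSeries.coeff (2 * m)) hg
    simpa [ι, PowerSeries.coeff_expand] using this
  have hιX : ι PowerSeries.X = PowerSeries.X ^ 2 := by simp [ι]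
  have hιC (c : K) : ι (PowerSeries.C c) = PowerSeries.C c := PowerSeries.expand_C 2 two_ne_zero c
  have hHroot (ε : PowerSeries K) (hε : ε ^ 2 = 1) :
      Polynomial.eval₂ ι (ε * PowerSeries.X ^ b) H = 0 := by
    rw [← hroot ε hε]
    have h := MvPolynomial.hom_eval₂ F κ (Polynomial.eval₂RingHom ι (ε * PowerSeries.X ^ b)) w
    have h1 : (Polynomial.eval₂RingHom ι (ε * PowerSeries.X ^ b)).comp κ = PowerSeries.C := by
      ext c : 1
      simp [κ, hιC]
    have h2 (j : Fin 3) : Polynomial.eval₂RingHom ι (ε * PowerSeries.X ^ b) (w j)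
        = PowerSeries.C (p j) + PowerSeries.C (e₁ j) * PowerSeries.X ^ 2
          + PowerSeries.C (e₂ j) * (PowerSeries.expand 2 two_ne_zero α
          + ε * PowerSeries.X ^ b * PowerSeries.expand 2 two_ne_zero η) := by
      have hια : ι α = PowerSeries.expand 2 two_ne_zero α := rfl
      have hιη : ι η = PowerSeries.expand 2 two_ne_zero η := rfl
      simp only [w, κ, map_add, map_mul, RingHom.comp_apply, Polynomial.coe_eval₂RingHom,
        Polynomial.eval₂_C, Polynomial.eval₂_X, hιC, hιX, hια, hιη]
      ring
    rw [h1, ← hH] at h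
    simp only [h2] at h
    exact h
  have hR : H %ₘ D = 0 := by
    set R := H %ₘ D with hRdef
    have hRdeg : R.natDegree < 2 := hDdeg ▸ Polynomial.natDegree_modByMonic_lt H hD (by
      intro h; rw [h] at hDdeg; simp at hDdeg)
    have hRroot (ε : PowerSeries K) (hε : ε ^ 2 = 1) :
        ι (R.coeff 0) + ι (R.coeff 1) * (ε * PowerSeries.X ^ b) = 0 := by
      have h1 := hHroot ε hε
      rw [← Polynomial.modByMonic_add_div H D, Polynomial.eval₂_add, Polynomial.eval₂_mul] at h1
      have h2 : Polynomial.eval₂ ι (ε * PowerSeries.X ^ b) D = 0 := by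
        simp only [D, Polynomial.eval₂_sub, Polynomial.eval₂_pow, Polynomial.eval₂_X,
          Polynomial.eval₂_C, map_pow, hιX]
        rw [mul_pow, hε]; ring
      rw [h2, zero_mul, add_zero, Polynomial.eval₂_eq_sum_range' ι hRdeg] at h1
      simpa [Finset.sum_range_succ] using h1
    have hp := hRroot 1 (by ring)
    have hm := hRroot (-1) (by ring)
    have h0 : R.coeff 0 = 0 := by
      apply hιinj
      rw [map_zero]
      have : (2 : PowerSeries K) * ι (R.coeff 0) = 0 := by linear_combination hp + hm
      have h2 : (2 : PowerSeries K) ≠ 0 := by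
        intro h
        have := congrArg PowerSeries.constantCoeff h
        rw [map_ofNat, map_zero] at this
        exact two_ne_zero this
      exact (mul_eq_zero.1 this).resolve_left h2
    have h1 : R.coeff 1 = 0 := by
      apply hιinj
      rw [map_zero]
      rw [h0, map_zero, zero_add, one_mul] at hp
      exact (mul_eq_zero.1 hp).resolve_right (pow_ne_zero _ PowerSeries.X_ne_zero)
    ext1 m
    rcases m with _ | _ | m
    · simpa using h0
    · simpa using h1
    · rw [Polynomial.coeff_eq_zero_of_natDegree_lt (by omega), Polynomial.coeff_zero]
  set Q := H /ₘ D with hQ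
  have hHQ : H = D * Q := by
    conv_lhs => rw [← Polynomial.modByMonic_add_div H D, hR, zero_add]
  refine ⟨Polynomial.coeToPowerSeries.ringHom Q, ?_, ?_⟩
  · rw [PowerSeries.isUnit_bivariate_iff]
    have h0 : H.map PowerSeries.constantCoeff
        = Polynomial.X ^ 2 * Q.map PowerSeries.constantCoeff := by
      rw [hHQ, Polynomial.map_mul]
      congr 1
      simp only [D, Polynomial.map_sub, Polynomial.map_pow, Polynomial.map_X, Polynomial.map_C,
        map_pow, PowerSeries.constantCoeff_X, zero_pow (by omega : b ≠ 0), map_zero, sub_zero]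
    have h1 : H.map PowerSeries.constantCoeff
        = (lineRestrict F p e₂).comp
          (Polynomial.C (PowerSeries.constantCoeff η) * Polynomial.X) := by
      have h := MvPolynomial.hom_eval₂ F κ (Polynomial.mapRingHom PowerSeries.constantCoeff) w
      have h' := MvPolynomial.hom_eval₂ F Polynomial.C (Polynomial.compRingHom
        (Polynomial.C (PowerSeries.constantCoeff η) * Polynomial.X))
        (fun j => Polynomial.C (p j) + Polynomial.C (e₂ j) * Polynomial.X)
      rw [hH]
      refine h.trans (Eq.trans ?_ h'.symm)
      congr 1
      · ext c : 1
        simp [κ]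
      · funext j
        simp [w, κ, hα]
    have h2 := congrArg (fun P => Polynomial.coeff P 2) (h1.symm.trans h0)
    simp only [Polynomial.comp_C_mul_X_coeff] at h2
    rw [Polynomial.coeff_X_pow_mul' , if_pos le_rfl, Nat.sub_self, Polynomial.coeff_map] at h2
    have h3 : PowerSeries.constantCoeff (PowerSeries.constantCoeff
        (Polynomial.coeToPowerSeries.ringHom Q)) = PowerSeries.constantCoeff (Q.coeff 0) := by
      rw [Polynomial.coeToPowerSeries.ringHom_apply, Polynomial.constantCoeff_coe]
    rw [h3, ← h2]
    exact mul_ne_zero hF2 (pow_ne_zero _ hη)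
  · have h := MvPolynomial.hom_eval₂ F κ Polynomial.coeToPowerSeries.ringHom w
    have h1 : (Polynomial.coeToPowerSeries.ringHom).comp κ = bivariateC K := by
      ext c : 1
      simp [κ]
    rw [h1] at h
    have h2 : Polynomial.coeToPowerSeries.ringHom H
      = Polynomial.coeToPowerSeries.ringHom Q *
        (PowerSeries.X ^ 2 - PowerSeries.C (PowerSeries.X ^ b)) := by
      rw [hHQ, map_mul, mul_comm]
      congr 1
      simp [D]
    rw [← h2, hH]
    refine Eq.trans ?_ h.symm
    congr 1
    funext j
    simp [w, κ]

end

section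

variable {K : Type*} [Field K]

/-- The restriction of a binary form to the affine line `T v + v'`, as a polynomial in `T`. -/
def restrictLine (v v' : Fin 2 → K) (g : MvPolynomial (Fin 2) K) : Polynomial K :=
  MvPolynomial.eval₂ Polynomial.C
    (fun i => Polynomial.C (v i) * Polynomial.X + Polynomial.C (v' i)) g

theorem aeval_restrictLine {L : Type*} [CommRing L] [Algebra K L] (v v' : Fin 2 → K)
    (g : MvPolynomial (Fin 2) K) (s : L) :
    Polynomial.aeval s (restrictLine v v' g)
      = MvPolynomial.eval₂ (algebraMap K L)
        (fun i => algebraMap K L (v i) * s + algebraMap K L (v' i)) g := by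
  have h := MvPolynomial.hom_eval₂ g Polynomial.C
    (Polynomial.aeval s : Polynomial K →ₐ[K] L).toRingHom
    (fun i => Polynomial.C (v i) * Polynomial.X + Polynomial.C (v' i))
  refine h.trans ?_
  congr 1
  · ext c; simp
  · funext i; simp

theorem eval_restrictLine (v v' : Fin 2 → K) (g : MvPolynomial (Fin 2) K) (s : K) :
    (restrictLine v v' g).eval s = MvPolynomial.eval (fun i => v i * s + v' i) g := by
  rw [← Polynomial.coe_aeval_eq_eval]
  exact (aeval_restrictLine v v' g s).trans rfl

theorem evalVec_smul {n : ℕ} {f : Fin 3 → MvPolynomial (Fin 2) K}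
    (hf : ∀ u, (f u).IsHomogeneous n) (c : K) (σ : Fin 2 → K) :
    evalVec f (c • σ) = c ^ n • evalVec f σ := by
  funext u
  have := eval₂_mul_of_isHomogeneous (RingHom.id K) (hf u) σ c
  simp only [MvPolynomial.eval₂_eq_eval_map, MvPolynomial.map_id] at this
  have e : c • σ = fun j => σ j * c := by funext j; simp [mul_comm]
  simp only [evalVec, e, Pi.smul_apply, smul_eq_mul]
  exact this

theorem projMap_mk {n : ℕ} {f : Fin 3 → MvPolynomial (Fin 2) K} (hf : IsProperParam n f)
    {σ : Fin 2 → K} (hσ : σ ≠ 0) :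
    projMap f (Projectivization.mk K σ hσ)
      = Projectivization.mk K (evalVec f σ) (hf.no_common_zero σ hσ) := by
  obtain ⟨c, hc⟩ := Projectivization.exists_smul_eq_mk_rep K σ hσ
  have hne := hf.no_common_zero _ (Projectivization.mk K σ hσ).rep_nonzero
  rw [projMap, dif_pos hne, Projectivization.mk_eq_mk_iff]
  refine ⟨c ^ n, ?_⟩
  rw [← hc]
  have := evalVec_smul hf.homog (c : K) σ
  rw [Units.smul_def, Units.smul_def, this, Units.val_pow_eq_pow_val]

theorem exists_smul_eq_of_cross {ι : Type*} {x y : ι → K} (hx : x ≠ 0) (hy : y ≠ 0)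
    (h : ∀ i j, x i * y j = x j * y i) : ∃ c : Kˣ, c • y = x := by
  obtain ⟨i, hi⟩ := Function.ne_iff.1 hy
  have hi' : y i ≠ 0 := hi
  have hxy : (x i / y i) • y = x := by
    funext j
    simp only [Pi.smul_apply, smul_eq_mul]
    rw [div_mul_eq_mul_div, div_eq_iff hi', h]
  have hxi : x i / y i ≠ 0 := by
    intro h0
    rw [h0, zero_smul] at hxy
    exact hx hxy.symm
  exact ⟨Units.mk0 _ hxi, hxy⟩

/-- A proper parameterization is injective at generic points of extensions of the base field. -/
theorem IsProperParam.eq_of_cross [IsAlgClosed K] {n : ℕ} {f : Fin 3 → MvPolynomial (Fin 2) K}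
    (hf : IsProperParam n f) {v v' : Fin 2 → K} (hv : v 0 * v' 1 - v 1 * v' 0 ≠ 0)
    {L : Type*} [CommRing L] [IsDomain L] [Algebra K L] {s s' : L}
    (hs : Transcendental K s) (hs' : Transcendental K s')
    (hcross : ∀ i j, Polynomial.aeval s (restrictLine v v' (f i)) *
        Polynomial.aeval s' (restrictLine v v' (f j))
      = Polynomial.aeval s (restrictLine v v' (f j)) *
        Polynomial.aeval s' (restrictLine v v' (f i))) : s = s' := by
  by_contra hss
  obtain ⟨S, hSfin, hSinj⟩ := hf.gen_injective
  let lin (P : Projectivization K (Fin 2 → K)) : Polynomial K :=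
    Polynomial.C (P.rep 1) * (Polynomial.C (v 0) * Polynomial.X + Polynomial.C (v' 0))
    - Polynomial.C (P.rep 0) * (Polynomial.C (v 1) * Polynomial.X + Polynomial.C (v' 1))
  have hlin (P) : lin P ≠ 0 := by
    intro h
    have h1 := congrArg (fun q => Polynomial.coeff q 1) h
    have h0 := congrArg (fun q => Polynomial.coeff q 0) h
    simp [lin] at h0 h1
    apply P.rep_nonzero
    have e0 : (v 0 * v' 1 - v 1 * v' 0) * P.rep 0 = 0 := by
      linear_combination (-v 0) * h0 + v' 0 * h1
    have e1 : (v 0 * v' 1 - v 1 * v' 0) * P.rep 1 = 0 := by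
      linear_combination (-v 1) * h0 + v' 1 * h1
    funext i
    fin_cases i
    · exact (mul_eq_zero.1 e0).resolve_left hv
    · exact (mul_eq_zero.1 e1).resolve_left hv
  let q : Polynomial K := ∏ P ∈ hSfin.toFinset, lin P
  have hq : q ≠ 0 := Finset.prod_ne_zero_iff.2 fun P _ => hlin P
  let Φ : MvPolynomial (Fin 2) K →ₐ[K] L := MvPolynomial.aeval ![s, s']
  let I := RingHom.ker Φ.toRingHom
  have : I.IsPrime := RingHom.ker_isPrime _
  have hΦ (r : Polynomial K) (i : Fin 2) :
      Φ (Polynomial.aeval (MvPolynomial.X i) r) = Polynomial.aeval (![s, s'] i) r := by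
    rw [← Polynomial.aeval_algHom_apply]
    simp [Φ]
  let h : MvPolynomial (Fin 2) K := (MvPolynomial.X 0 - MvPolynomial.X 1) *
    (Polynomial.aeval (MvPolynomial.X 0) q * Polynomial.aeval (MvPolynomial.X 1) q)
  have hI : h ∉ I := by
    intro hh
    have : Φ h = 0 := hh
    simp only [h, map_mul, map_sub, hΦ] at this
    rcases mul_eq_zero.1 this with h0 | h0
    · exact hss (sub_eq_zero.1 (by simpa [Φ] using h0))
    · rcases mul_eq_zero.1 h0 with h1 | h1
      · exact hs ⟨q, hq, by simpa using h1⟩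
      · exact hs' ⟨q, hq, by simpa using h1⟩
  rw [← MvPolynomial.IsPrime.vanishingIdeal_zeroLocus (K := K) I,
    MvPolynomial.mem_vanishingIdeal_iff] at hI
  push Not at hI
  obtain ⟨z, hz, hzh⟩ := hI
  have hzero (g : MvPolynomial (Fin 2) K) (hg : Φ g = 0) :
      (MvPolynomial.aeval z : MvPolynomial (Fin 2) K →ₐ[K] K) g = 0 :=
    MvPolynomial.mem_zeroLocus_iff.1 hz g hg
  have hzr (r : Polynomial K) (i : Fin 2) :
      (MvPolynomial.aeval z : MvPolynomial (Fin 2) K →ₐ[K] K)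
        (Polynomial.aeval (MvPolynomial.X i) r) = r.eval (z i) := by
    rw [← Polynomial.aeval_algHom_apply]
    simp [Polynomial.aeval_def, Polynomial.eval₂_eq_eval_map]
  simp only [h, map_mul, hzr, map_sub, MvPolynomial.aeval_X] at hzh
  have hz01 : z 0 ≠ z 1 := fun h0 => hzh (by rw [h0]; simp)
  have hq0 : q.eval (z 0) ≠ 0 := fun h0 => hzh (by rw [h0]; simp)
  have hq1 : q.eval (z 1) ≠ 0 := fun h0 => hzh (by rw [h0]; simp)
  let σ (i : Fin 2) : Fin 2 → K := fun j => v j * z i + v' j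
  have hσ (i : Fin 2) : σ i ≠ 0 := by
    intro h0
    have e0 := congrFun h0 0
    have e1 := congrFun h0 1
    simp only [σ, Pi.zero_apply] at e0 e1
    exact hv (by linear_combination v 0 * e1 - v 1 * e0)
  have hσS (i : Fin 2) (hqi : q.eval (z i) ≠ 0) : Projectivization.mk K (σ i) (hσ i) ∈ Sᶜ := by
    intro hmem
    apply hqi
    rw [Polynomial.eval_prod]
    refine Finset.prod_eq_zero (hSfin.mem_toFinset.2 hmem) ?_
    obtain ⟨c, hc⟩ := Projectivization.exists_smul_eq_mk_rep K (σ i) (hσ i)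
    simp only [lin, ← hc, Units.smul_def, Pi.smul_apply, smul_eq_mul, σ]
    simp
    ring
  have hev (i : Fin 2) (u : Fin 3) : evalVec f (σ i) u = (restrictLine v v' (f u)).eval (z i) :=
    (eval_restrictLine v v' (f u) (z i)).symm
  have heq := hSinj (hσS 0 hq0) (hσS 1 hq1) (by
    rw [projMap_mk hf, projMap_mk hf, Projectivization.mk_eq_mk_iff]
    refine exists_smul_eq_of_cross (hf.no_common_zero _ (hσ 0)) (hf.no_common_zero _ (hσ 1)) ?_
    intro i j
    have := hzero (Polynomial.aeval (MvPolynomial.X 0) (restrictLine v v' (f i)) *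
        Polynomial.aeval (MvPolynomial.X 1) (restrictLine v v' (f j))
      - Polynomial.aeval (MvPolynomial.X 0) (restrictLine v v' (f j)) *
        Polynomial.aeval (MvPolynomial.X 1) (restrictLine v v' (f i))) (by
        simp only [map_sub, map_mul, hΦ]
        exact sub_eq_zero.2 (hcross i j))
    simp only [map_sub, map_mul, hzr] at this
    rw [hev, hev, hev, hev]
    exact sub_eq_zero.1 this)
  rw [Projectivization.mk_eq_mk_iff'] at heq
  obtain ⟨c, hc⟩ := heq
  have e0 := congrFun hc 0
  have e1 := congrFun hc 1
  simp only [σ, Pi.smul_apply, smul_eq_mul] at e0 e1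
  have hc1 : (v 0 * v' 1 - v 1 * v' 0) * (c - 1) = 0 := by
    linear_combination v 0 * e1 - v 1 * e0
  have hc1' : c = 1 := sub_eq_zero.1 ((mul_eq_zero.1 hc1).resolve_left hv)
  have : (v 0 * v' 1 - v 1 * v' 0) * (z 1 - z 0) = 0 := by
    rw [hc1'] at e0 e1
    linear_combination v' 1 * e0 - v' 0 * e1
  exact hz01 (sub_eq_zero.1 ((mul_eq_zero.1 this).resolve_left hv)).symm

end

section

variable {K : Type*} [Field K]

theorem pointIdeal_pow_le_comap (p e : Fin 3 → K) (k : ℕ) {F : MvPolynomial (Fin 3) K}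
    (hF : F ∈ pointIdeal p ^ k) : Polynomial.X ^ k ∣ lineRestrict F p e := by
  let φ : MvPolynomial (Fin 3) K →+* Polynomial K := MvPolynomial.eval₂Hom Polynomial.C
    (fun j => Polynomial.C (p j) + Polynomial.C (e j) * Polynomial.X)
  have h1 : (pointIdeal p).map φ ≤ Ideal.span {Polynomial.X} := by
    rw [pointIdeal, Ideal.map_span, Ideal.span_le]
    rintro _ ⟨L, ⟨-, hL⟩, rfl⟩
    rw [SetLike.mem_coe, Ideal.mem_span_singleton, Polynomial.X_dvd_iff,
      Polynomial.coeff_zero_eq_eval_zero]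
    have := MvPolynomial.hom_eval₂ L Polynomial.C (Polynomial.evalRingHom (0 : K))
      (fun j => Polynomial.C (p j) + Polynomial.C (e j) * Polynomial.X)
    refine this.trans (Eq.trans ?_ hL)
    rw [MvPolynomial.eval, MvPolynomial.coe_eval₂Hom]
    congr 1
    · ext; simp
    · funext j; simp
  have h2 : φ F ∈ Ideal.span {Polynomial.X} ^ k := by
    refine Ideal.pow_right_mono h1 k ?_
    rw [← Ideal.map_pow]
    exact Ideal.mem_map_of_mem φ hF
  rwa [Ideal.span_singleton_pow, Ideal.mem_span_singleton] at h2

/-- If all restrictions of a form to lines through `p` vanish to order `k` at `p`, then the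
form lies in the `k`-th power of the ideal of `p`. -/
theorem mem_pointIdeal_pow_of_lineRestrict [Infinite K] {n : ℕ} {F : MvPolynomial (Fin 3) K}
    (hF : F.IsHomogeneous n) {p : Fin 3 → K} (hp : p ≠ 0) (k : ℕ)
    (h : ∀ e : Fin 3 → K, ∀ i < k, (lineRestrict F p e).coeff i = 0) :
    F ∈ pointIdeal p ^ k := by
  obtain ⟨c, hc⟩ := Function.ne_iff.1 hp
  replace hc : p c ≠ 0 := hc
  let ℓ (j : Fin 3) : MvPolynomial (Fin 3) K :=
    MvPolynomial.X j - MvPolynomial.C (p j / p c) * MvPolynomial.X c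
  have hℓ (j) : ℓ j ∈ pointIdeal p := by
    refine Ideal.subset_span ⟨?_, ?_⟩
    · refine (MvPolynomial.isHomogeneous_X K j).sub ?_
      have := (MvPolynomial.isHomogeneous_C (Fin 3) (p j / p c)).mul
        (MvPolynomial.isHomogeneous_X K c)
      rwa [zero_add] at this
    · simp only [ℓ, map_sub, map_mul, MvPolynomial.eval_X, MvPolynomial.eval_C]
      rw [div_mul_cancel₀ _ hc, sub_self]
  obtain ⟨H, hH⟩ : ∃ H : Polynomial (MvPolynomial (Fin 3) K), H = MvPolynomial.eval₂
      (Polynomial.C.comp MvPolynomial.C)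
      (fun j => Polynomial.C (MvPolynomial.C (p j / p c) * MvPolynomial.X c)
        + Polynomial.C (ℓ j) * Polynomial.X) F := ⟨_, rfl⟩
  have hrees : H ∈ reesAlgebra (pointIdeal p) := by
    have hC (a : MvPolynomial (Fin 3) K) : Polynomial.C a ∈ reesAlgebra (pointIdeal p) :=
      (reesAlgebra (pointIdeal p)).algebraMap_mem a
    rw [hH, MvPolynomial.eval₂_eq]
    refine Subalgebra.sum_mem _ fun d _ => Subalgebra.mul_mem _ (hC _)
      (Subalgebra.prod_mem _ fun j _ => Subalgebra.pow_mem _ (Subalgebra.add_mem _ (hC _) ?_) _)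
    intro i
    rw [Polynomial.coeff_C_mul, Polynomial.coeff_X]
    split_ifs with hi
    · subst hi; simpa using hℓ j
    · simp
  have heval : H.eval 1 = F := by
    rw [hH]
    have := MvPolynomial.hom_eval₂ F (Polynomial.C.comp MvPolynomial.C)
      (Polynomial.evalRingHom (1 : MvPolynomial (Fin 3) K))
      (fun j => Polynomial.C (MvPolynomial.C (p j / p c) * MvPolynomial.X c)
        + Polynomial.C (ℓ j) * Polynomial.X)
    refine this.trans (Eq.trans ?_ (MvPolynomial.eval₂_eta F))
    congr 1
    · ext; simp
    · funext j; simp [ℓ]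
  have hcoeff (i : ℕ) (hi : i < k) : H.coeff i = 0 := by
    have hXc : MvPolynomial.X c * H.coeff i = 0 := by
      refine MvPolynomial.funext fun q => ?_
      rw [map_mul, MvPolynomial.eval_X, map_zero]
      by_cases hq : q c = 0
      · rw [hq, zero_mul]
      suffices hs : MvPolynomial.eval q (H.coeff i) = 0 by rw [hs, mul_zero]
      obtain ⟨r, hr⟩ : ∃ r, r = q c / p c := ⟨_, rfl⟩
      have hr0 : r ≠ 0 := by rw [hr]; exact div_ne_zero hq hc
      have h1 : H.map (MvPolynomial.eval q)
          = Polynomial.C r ^ n * lineRestrict F p (fun j => MvPolynomial.eval q (ℓ j) / r) := by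
        rw [← eval₂_mul_of_isHomogeneous Polynomial.C hF, hH]
        have := MvPolynomial.hom_eval₂ F (Polynomial.C.comp MvPolynomial.C)
          (Polynomial.mapRingHom (MvPolynomial.eval q))
          (fun j => Polynomial.C (MvPolynomial.C (p j / p c) * MvPolynomial.X c)
            + Polynomial.C (ℓ j) * Polynomial.X)
        refine this.trans ?_
        congr 1
        · ext; simp
        · funext j
          simp only [Polynomial.coe_mapRingHom, Polynomial.map_add, Polynomial.map_mul,
            Polynomial.map_C, Polynomial.map_X, map_mul, MvPolynomial.eval_C, MvPolynomial.eval_X]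
          rw [add_mul, mul_right_comm (Polynomial.C (MvPolynomial.eval q (ℓ j) / r)),
            ← map_mul Polynomial.C (_ / r), div_mul_cancel₀ _ hr0, hr,
                ← map_mul Polynomial.C (p j / p c),
            show p j / p c * q c = p j * (q c / p c) by ring, map_mul Polynomial.C (p j)]
      have h2 := congrArg (fun P => Polynomial.coeff P i) h1
      simp only [Polynomial.coeff_map, ← map_pow, Polynomial.coeff_C_mul, h _ i hi,
        mul_zero] at h2
      exact h2
    exact (mul_eq_zero.1 hXc).resolve_left (MvPolynomial.X_ne_zero c)
  rw [← heval, Polynomial.eval_eq_sum, Polynomial.sum]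
  refine Ideal.sum_mem _ fun i _ => ?_
  rw [one_pow, mul_one]
  by_cases hi : i < k
  · rw [hcoeff i hi]; exact Ideal.zero_mem _
  · exact Ideal.pow_le_pow_right (not_lt.1 hi) (hrees i)

theorem exists_lineRestrict_coeff_two [Infinite K] {n : ℕ} {F : MvPolynomial (Fin 3) K}
    (hF : F.IsHomogeneous n) {p : Fin 3 → K} (hp : p ≠ 0) (h : multAt F p = 2) :
    (∀ e : Fin 3 → K, Polynomial.X ^ 2 ∣ lineRestrict F p e) ∧
      ∃ e : Fin 3 → K, (lineRestrict F p e).coeff 2 ≠ 0 := by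
  have hbdd : BddAbove {m | F ∈ pointIdeal p ^ m} := by
    by_contra hb
    rw [multAt, Nat.sSup_of_not_bddAbove hb] at h
    omega
  have hmem : F ∈ pointIdeal p ^ 2 := by
    have := Nat.sSup_mem (s := {m | F ∈ pointIdeal p ^ m}) ⟨0, by simp⟩ hbdd
    rw [multAt] at h
    rwa [h] at this
  have h2 (e : Fin 3 → K) : Polynomial.X ^ 2 ∣ lineRestrict F p e :=
    pointIdeal_pow_le_comap p e 2 hmem
  refine ⟨h2, ?_⟩
  by_contra! h3
  have hmem3 : F ∈ pointIdeal p ^ 3 := by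
    refine mem_pointIdeal_pow_of_lineRestrict hF hp 3 fun e i hi => ?_
    rcases Nat.lt_succ_iff_lt_or_eq.1 hi with hi | rfl
    · exact Polynomial.X_pow_dvd_iff.1 (h2 e) i hi
    · exact h3 e
  have := le_csSup hbdd (show 3 ∈ {m | F ∈ pointIdeal p ^ m} from hmem3)
  rw [multAt] at h
  omega

end

section

variable {K : Type*} [Field K]

theorem coeff_eval₂_C_mul_X {σ K : Type*} [CommRing K] (g : MvPolynomial σ K) (i : ℕ) :
    (MvPolynomial.eval₂ (Polynomial.C.comp MvPolynomial.C)
      (fun j => Polynomial.C (MvPolynomial.X j) * Polynomial.X) g :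
        Polynomial (MvPolynomial σ K)).coeff i = MvPolynomial.homogeneousComponent i g := by
  induction g using MvPolynomial.induction_on' with
  | add p q hp hq => rw [MvPolynomial.eval₂_add, Polynomial.coeff_add, map_add, hp, hq]
  | monomial m c =>
    rw [MvPolynomial.eval₂_monomial, Finsupp.prod]
    simp only [mul_pow, Finset.prod_mul_distrib, ← map_pow, ← map_prod]
    rw [Finset.prod_pow_eq_pow_sum, RingHom.comp_apply, ← mul_assoc, ← map_mul,
      Polynomial.coeff_C_mul_X_pow]
    have hm : MvPolynomial.C c * ∏ j ∈ m.support, (MvPolynomial.X j : MvPolynomial σ K) ^ m j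
        = MvPolynomial.monomial m c := (MvPolynomial.monomial_eq (a := c) (s := m)).symm
    have hhom := MvPolynomial.isHomogeneous_monomial c (d := m) rfl
    rw [hm, MvPolynomial.homogeneousComponent_of_mem
      ((MvPolynomial.mem_homogeneousSubmodule _ _).2 hhom)]
    rfl

theorem MvPolynomial.IsHomogeneous.exists_of_dvd {σ K : Type*} [CommRing K] [IsDomain K]
    {g h : MvPolynomial σ K} {n : ℕ}
    (hh : h.IsHomogeneous n) (h0 : h ≠ 0) (hd : g ∣ h) : ∃ d, g.IsHomogeneous d := by
  let φ : MvPolynomial σ K →+* Polynomial (MvPolynomial σ K) :=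
    MvPolynomial.eval₂Hom (Polynomial.C.comp MvPolynomial.C)
      (fun j => Polynomial.C (MvPolynomial.X j) * Polynomial.X)
  have hcoeff (q : MvPolynomial σ K) (i : ℕ) :
      (φ q).coeff i = MvPolynomial.homogeneousComponent i q := coeff_eval₂_C_mul_X q i
  have hinj (q : MvPolynomial σ K) (hq : φ q = 0) : q = 0 := by
    rw [← MvPolynomial.sum_homogeneousComponent q]
    exact Finset.sum_eq_zero fun i _ => by rw [← hcoeff, hq, Polynomial.coeff_zero]
  obtain ⟨k, rfl⟩ := hd
  have hg0 : φ g ≠ 0 := fun hq => h0 (by rw [hinj g hq, zero_mul])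
  have hk0 : φ k ≠ 0 := fun hq => h0 (by rw [hinj k hq, mul_zero])
  have hmon : φ (g * k) = Polynomial.monomial n (g * k) := by
    ext1 i
    rw [hcoeff, Polynomial.coeff_monomial,
      MvPolynomial.homogeneousComponent_of_mem ((MvPolynomial.mem_homogeneousSubmodule _ _).2 hh)]
    simp only [eq_comm]
  have hdeg : (φ g).natDegree + (φ k).natDegree = n := by
    rw [← Polynomial.natDegree_mul hg0 hk0, ← map_mul, hmon,
      Polynomial.natDegree_monomial_eq _ h0]
  have htr : (φ g).natTrailingDegree + (φ k).natTrailingDegree = n := by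
    rw [← Polynomial.natTrailingDegree_mul hg0 hk0, ← map_mul, hmon,
      Polynomial.natTrailingDegree_monomial h0]
  have h1 := Polynomial.natTrailingDegree_le_natDegree (φ g)
  have h2 := Polynomial.natTrailingDegree_le_natDegree (φ k)
  refine ⟨(φ g).natDegree, ?_⟩
  have : g = MvPolynomial.homogeneousComponent (φ g).natDegree g := by
    conv_lhs => rw [← MvPolynomial.sum_homogeneousComponent g]
    rw [Finset.sum_eq_single_of_mem (φ g).natDegree]
    · by_contra hlt
      rw [Finset.mem_range, not_lt] at hlt
      apply hg0
      rw [← Polynomial.leadingCoeff_eq_zero, Polynomial.leadingCoeff, hcoeff]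
      refine MvPolynomial.homogeneousComponent_eq_zero _ _ ?_
      omega
    · intro i _ hi
      rw [← hcoeff]
      rcases lt_or_gt_of_ne hi with hi | hi
      · exact Polynomial.coeff_eq_zero_of_lt_natTrailingDegree (by omega)
      · exact Polynomial.coeff_eq_zero_of_natDegree_lt hi
  have hhom := MvPolynomial.homogeneousComponent_isHomogeneous (φ g).natDegree g
  rwa [← this] at hhom

/-- A binary form vanishing at `σ` is divisible by the corresponding linear form. -/
theorem linFormOf_dvd {g : MvPolynomial (Fin 2) K} {n : ℕ} (hg : g.IsHomogeneous n)
    {σ : Fin 2 → K} (hσ : σ ≠ 0) (h0 : MvPolynomial.eval σ g = 0) : linFormOf σ ∣ g := by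
  obtain ⟨c, hc⟩ := Function.ne_iff.1 hσ
  replace hc : σ c ≠ 0 := hc
  have h1 := eval₂_mul_of_isHomogeneous MvPolynomial.C hg MvPolynomial.X (MvPolynomial.C (σ c))
  have h2 := eval₂_mul_of_isHomogeneous MvPolynomial.C hg (fun j => MvPolynomial.C (σ j))
    (MvPolynomial.X c : MvPolynomial (Fin 2) K)
  rw [MvPolynomial.eval₂_eta] at h1
  have h3 : MvPolynomial.eval₂ MvPolynomial.C (fun j => MvPolynomial.C (σ j)) g
      = (0 : MvPolynomial (Fin 2) K) := by
    have := MvPolynomial.hom_eval₂ g (RingHom.id K)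
        (MvPolynomial.C : K →+* MvPolynomial (Fin 2) K) σ
    rw [RingHom.comp_id] at this
    rw [← this, ← map_zero MvPolynomial.C]
    exact congrArg _ h0
  rw [h3, mul_zero] at h2
  have h4 : MvPolynomial.eval₂ MvPolynomial.C
        (fun j => MvPolynomial.X j * MvPolynomial.C (σ c)) g
      - MvPolynomial.eval₂ MvPolynomial.C (fun j => MvPolynomial.C (σ j) * MvPolynomial.X c) g
        ∈ Ideal.span {linFormOf σ} := by
    rw [← Ideal.Quotient.eq, MvPolynomial.hom_eval₂, MvPolynomial.hom_eval₂]
    congr 1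
    funext j
    rw [Ideal.Quotient.eq, Ideal.mem_span_singleton, linFormOf]
    fin_cases c <;> fin_cases j
    · exact ⟨0, by simp; ring⟩
    · exact ⟨-1, by simp; ring⟩
    · exact ⟨1, by simp; ring⟩
    · exact ⟨0, by simp; ring⟩
  rw [h1, h2, sub_zero, Ideal.mem_span_singleton, ← map_pow] at h4
  have hu : IsUnit (MvPolynomial.C (σ c ^ n) : MvPolynomial (Fin 2) K) :=
    (IsUnit.mk0 _ (pow_ne_zero n hc)).map MvPolynomial.C
  exact (hu.dvd_mul_left).1 h4

theorem natDegree_prod_linear_le {σ L : Type*} [CommRing L] (a b : σ → L) (d : σ → ℕ)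
    (S : Finset σ) :
    (∏ j ∈ S, (Polynomial.C (a j) * Polynomial.X + Polynomial.C (b j)) ^ d j).natDegree
      ≤ ∑ j ∈ S, d j := by
  refine (Polynomial.natDegree_prod_le _ _).trans (Finset.sum_le_sum fun j _ => ?_)
  simpa using Polynomial.natDegree_pow_le_of_le (d j)
    (Polynomial.natDegree_linear_le (a := a j) (b := b j))

theorem coeff_prod_linear {σ L : Type*} [CommRing L] (a b : σ → L) (d : σ → ℕ) (S : Finset σ) :
    (∏ j ∈ S, (Polynomial.C (a j) * Polynomial.X + Polynomial.C (b j)) ^ d j).coeff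
      (∑ j ∈ S, d j) = ∏ j ∈ S, a j ^ d j := by
  classical
  induction S using Finset.induction_on with
  | empty => simp
  | insert i S hi ih =>
    rw [Finset.prod_insert hi, Finset.sum_insert hi, Finset.prod_insert hi,
      Polynomial.coeff_mul_add_eq_of_natDegree_le _ (natDegree_prod_linear_le a b d S), ih]
    · congr 1
      have := Polynomial.coeff_pow_of_natDegree_le (n := 1) (m := d i)
        (Polynomial.natDegree_linear_le (a := a i) (b := b i))
      rw [mul_one] at this
      rw [this]
      simp
    · simpa using Polynomial.natDegree_pow_le_of_le (d i)
        (Polynomial.natDegree_linear_le (a := a i) (b := b i))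

theorem natDegree_eval₂_linear_le {σ L : Type*} [Fintype σ] [CommRing L] (κ : K →+* L)
    {g : MvPolynomial σ K} {n : ℕ} (hg : g.IsHomogeneous n) (a b : σ → L) :
    (MvPolynomial.eval₂ (Polynomial.C.comp κ)
      (fun j => Polynomial.C (a j) * Polynomial.X + Polynomial.C (b j)) g).natDegree ≤ n := by
  rw [MvPolynomial.eval₂_eq']
  refine Polynomial.natDegree_sum_le_of_forall_le _ _ fun d hd => ?_
  have hdn := hg (MvPolynomial.mem_support_iff.1 hd)
  rw [Finsupp.weight_apply, Finsupp.sum_fintype _ _ (by simp)] at hdn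
  simp only [Pi.one_apply, smul_eq_mul, mul_one] at hdn
  refine (Polynomial.natDegree_C_mul_le _ _).trans ?_
  rw [← hdn]
  exact natDegree_prod_linear_le a b d _

theorem coeff_eval₂_linear {σ L : Type*} [Fintype σ] [CommRing L] (κ : K →+* L)
    {g : MvPolynomial σ K} {n : ℕ} (hg : g.IsHomogeneous n) (a b : σ → L) :
    (MvPolynomial.eval₂ (Polynomial.C.comp κ)
      (fun j => Polynomial.C (a j) * Polynomial.X + Polynomial.C (b j)) g).coeff n
        = MvPolynomial.eval₂ κ a g := by
  rw [MvPolynomial.eval₂_eq', MvPolynomial.eval₂_eq', Polynomial.finsetSum_coeff]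
  refine Finset.sum_congr rfl fun d hd => ?_
  have hdn := hg (MvPolynomial.mem_support_iff.1 hd)
  rw [Finsupp.weight_apply, Finsupp.sum_fintype _ _ (by simp)] at hdn
  simp only [Pi.one_apply, smul_eq_mul, mul_one] at hdn
  rw [RingHom.comp_apply, Polynomial.coeff_C_mul, ← hdn, coeff_prod_linear]

theorem restrictLine_natDegree_le {g : MvPolynomial (Fin 2) K} {n : ℕ} (hg : g.IsHomogeneous n)
    (v v' : Fin 2 → K) : (restrictLine v v' g).natDegree ≤ n :=
  natDegree_eval₂_linear_le (RingHom.id K) hg v v'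

theorem restrictLine_coeff {g : MvPolynomial (Fin 2) K} {n : ℕ} (hg : g.IsHomogeneous n)
    (v v' : Fin 2 → K) : (restrictLine v v' g).coeff n = MvPolynomial.eval v g :=
  coeff_eval₂_linear (RingHom.id K) hg v v'

theorem restrictLine_mul (v v' : Fin 2 → K) (g h : MvPolynomial (Fin 2) K) :
    restrictLine v v' (g * h) = restrictLine v v' g * restrictLine v v' h :=
  MvPolynomial.eval₂_mul _ _

theorem eq_zero_of_restrictLine [Infinite K] {g : MvPolynomial (Fin 2) K} {n : ℕ}
    (hg : g.IsHomogeneous n) {v v' : Fin 2 → K} (hv : v 0 * v' 1 - v 1 * v' 0 ≠ 0)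
    (h : restrictLine v v' g = 0) : g = 0 := by
  have h1 : linFormOf v * g = 0 := by
    refine MvPolynomial.funext fun q => ?_
    rw [map_mul, map_zero]
    by_cases hq : v 0 * q 1 - v 1 * q 0 = 0
    · rw [linFormOf]
      simp only [map_sub, map_mul, MvPolynomial.eval_C, MvPolynomial.eval_X]
      rw [show v 1 * q 0 - v 0 * q 1 = 0 by linear_combination -hq, zero_mul]
    · have h2 := congrArg (Polynomial.eval ((q 0 * v' 1 - q 1 * v' 0) / (v 0 * q 1 - v 1 * q 0))) h
      rw [eval_restrictLine, Polynomial.eval_zero] at h2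
      have h3 := eval₂_mul_of_isHomogeneous (RingHom.id K) hg
        (fun i => v i * ((q 0 * v' 1 - q 1 * v' 0) / (v 0 * q 1 - v 1 * q 0)) + v' i)
        ((v 0 * q 1 - v 1 * q 0) / (v 0 * v' 1 - v 1 * v' 0))
      have h4 : MvPolynomial.eval q g = 0 := by
        refine Eq.trans ?_ (h3.trans ?_)
        · rw [MvPolynomial.eval, MvPolynomial.coe_eval₂Hom]
          congr 1
          funext j
          obtain ⟨D, hD⟩ : ∃ D, D = v 0 * v' 1 - v 1 * v' 0 := ⟨_, rfl⟩
          obtain ⟨E, hE⟩ : ∃ E, E = v 0 * q 1 - v 1 * q 0 := ⟨_, rfl⟩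
          have key : q j * D = v j * (q 0 * v' 1 - q 1 * v' 0) + v' j * E := by
            fin_cases j <;> simp [hD, hE] <;> ring
          rw [← hD] at hv
          rw [← hE] at hq
          rw [← hD, ← hE]
          field_simp
          linear_combination key
        · refine Eq.trans (congrArg _ h2) (mul_zero _)
      rw [h4, mul_zero]
  refine (mul_eq_zero.1 h1).resolve_left fun h2 => hv ?_
  have e0 := congrArg (MvPolynomial.eval ![1, 0]) h2
  have e1 := congrArg (MvPolynomial.eval ![0, 1]) h2
  simp [linFormOf] at e0 e1
  rw [e0, e1]; ring

end

section

variable {K : Type*} [Field K]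

theorem IsGcdOfCross.ne_zero [IsAlgClosed K] {n : ℕ} {f : Fin 3 → MvPolynomial (Fin 2) K}
    (hf : IsProperParam n f) {p : Fin 3 → K} (hp : p ≠ 0) {G : MvPolynomial (Fin 2) K}
    (hG : IsGcdOfCross f p G) : G ≠ 0 := by
  rintro rfl
  have h0 (i j : Fin 3) (hij : i < j) : crossDiff f p i j = 0 := zero_dvd_iff.1 (hG.1 i j hij)
  have h1 (i j : Fin 3) : MvPolynomial.C (p i) * f j = MvPolynomial.C (p j) * f i := by
    rcases lt_trichotomy i j with hij | rfl | hij
    · exact sub_eq_zero.1 (h0 i j hij)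
    · rfl
    · exact (sub_eq_zero.1 (h0 j i hij)).symm
  obtain ⟨c, hc⟩ := Function.ne_iff.1 hp
  replace hc : p c ≠ 0 := hc
  let v : Fin 2 → K := ![1, 0]
  let v' : Fin 2 → K := ![0, 1]
  have h2 (i : Fin 3) : restrictLine v v' (f i)
      = Polynomial.C (p i / p c) * restrictLine v v' (f c) := by
    have h3 := congrArg (restrictLine v v') (h1 c i)
    rw [restrictLine_mul, restrictLine_mul] at h3
    simp only [restrictLine, MvPolynomial.eval₂_C] at h3 ⊢
    have h4 : Polynomial.C (p c)⁻¹ * Polynomial.C (p c) = 1 := by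
      rw [← map_mul, inv_mul_cancel₀ hc, map_one]
    rw [div_eq_mul_inv, map_mul]
    linear_combination Polynomial.C (p c)⁻¹ * h3 - h4 * MvPolynomial.eval₂ Polynomial.C
      (fun i => Polynomial.C (v i) * Polynomial.X + Polynomial.C (v' i)) (f i)
  have h5 := hf.eq_of_cross (v := v) (v' := v') (L := MvPolynomial (Fin 2) K)
    (by simp [v, v']) (MvPolynomial.transcendental_X K 0) (MvPolynomial.transcendental_X K 1) (by
      intro i j
      rw [h2 i, h2 j]
      simp only [map_mul, Polynomial.aeval_C]
      ring)
  exact absurd (MvPolynomial.X_injective h5) (by simp)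

/-- The combination `∑ ℓ_u f_u` of the components of a parameterization. -/
def linComb (ℓ : Fin 3 → K) (f : Fin 3 → MvPolynomial (Fin 2) K) : MvPolynomial (Fin 2) K :=
  ∑ u, MvPolynomial.C (ℓ u) * f u

theorem isHomogeneous_linComb {n : ℕ} {f : Fin 3 → MvPolynomial (Fin 2) K}
    (hf : ∀ u, (f u).IsHomogeneous n) (ℓ : Fin 3 → K) : (linComb ℓ f).IsHomogeneous n := by
  refine MvPolynomial.IsHomogeneous.sum _ _ _ fun u _ => ?_
  have := (MvPolynomial.isHomogeneous_C (Fin 2) (ℓ u)).mul (hf u)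
  rwa [zero_add] at this

/-- Coordinates adapted to the local study of a parameterized curve at the point `p`: an affine
coordinate `T v + v'` on the source, and a basis `p, e₁, e₂` of the target with dual basis
`ℓ₀, ℓ₁, ℓ₂`. -/
structure LocalFrame (n d : ℕ) (f : Fin 3 → MvPolynomial (Fin 2) K) (F : MvPolynomial (Fin 3) K)
    (p : Fin 3 → K) (G : MvPolynomial (Fin 2) K) where
  v : Fin 2 → K
  v' : Fin 2 → K
  e₁ : Fin 3 → K
  e₂ : Fin 3 → K
  ℓ₀ : Fin 3 → K
  ℓ₁ : Fin 3 → K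
  ℓ₂ : Fin 3 → K
  A' : Polynomial K
  B' : Polynomial K
  det_ne_zero : v 0 * v' 1 - v 1 * v' 0 ≠ 0
  expand : ∀ i j, p i * ℓ₀ j + e₁ i * ℓ₁ j + e₂ i * ℓ₂ j = if i = j then 1 else 0
  h1p : ∑ j, ℓ₁ j * p j = 0
  h11 : ∑ j, ℓ₁ j * e₁ j = 1
  h12 : ∑ j, ℓ₁ j * e₂ j = 0
  h2p : ∑ j, ℓ₂ j * p j = 0
  h21 : ∑ j, ℓ₂ j * e₁ j = 0
  h22 : ∑ j, ℓ₂ j * e₂ j = 1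
  eq_A : restrictLine v v' (linComb ℓ₁ f) = restrictLine v v' G * A'
  eq_B : restrictLine v v' (linComb ℓ₂ f) = restrictLine v v' G * B'
  natDegree_gcd : (restrictLine v v' G).natDegree = d
  natDegree_A : (restrictLine v v' (linComb ℓ₁ f)).natDegree = n
  eval_A'_ne_zero : ∀ τ, (restrictLine v v' G).eval τ = 0 → A'.eval τ ≠ 0
  eval_B'_ne_zero : ∀ τ, A'.eval τ = 0 → B'.eval τ ≠ 0
  coeff_two_ne_zero : (lineRestrict F p e₂).coeff 2 ≠ 0
  eval_e₂_ne_zero : MvPolynomial.eval e₂ F ≠ 0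

theorem exists_complement {v : Fin 2 → K} (hv : v ≠ 0) :
    ∃ v' : Fin 2 → K, v 0 * v' 1 - v 1 * v' 0 ≠ 0 := by
  by_cases h : v 0 = 0
  · refine ⟨![1, 0], fun h' => hv ?_⟩
    funext i
    fin_cases i
    · exact h
    · simpa using h'
  · exact ⟨![0, 1], by simpa using h⟩

/-- The coefficient of `y ^ i` in `F (p + y e)`, as a polynomial in `e`. -/
theorem exists_lineRestrict_coeff (F : MvPolynomial (Fin 3) K) (p : Fin 3 → K) (i : ℕ) :
    ∃ P : MvPolynomial (Fin 3) K, ∀ e, MvPolynomial.eval e P = (lineRestrict F p e).coeff i := by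
  refine ⟨(MvPolynomial.eval₂ (Polynomial.C.comp MvPolynomial.C)
    (fun j => Polynomial.C (MvPolynomial.C (p j)) + Polynomial.C (MvPolynomial.X j) * Polynomial.X)
      F : Polynomial (MvPolynomial (Fin 3) K)).coeff i, fun e => ?_⟩
  rw [← Polynomial.coeff_map]
  congr 1
  have := MvPolynomial.hom_eval₂ F (Polynomial.C.comp MvPolynomial.C)
    (Polynomial.mapRingHom (MvPolynomial.eval e))
    (fun j => Polynomial.C (MvPolynomial.C (p j)) + Polynomial.C (MvPolynomial.X j) * Polynomial.X)
  refine this.trans ?_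
  congr 1
  · ext; simp
  · funext j; simp

theorem exists_localFrame [IsAlgClosed K] [CharZero K]
    {n : ℕ} {f : Fin 3 → MvPolynomial (Fin 2) K} (hf : IsProperParam n f)
    {F : MvPolynomial (Fin 3) K} (hF : F.IsHomogeneous n) (hF0 : F ≠ 0)
    {p : Fin 3 → K} (hp : p ≠ 0) (hmult : multAt F p = 2)
    {G : MvPolynomial (Fin 2) K} (hG : IsGcdOfCross f p G) :
    ∃ d, G.IsHomogeneous d ∧ Nonempty (LocalFrame n d f F p G) := by
  classical
  have hG0 := hG.ne_zero hf hp
  have hcd (i j : Fin 3) : (crossDiff f p i j).IsHomogeneous n := by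
    have h (i j : Fin 3) : (MvPolynomial.C (p i) * f j).IsHomogeneous n := by
      have := (MvPolynomial.isHomogeneous_C (Fin 2) (p i)).mul (hf.homog j)
      rwa [zero_add] at this
    exact (h i j).sub (h j i)
  have hGhom : ∃ d, G.IsHomogeneous d := by
    by_contra hno
    apply hG0
    apply zero_dvd_iff.1
    refine hG.2 0 fun i j hij => zero_dvd_iff.2 ?_
    by_contra hne
    exact hno ((hcd i j).exists_of_dvd hne (hG.1 i j hij))
  obtain ⟨d, hd⟩ := hGhom
  refine ⟨d, hd, ?_⟩
  obtain ⟨h01, e01⟩ := hG.1 0 1 (by decide)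
  obtain ⟨h02, e02⟩ := hG.1 0 2 (by decide)
  obtain ⟨h12, e12⟩ := hG.1 1 2 (by decide)
  have hhom {h : MvPolynomial (Fin 2) K} {i j : Fin 3} (e : crossDiff f p i j = G * h) :
      ∃ m, h.IsHomogeneous m := by
    by_cases h0 : crossDiff f p i j = 0
    · rw [h0, eq_comm, mul_eq_zero] at e
      exact ⟨0, (e.resolve_left hG0) ▸ MvPolynomial.isHomogeneous_zero _ _ _⟩
    · exact (hcd i j).exists_of_dvd h0 ⟨G, by rw [e, mul_comm]⟩
  let k : Fin 3 → MvPolynomial (Fin 2) K := ![h12, -h02, h01]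
  have hk (w : Fin 2 → K) (hw : w ≠ 0) : ∃ u, MvPolynomial.eval w (k u) ≠ 0 := by
    by_contra! hall
    have a01 : MvPolynomial.eval w h01 = 0 := by simpa [k] using hall 2
    have a02 : MvPolynomial.eval w h02 = 0 := by simpa [k] using hall 1
    have a12 : MvPolynomial.eval w h12 = 0 := by simpa [k] using hall 0
    have hdvd : ∀ i j : Fin 3, i < j → G * linFormOf w ∣ crossDiff f p i j := by
      have key {h : MvPolynomial (Fin 2) K} {i j : Fin 3} (e : crossDiff f p i j = G * h)
          (a : MvPolynomial.eval w h = 0) : G * linFormOf w ∣ crossDiff f p i j := by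
        obtain ⟨m, hm⟩ := hhom e
        rw [e]
        exact mul_dvd_mul_left _ (linFormOf_dvd hm hw a)
      intro i j hij
      fin_cases i <;> fin_cases j <;> first | exact absurd hij (by decide) | skip
      · exact key e01 a01
      · exact key e02 a02
      · exact key e12 a12
    have hu := isUnit_of_dvd_one ((mul_dvd_mul_iff_left hG0).1
      ((hG.2 _ hdvd).trans (mul_one G).symm.dvd))
    have := (hu.map (MvPolynomial.eval w)).ne_zero
    apply this
    simp [linFormOf]
    ring
  have hpk : ∑ u, MvPolynomial.C (p u) * k u = 0 := by
    refine (mul_eq_zero.1 (?_ : G * _ = 0)).resolve_left hG0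
    simp only [crossDiff] at e01 e02 e12
    simp only [k, Fin.sum_univ_three, Matrix.cons_val_zero, Matrix.cons_val_one, Matrix.cons_val]
    linear_combination (-MvPolynomial.C (p 0)) * e12 + MvPolynomial.C (p 1) * e02
      - MvPolynomial.C (p 2) * e01
  obtain ⟨v, hv⟩ : ∃ v, MvPolynomial.eval v (G * MvPolynomial.X 0) ≠ 0 := by
    by_contra! h
    exact mul_ne_zero hG0 (MvPolynomial.X_ne_zero 0)
      (MvPolynomial.funext fun q => by rw [h q, map_zero])
  rw [map_mul, MvPolynomial.eval_X, mul_ne_zero_iff] at hv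
  obtain ⟨hGv, hv1⟩ := hv
  have hv0 : v ≠ 0 := fun h => hv1 (by rw [h, Pi.zero_apply])
  obtain ⟨v', hdet⟩ := exists_complement hv0
  have hline (τ : K) : (fun i => v i * τ + v' i) ≠ 0 := by
    intro h0
    have e0 := congrFun h0 0
    have e1 := congrFun h0 1
    simp only [Pi.zero_apply] at e0 e1
    exact hdet (by linear_combination v 0 * e1 - v 1 * e0)
  have hΓ0 : restrictLine v v' G ≠ 0 := by
    intro h0
    apply hGv
    rw [← restrictLine_coeff hd v v', h0, Polynomial.coeff_zero]
  let lin (w : Fin 2 → K) : MvPolynomial (Fin 3) K :=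
    ∑ u, MvPolynomial.C (MvPolynomial.eval w (k u)) * MvPolynomial.X u
  have hlin (w : Fin 2 → K) (hw : w ≠ 0) : lin w ≠ 0 := by
    obtain ⟨u, hu⟩ := hk w hw
    intro h0
    have := congrArg (MvPolynomial.eval (Pi.single u 1)) h0
    simp [lin, Pi.single_apply] at this
    exact hu this
  obtain ⟨P₂, hP₂⟩ := exists_lineRestrict_coeff F p 2
  obtain ⟨-, q, hq⟩ := exists_lineRestrict_coeff_two hF hp hmult
  have hP₂0 : P₂ ≠ 0 := by
    rintro rfl
    exact hq (by rw [← hP₂, map_zero])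
  obtain ⟨e₂, he₂⟩ : ∃ e₂, MvPolynomial.eval e₂ (P₂ * F * lin v *
      ∏ τ ∈ (restrictLine v v' G).roots.toFinset, lin (fun i => v i * τ + v' i)) ≠ 0 := by
    by_contra! h
    refine mul_ne_zero (mul_ne_zero (mul_ne_zero hP₂0 hF0) (hlin v hv0))
      (Finset.prod_ne_zero_iff.2 fun τ _ => hlin _ (hline τ))
      (MvPolynomial.funext fun q => by rw [h q, map_zero])
  simp only [map_mul, map_prod, mul_ne_zero_iff, Finset.prod_ne_zero_iff] at he₂
  obtain ⟨⟨⟨hc2, hFe⟩, hlv⟩, hlτ⟩ := he₂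
  rw [hP₂] at hc2
  have hlin_eval (w : Fin 2 → K) : MvPolynomial.eval e₂ (lin w)
      = MvPolynomial.eval w (linComb e₂ k) := by
    simp [lin, linComb, Fin.sum_univ_three]
    ring
  let N : Fin 3 → K := ![e₂ 1 * p 2 - e₂ 2 * p 1, e₂ 2 * p 0 - e₂ 0 * p 2, e₂ 0 * p 1 - e₂ 1 * p 0]
  have hNf : linComb N f = G * linComb e₂ k := by
    simp only [crossDiff] at e01 e02 e12
    simp only [linComb, N, k, Fin.sum_univ_three, Matrix.cons_val_zero, Matrix.cons_val_one,
      Matrix.cons_val, map_sub, map_mul]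
    linear_combination MvPolynomial.C (e₂ 0) * e12 - MvPolynomial.C (e₂ 1) * e02
      + MvPolynomial.C (e₂ 2) * e01
  have hNv : MvPolynomial.eval v (linComb N f) ≠ 0 := by
    rw [hNf, map_mul]
    exact mul_ne_zero hGv (by rwa [← hlin_eval])
  obtain ⟨e₁, he₁⟩ : ∃ e₁ : Fin 3 → K, N 0 * e₁ 0 + N 1 * e₁ 1 + N 2 * e₁ 2 = 1 := by
    have hN0 : N ≠ 0 := by
      intro h0
      apply hNv
      simp [linComb, h0]
    obtain ⟨c, hc⟩ := Function.ne_iff.1 hN0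
    replace hc : N c ≠ 0 := hc
    refine ⟨Pi.single c (N c)⁻¹, ?_⟩
    have : ∑ u, N u * (Pi.single c (N c)⁻¹ : Fin 3 → K) u = 1 := by
      simp [Pi.single_apply, hc]
    rwa [Fin.sum_univ_three] at this
  let N' : Fin 3 → K := ![p 1 * e₁ 2 - p 2 * e₁ 1, p 2 * e₁ 0 - p 0 * e₁ 2, p 0 * e₁ 1 - p 1 * e₁ 0]
  let N₀ : Fin 3 → K :=
    ![e₁ 1 * e₂ 2 - e₁ 2 * e₂ 1, e₁ 2 * e₂ 0 - e₁ 0 * e₂ 2, e₁ 0 * e₂ 1 - e₁ 1 * e₂ 0]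
  have hN'f : linComb N' f = G * (- linComb e₁ k) := by
    simp only [crossDiff] at e01 e02 e12
    simp only [linComb, N', k, Fin.sum_univ_three, Matrix.cons_val_zero, Matrix.cons_val_one,
      Matrix.cons_val, map_sub, map_mul]
    linear_combination (-MvPolynomial.C (e₁ 0)) * e12 + MvPolynomial.C (e₁ 1) * e02
      - MvPolynomial.C (e₁ 2) * e01
  simp only [N, Matrix.cons_val_zero, Matrix.cons_val_one, Matrix.cons_val] at he₁
  refine ⟨⟨v, v', e₁, e₂, N₀, N, N', restrictLine v v' (linComb e₂ k),
    restrictLine v v' (-linComb e₁ k), hdet, ?_, ?_, ?_, ?_, ?_, ?_, ?_, ?_, ?_, ?_, ?_, ?_, ?_,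
    hc2, hFe⟩⟩
  · intro i j
    fin_cases i <;> fin_cases j <;> simp [N, N', N₀]
    · linear_combination he₁
    · ring
    · ring
    · ring
    · linear_combination he₁
    · ring
    · ring
    · ring
    · linear_combination he₁
  · simp [N, Fin.sum_univ_three]; ring
  · simp [N, Fin.sum_univ_three]; linear_combination he₁
  · simp [N, Fin.sum_univ_three]; ring
  · simp [N', Fin.sum_univ_three]; ring
  · simp [N', Fin.sum_univ_three]; ring
  · simp [N', Fin.sum_univ_three]; linear_combination he₁
  · rw [hNf, restrictLine_mul]
  · rw [hN'f, restrictLine_mul]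
  · refine le_antisymm (restrictLine_natDegree_le hd v v') (Polynomial.le_natDegree_of_ne_zero ?_)
    rwa [restrictLine_coeff hd]
  · refine le_antisymm (restrictLine_natDegree_le (isHomogeneous_linComb hf.homog N) v v')
      (Polynomial.le_natDegree_of_ne_zero ?_)
    rwa [restrictLine_coeff (isHomogeneous_linComb hf.homog N)]
  · intro τ hτ
    rw [eval_restrictLine, ← hlin_eval]
    exact hlτ τ (by rw [Multiset.mem_toFinset]; exact (Polynomial.mem_roots hΓ0).2 hτ)
  · intro τ h2 h1
    rw [eval_restrictLine] at h1 h2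
    obtain ⟨u, hu⟩ := hk _ (hline τ)
    apply hu
    have h0 := congrArg (MvPolynomial.eval fun i => v i * τ + v' i) hpk
    obtain ⟨κ, hκ⟩ : ∃ κ : Fin 3 → K,
      κ = fun u => MvPolynomial.eval (fun i => v i * τ + v' i) (k u) := ⟨_, rfl⟩
    have hκ' (u) : MvPolynomial.eval (fun i => v i * τ + v' i) (k u) = κ u := by rw [hκ]
    simp only [linComb, map_neg, map_mul, map_add, MvPolynomial.eval_C, Fin.sum_univ_three,
      map_zero, hκ'] at h0 h1 h2
    rw [hκ']
    fin_cases u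
    · simp
      linear_combination (-κ 0) * he₁ + (e₁ 1 * e₂ 2 - e₁ 2 * e₂ 1) * h0
        - (e₂ 1 * p 2 - e₂ 2 * p 1) * h1 + (p 1 * e₁ 2 - p 2 * e₁ 1) * h2
    · simp
      linear_combination (-κ 1) * he₁ + (e₁ 2 * e₂ 0 - e₁ 0 * e₂ 2) * h0
        - (e₂ 2 * p 0 - e₂ 0 * p 2) * h1 + (p 2 * e₁ 0 - p 0 * e₁ 2) * h2
    · simp
      linear_combination (-κ 2) * he₁ + (e₁ 0 * e₂ 1 - e₁ 1 * e₂ 0) * h0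
        - (e₂ 0 * p 1 - e₂ 1 * p 0) * h1 + (p 0 * e₁ 1 - p 1 * e₁ 0) * h2

end

section

namespace LocalFrame

variable {K : Type*} [Field K] {n d : ℕ} {f : Fin 3 → MvPolynomial (Fin 2) K}
  {F : MvPolynomial (Fin 3) K} {p : Fin 3 → K} {G : MvPolynomial (Fin 2) K}

/-- The common factor of the coordinates `A` and `B`, in the affine coordinate of the source. -/
abbrev Γ (fr : LocalFrame n d f F p G) : Polynomial K := restrictLine fr.v fr.v' G

/-- The `e₁`-coordinate of the parameterization. -/
abbrev A (fr : LocalFrame n d f F p G) : Polynomial K := restrictLine fr.v fr.v' (linComb fr.ℓ₁ f)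

/-- The `e₂`-coordinate of the parameterization. -/
abbrev B (fr : LocalFrame n d f F p G) : Polynomial K := restrictLine fr.v fr.v' (linComb fr.ℓ₂ f)

/-- The `p`-coordinate of the parameterization. -/
abbrev C (fr : LocalFrame n d f F p G) : Polynomial K := restrictLine fr.v fr.v' (linComb fr.ℓ₀ f)

theorem _root_.restrictLine_linComb (v v' : Fin 2 → K) (ℓ : Fin 3 → K)
    (f : Fin 3 → MvPolynomial (Fin 2) K) :
    restrictLine v v' (linComb ℓ f) = ∑ u, Polynomial.C (ℓ u) * restrictLine v v' (f u) := by
  rw [linComb, restrictLine, Fin.sum_univ_three, Fin.sum_univ_three]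
  simp only [MvPolynomial.eval₂_add, MvPolynomial.eval₂_mul, MvPolynomial.eval₂_C]
  rfl

theorem restrictLine_eq (fr : LocalFrame n d f F p G) (u : Fin 3) :
    restrictLine fr.v fr.v' (f u) = Polynomial.C (p u) * fr.C + Polynomial.C (fr.e₁ u) * fr.A
      + Polynomial.C (fr.e₂ u) * fr.B := by
  simp only [C, A, B, restrictLine_linComb, Finset.mul_sum, ← Finset.sum_add_distrib]
  have h (j : Fin 3) : Polynomial.C (p u) * (Polynomial.C (fr.ℓ₀ j) * restrictLine fr.v fr.v' (f j))
      + Polynomial.C (fr.e₁ u) * (Polynomial.C (fr.ℓ₁ j) * restrictLine fr.v fr.v' (f j))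
      + Polynomial.C (fr.e₂ u) * (Polynomial.C (fr.ℓ₂ j) * restrictLine fr.v fr.v' (f j))
      = if u = j then restrictLine fr.v fr.v' (f j) else 0 := by
    have := congrArg Polynomial.C (fr.expand u j)
    simp only [map_add, map_mul] at this
    split_ifs at this ⊢ with huj
    · rw [map_one] at this
      linear_combination this * restrictLine fr.v fr.v' (f j)
    · rw [map_zero] at this
      linear_combination this * restrictLine fr.v fr.v' (f j)
  simp only [h, Finset.sum_ite_eq, Finset.mem_univ, if_true]

theorem eval₂_eq_zero (fr : LocalFrame n d f F p G) (hFf : MvPolynomial.aeval f F = 0)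
    {L : Type*} [CommRing L] [Algebra K L] (s : L) :
    MvPolynomial.eval₂ (algebraMap K L) (fun u => algebraMap K L (p u) * Polynomial.aeval s fr.C
      + algebraMap K L (fr.e₁ u) * Polynomial.aeval s fr.A
      + algebraMap K L (fr.e₂ u) * Polynomial.aeval s fr.B) F = 0 := by
  have h1 := congrArg (MvPolynomial.eval₂Hom (algebraMap K L)
    (fun i => algebraMap K L (fr.v i) * s + algebraMap K L (fr.v' i))) hFf
  rw [MvPolynomial.aeval_def, MvPolynomial.hom_eval₂, map_zero] at h1
  refine Eq.trans ?_ h1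
  congr 1
  · ext; simp
  · funext u
    rw [MvPolynomial.coe_eval₂Hom, ← aeval_restrictLine, fr.restrictLine_eq u]
    simp only [map_add, map_mul, Polynomial.aeval_C]

/-- The implicit equation holds at `p + x e₁ + y e₂` for the affine coordinates `x, y`. -/
theorem eval₂_affine_eq_zero (fr : LocalFrame n d f F p G) (hF : F.IsHomogeneous n)
    (hFf : MvPolynomial.aeval f F = 0)
    {L : Type*} [CommRing L] [IsDomain L] [Algebra K L] {s x y : L}
    (hC : Polynomial.aeval s fr.C ≠ 0)
    (hA : Polynomial.aeval s fr.A = x * Polynomial.aeval s fr.C)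
    (hB : Polynomial.aeval s fr.B = y * Polynomial.aeval s fr.C) :
    MvPolynomial.eval₂ (algebraMap K L) (fun u => algebraMap K L (p u)
      + algebraMap K L (fr.e₁ u) * x + algebraMap K L (fr.e₂ u) * y) F = 0 := by
  have h1 := fr.eval₂_eq_zero hFf s
  have h2 := eval₂_mul_of_isHomogeneous (algebraMap K L) hF (fun u => algebraMap K L (p u)
      + algebraMap K L (fr.e₁ u) * x + algebraMap K L (fr.e₂ u) * y) (Polynomial.aeval s fr.C)
  have h3 : (fun u => algebraMap K L (p u) * Polynomial.aeval s fr.C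
      + algebraMap K L (fr.e₁ u) * Polynomial.aeval s fr.A
      + algebraMap K L (fr.e₂ u) * Polynomial.aeval s fr.B)
      = fun u => (algebraMap K L (p u) + algebraMap K L (fr.e₁ u) * x
        + algebraMap K L (fr.e₂ u) * y) * Polynomial.aeval s fr.C := by
    funext u
    rw [hA, hB]
    ring
  rw [h3, h2] at h1
  exact (mul_eq_zero.1 h1).resolve_left (pow_ne_zero _ hC)

theorem eval_C_ne_zero (fr : LocalFrame n d f F p G) (hf : IsProperParam n f)
    (hF : F.IsHomogeneous n) (hFf : MvPolynomial.aeval f F = 0) {τ : K} (hτ : fr.A.eval τ = 0) :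
    fr.C.eval τ ≠ 0 := by
  intro hC
  have h1 := fr.eval₂_eq_zero hFf τ
  have h2 := eval₂_mul_of_isHomogeneous (algebraMap K K) hF fr.e₂ (fr.B.eval τ)
  simp only [Polynomial.coe_aeval_eq_eval, hC, hτ, mul_zero, zero_add,
    Algebra.algebraMap_self, RingHom.id_apply] at h1 h2
  rw [h1, eq_comm] at h2
  rcases mul_eq_zero.1 h2 with h3 | h3
  · have hB := eq_zero_of_pow_eq_zero h3
    have hw : (fun i => fr.v i * τ + fr.v' i) ≠ 0 := by
      intro h0
      have e0 := congrFun h0 0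
      have e1 := congrFun h0 1
      simp only [Pi.zero_apply] at e0 e1
      exact fr.det_ne_zero (by linear_combination fr.v 0 * e1 - fr.v 1 * e0)
    refine hf.no_common_zero _ hw (funext fun u => ?_)
    rw [evalVec, ← eval_restrictLine, fr.restrictLine_eq]
    simp [hB, hC, hτ]
  · exact fr.eval_e₂_ne_zero h3

theorem A_ne_zero (fr : LocalFrame n d f F p G) (hn : n ≠ 0) : fr.A ≠ 0 := by
  intro h
  apply hn
  rw [← fr.natDegree_A]
  exact (congrArg Polynomial.natDegree h).trans Polynomial.natDegree_zero

theorem Γ_ne_zero (fr : LocalFrame n d f F p G) (hn : n ≠ 0) : fr.Γ ≠ 0 := by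
  intro h
  apply fr.A_ne_zero hn
  rw [A, fr.eq_A]
  exact (congrArg (· * fr.A') h).trans (zero_mul _)

theorem A'_ne_zero (fr : LocalFrame n d f F p G) (hn : n ≠ 0) : fr.A' ≠ 0 := by
  intro h
  apply fr.A_ne_zero hn
  rw [A, fr.eq_A, h, mul_zero]

theorem C_ne_zero [IsAlgClosed K] (fr : LocalFrame n d f F p G) (hn : n ≠ 0)
    (hf : IsProperParam n f)
    (hF : F.IsHomogeneous n) (hFf : MvPolynomial.aeval f F = 0) : fr.C ≠ 0 := by
  obtain ⟨τ, hτ⟩ := IsAlgClosed.exists_root fr.A (by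
    rw [Polynomial.degree_eq_natDegree (fr.A_ne_zero hn), fr.natDegree_A]
    exact_mod_cast hn)
  intro h
  exact fr.eval_C_ne_zero hf hF hFf hτ ((congrArg (Polynomial.eval τ) h).trans Polynomial.eval_zero)

theorem isCoprime_A_C [IsAlgClosed K] (fr : LocalFrame n d f F p G)
    (hf : IsProperParam n f)
    (hF : F.IsHomogeneous n) (hFf : MvPolynomial.aeval f F = 0) : IsCoprime fr.A fr.C :=
  (Polynomial.isCoprime_iff_aeval_ne_zero_of_isAlgClosed K K fr.A fr.C).2 fun _ =>
    or_iff_not_imp_left.2 fun h => fr.eval_C_ne_zero hf hF hFf (not_not.1 h)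

theorem eq_of_affine_eq [IsAlgClosed K] (fr : LocalFrame n d f F p G) (hn : n ≠ 0)
    (hf : IsProperParam n f)
    (hF : F.IsHomogeneous n) (hFf : MvPolynomial.aeval f F = 0)
    {L : Type*} [CommRing L] [IsDomain L] [Algebra K L] {s s' : L}
    (hs : Transcendental K s) (hs' : Transcendental K s')
    (hA : Polynomial.aeval s fr.A * Polynomial.aeval s' fr.C
      = Polynomial.aeval s' fr.A * Polynomial.aeval s fr.C)
    (hB : Polynomial.aeval s fr.B * Polynomial.aeval s' fr.C
      = Polynomial.aeval s' fr.B * Polynomial.aeval s fr.C) : s = s' := by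
  have hC0 := fr.C_ne_zero hn hf hF hFf
  have hCs : Polynomial.aeval s fr.C ≠ 0 := fun h => hs ⟨_, hC0, h⟩
  have hCs' : Polynomial.aeval s' fr.C ≠ 0 := fun h => hs' ⟨_, hC0, h⟩
  have hAB : Polynomial.aeval s fr.A * Polynomial.aeval s' fr.B
      = Polynomial.aeval s' fr.A * Polynomial.aeval s fr.B := by
    refine mul_right_cancel₀ (mul_ne_zero hCs hCs') ?_
    linear_combination (Polynomial.aeval s' fr.B * Polynomial.aeval s fr.C) * hA
      - (Polynomial.aeval s' fr.A * Polynomial.aeval s fr.C) * hB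
  refine hf.eq_of_cross fr.det_ne_zero hs hs' fun i j => ?_
  rw [fr.restrictLine_eq i, fr.restrictLine_eq j]
  simp only [map_add, map_mul, Polynomial.aeval_C]
  linear_combination (algebraMap K L (fr.e₁ i) * algebraMap K L (p j)
      - algebraMap K L (fr.e₁ j) * algebraMap K L (p i)) * hA
    + (algebraMap K L (fr.e₂ i) * algebraMap K L (p j)
      - algebraMap K L (fr.e₂ j) * algebraMap K L (p i)) * hB
    + (algebraMap K L (fr.e₁ i) * algebraMap K L (fr.e₂ j)
      - algebraMap K L (fr.e₁ j) * algebraMap K L (fr.e₂ i)) * hAB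

end LocalFrame

end

section

namespace LocalFrame

variable {K : Type*} [Field K] {n d : ℕ} {f : Fin 3 → MvPolynomial (Fin 2) K}
  {F : MvPolynomial (Fin 3) K} {p : Fin 3 → K} {G : MvPolynomial (Fin 2) K}

variable {Ω : Type*} [Field Ω] [Algebra K Ω]

theorem transcendental_of_affine_eq [IsAlgClosed K] (fr : LocalFrame n d f F p G)
    (hf : IsProperParam n f) (hF : F.IsHomogeneous n) (hFf : MvPolynomial.aeval f F = 0)
    {r s : Ω} (hr : Transcendental K r)
    (hs : Polynomial.aeval s fr.A = r * Polynomial.aeval s fr.C) : Transcendental K s := by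
  intro halg
  obtain ⟨τ, rfl⟩ : ∃ τ, algebraMap K Ω τ = s :=
    minpoly.mem_range_of_degree_eq_one K s (IsAlgClosed.degree_eq_one_of_irreducible K
      (minpoly.irreducible halg.isIntegral))
  rw [Polynomial.aeval_algebraMap_apply_eq_algebraMap_eval,
    Polynomial.aeval_algebraMap_apply_eq_algebraMap_eval] at hs
  by_cases hC : fr.C.eval τ = 0
  · rw [hC, map_zero, mul_zero, map_eq_zero] at hs
    exact fr.eval_C_ne_zero hf hF hFf hs hC
  · apply hr
    have : r = algebraMap K Ω (fr.A.eval τ / fr.C.eval τ) := by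
      rw [map_div₀, eq_div_iff (by rwa [Ne, map_eq_zero]), hs]
    rw [this]
    exact isAlgebraic_algebraMap _

/-- The polynomial whose roots are the parameters of the points with affine coordinate
`x = r`. -/
abbrev fiber (fr : LocalFrame n d f F p G) (r : Ω) : Polynomial Ω :=
  fr.A.map (algebraMap K Ω) - Polynomial.C r * fr.C.map (algebraMap K Ω)

theorem eval_fiber (fr : LocalFrame n d f F p G) (r s : Ω) :
    (fr.fiber r).eval s = Polynomial.aeval s fr.A - r * Polynomial.aeval s fr.C := by
  simp [fiber]

theorem natDegree_C_le (fr : LocalFrame n d f F p G) (hf : IsProperParam n f) :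
    fr.C.natDegree ≤ n :=
  restrictLine_natDegree_le (isHomogeneous_linComb hf.homog _) _ _

theorem natDegree_B_le (fr : LocalFrame n d f F p G) (hf : IsProperParam n f) :
    fr.B.natDegree ≤ n :=
  restrictLine_natDegree_le (isHomogeneous_linComb hf.homog _) _ _

theorem natDegree_fiber (fr : LocalFrame n d f F p G) (hn : n ≠ 0) (hf : IsProperParam n f)
    {r : Ω} (hr : Transcendental K r) : (fr.fiber r).natDegree = n := by
  refine le_antisymm ?_ (Polynomial.le_natDegree_of_ne_zero ?_)
  · refine (Polynomial.natDegree_sub_le _ _).trans (max_le ?_ ?_)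
    · exact Polynomial.natDegree_map_le.trans fr.natDegree_A.le
    · exact (Polynomial.natDegree_C_mul_le _ _).trans
        (Polynomial.natDegree_map_le.trans (fr.natDegree_C_le hf))
  · intro h
    apply hr
    rw [Polynomial.coeff_sub, Polynomial.coeff_C_mul, Polynomial.coeff_map,
      Polynomial.coeff_map] at h
    refine ⟨Polynomial.C (fr.A.coeff n) - Polynomial.C (fr.C.coeff n) * Polynomial.X, ?_, ?_⟩
    · intro h0
      have h1 := congrArg (fun q => Polynomial.coeff q 0) h0
      simp at h1
      apply fr.A_ne_zero hn
      rw [← Polynomial.leadingCoeff_eq_zero, Polynomial.leadingCoeff, fr.natDegree_A]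
      exact h1
    · simp only [map_sub, map_mul, Polynomial.aeval_C, Polynomial.aeval_X]
      linear_combination h

theorem nodup_roots_fiber [IsAlgClosed K] [CharZero K] (fr : LocalFrame n d f F p G) (hn : n ≠ 0)
    (hf : IsProperParam n f) (hF : F.IsHomogeneous n) (hFf : MvPolynomial.aeval f F = 0)
    {r : Ω} (hr : Transcendental K r) : (fr.fiber r).roots.Nodup := by
  classical
  have hq0 : fr.fiber r ≠ 0 := fun h => hn (by
    rw [← fr.natDegree_fiber hn hf hr]
    exact (congrArg Polynomial.natDegree h).trans Polynomial.natDegree_zero)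
  rw [Multiset.nodup_iff_count_le_one]
  intro s
  by_contra! hlt
  rw [Polynomial.count_roots] at hlt
  obtain ⟨h2, h1⟩ := (Polynomial.one_lt_rootMultiplicity_iff_isRoot hq0).1 hlt
  rw [Polynomial.IsRoot] at h1 h2
  rw [eval_fiber] at h2
  simp only [fiber, Polynomial.derivative_sub, Polynomial.derivative_C_mul,
    Polynomial.derivative_map, Polynomial.eval_sub, Polynomial.eval_mul, Polynomial.eval_C,
    Polynomial.eval_map_algebraMap] at h1
  have hs := fr.transcendental_of_affine_eq hf hF hFf hr (sub_eq_zero.1 h2)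
  have hw : Polynomial.wronskian fr.A fr.C = 0 := by
    by_contra hne
    refine hs ⟨_, hne, ?_⟩
    simp only [Polynomial.wronskian, map_sub, map_mul]
    linear_combination Polynomial.aeval s (Polynomial.derivative fr.C) * h2
      - Polynomial.aeval s fr.C * h1
  have hA := ((fr.isCoprime_A_C hf hF hFf).wronskian_eq_zero_iff.1 hw).1
  have := Polynomial.derivative_eq_zero.1 hA
  rw [fr.natDegree_A] at this
  exact hn this

theorem prod_eval_fiber [IsAlgClosed K] [CharZero K] [IsAlgClosed Ω]
    (fr : LocalFrame n d f F p G) (hn : n ≠ 0)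
    (hf : IsProperParam n f) (hF : F.IsHomogeneous n) (hFf : MvPolynomial.aeval f F = 0)
    {r : Ω} (hr : Transcendental K r) (y : Ω) :
    ((fr.fiber r).roots.map fun s => Polynomial.aeval s fr.C).prod *
      MvPolynomial.eval₂ (algebraMap K Ω) (fun u => algebraMap K Ω (p u)
        + algebraMap K Ω (fr.e₁ u) * r + algebraMap K Ω (fr.e₂ u) * y) F
    = algebraMap K Ω (MvPolynomial.eval fr.e₂ F) * ((fr.fiber r).roots.map fun s =>
      y * Polynomial.aeval s fr.C - Polynomial.aeval s fr.B).prod := by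
  have hq0 : fr.fiber r ≠ 0 := fun h => hn (by
    rw [← fr.natDegree_fiber hn hf hr]
    exact (congrArg Polynomial.natDegree h).trans Polynomial.natDegree_zero)
  have hC0 := fr.C_ne_zero hn hf hF hFf
  have hroot (s) (hs : s ∈ (fr.fiber r).roots) :
      Polynomial.aeval s fr.A = r * Polynomial.aeval s fr.C := by
    have := (Polynomial.mem_roots hq0).1 hs
    rw [Polynomial.IsRoot, eval_fiber] at this
    exact sub_eq_zero.1 this
  have htr (s) (hs : s ∈ (fr.fiber r).roots) : Transcendental K s :=
    fr.transcendental_of_affine_eq hf hF hFf hr (hroot s hs)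
  have hCs (s) (hs : s ∈ (fr.fiber r).roots) : Polynomial.aeval s fr.C ≠ 0 :=
    fun h => htr s hs ⟨_, hC0, h⟩
  obtain ⟨P, hP⟩ : ∃ P : Polynomial Ω, P = MvPolynomial.eval₂
      (Polynomial.C.comp (algebraMap K Ω)) (fun u => Polynomial.C (algebraMap K Ω (fr.e₂ u)) *
        Polynomial.X + Polynomial.C (algebraMap K Ω (p u) + algebraMap K Ω (fr.e₁ u) * r)) F :=
    ⟨_, rfl⟩
  have hPeval (z : Ω) : P.eval z = MvPolynomial.eval₂ (algebraMap K Ω) (fun u =>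
      algebraMap K Ω (p u) + algebraMap K Ω (fr.e₁ u) * r + algebraMap K Ω (fr.e₂ u) * z) F := by
    rw [hP, ← Polynomial.coe_evalRingHom, MvPolynomial.hom_eval₂]
    congr 1
    · ext; simp
    · funext u; simp; ring
  have hPdeg : P.natDegree ≤ n := by
    rw [hP]
    exact natDegree_eval₂_linear_le _ hF _ _
  have hPcoeff : P.coeff n = algebraMap K Ω (MvPolynomial.eval fr.e₂ F) := by
    rw [hP, coeff_eval₂_linear _ hF, MvPolynomial.eval, MvPolynomial.coe_eval₂Hom,
      MvPolynomial.hom_eval₂]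
    rfl
  have hFe : algebraMap K Ω (MvPolynomial.eval fr.e₂ F) ≠ 0 := by
    rw [Ne, map_eq_zero]
    exact fr.eval_e₂_ne_zero
  have hPn : P.natDegree = n :=
    le_antisymm hPdeg (Polynomial.le_natDegree_of_ne_zero (by rw [hPcoeff]; exact hFe))
  have hP0 : P ≠ 0 := by
    rintro h0
    rw [h0, Polynomial.coeff_zero] at hPcoeff
    exact hFe hPcoeff.symm
  let Y (s : Ω) : Ω := Polynomial.aeval s fr.B / Polynomial.aeval s fr.C
  have hle : (fr.fiber r).roots.map Y ≤ P.roots := by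
    rw [Multiset.le_iff_subset]
    · intro z hz
      obtain ⟨s, hs, rfl⟩ := Multiset.mem_map.1 hz
      rw [Polynomial.mem_roots hP0, Polynomial.IsRoot, hPeval]
      exact fr.eval₂_affine_eq_zero hF hFf (hCs s hs) (hroot s hs)
        (div_mul_cancel₀ _ (hCs s hs)).symm
    · refine Multiset.Nodup.map_on ?_ (fr.nodup_roots_fiber hn hf hF hFf hr)
      intro s hs s' hs' hss
      refine fr.eq_of_affine_eq hn hf hF hFf (htr s hs) (htr s' hs') ?_ ?_
      · rw [hroot s hs, hroot s' hs']; ring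
      · exact (div_eq_div_iff (hCs s hs) (hCs s' hs')).1 hss
  have hcard : (fr.fiber r).roots.card = n := by
    rw [← Polynomial.Splits.natDegree_eq_card_roots (IsAlgClosed.splits _),
      fr.natDegree_fiber hn hf hr]
  have hroots : (fr.fiber r).roots.map Y = P.roots := by
    refine Multiset.eq_of_le_of_card_le hle ?_
    rw [Multiset.card_map, hcard, ← hPn]
    exact P.card_roots'
  have hprod := Polynomial.Splits.eq_prod_roots (IsAlgClosed.splits P)
  rw [← hPeval, hprod, Polynomial.leadingCoeff, hPn, hPcoeff, ← hroots, Polynomial.eval_mul,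
    Polynomial.eval_C, mul_left_comm]
  congr 1
  rw [Polynomial.eval_multiset_prod, Multiset.map_map, Multiset.map_map, ← Multiset.prod_map_mul]
  congr 1
  refine Multiset.map_congr rfl fun s hs => ?_
  have := hCs s hs
  simp [Y]
  field_simp

end LocalFrame

end

section

namespace LocalFrame

variable {K : Type*} [Field K] {n d : ℕ} {f : Fin 3 → MvPolynomial (Fin 2) K}
  {F : MvPolynomial (Fin 3) K} {p : Fin 3 → K} {G : MvPolynomial (Fin 2) K}

/-- The resultant of a fiber and a polynomial of degree at most `n`. -/
theorem aeval_resultant_fiber {Ω : Type*} [Field Ω] [Algebra K Ω] [IsAlgClosed Ω]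
    (fr : LocalFrame n d f F p G) (hn : n ≠ 0) (hf : IsProperParam n f)
    {r : Ω} (hr : Transcendental K r) (H : Polynomial K) (hH : H.natDegree ≤ n) :
    Polynomial.aeval r (Polynomial.resultant
      (fr.A.map Polynomial.C - Polynomial.C Polynomial.X * fr.C.map Polynomial.C)
      (H.map Polynomial.C) n n)
    = (fr.fiber r).leadingCoeff ^ n *
      ((fr.fiber r).roots.map fun s => Polynomial.aeval s H).prod := by
  have hφ : (Polynomial.aeval (R := K) r).toRingHom.comp Polynomial.C = algebraMap K Ω := by
    ext; simp
  have h1 := Polynomial.resultant_map_map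
    (fr.A.map Polynomial.C - Polynomial.C Polynomial.X * fr.C.map Polynomial.C)
    (H.map Polynomial.C) n n (Polynomial.aeval (R := K) r).toRingHom
  rw [Polynomial.map_sub, Polynomial.map_mul, Polynomial.map_map, Polynomial.map_map,
    Polynomial.map_map, hφ, Polynomial.map_C] at h1
  have h2 : (Polynomial.aeval (R := K) r).toRingHom Polynomial.X = r := Polynomial.aeval_X r
  rw [h2] at h1
  refine h1.symm.trans ?_
  have h3 := Polynomial.resultant_eq_prod_eval (fr.fiber r) (H.map (algebraMap K Ω)) n
    (Polynomial.natDegree_map_le.trans hH) (IsAlgClosed.splits _)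
  rw [fr.natDegree_fiber hn hf hr] at h3
  refine h3.trans ?_
  simp only [Polynomial.eval_map_algebraMap]

theorem eval_zero_resultant_fiber [IsAlgClosed K] (fr : LocalFrame n d f F p G)
    (H : Polynomial K) (hH : H.natDegree ≤ n) :
    Polynomial.eval 0 (Polynomial.resultant
      (fr.A.map Polynomial.C - Polynomial.C Polynomial.X * fr.C.map Polynomial.C)
      (H.map Polynomial.C) n n)
    = fr.A.leadingCoeff ^ n * (fr.A.roots.map H.eval).prod := by
  have hφ : (Polynomial.evalRingHom (0 : K)).comp Polynomial.C = RingHom.id K := by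
    ext; simp
  have h1 := Polynomial.resultant_map_map
    (fr.A.map Polynomial.C - Polynomial.C Polynomial.X * fr.C.map Polynomial.C)
    (H.map Polynomial.C) n n (Polynomial.evalRingHom (0 : K))
  rw [Polynomial.map_sub, Polynomial.map_mul, Polynomial.map_map, Polynomial.map_map,
    Polynomial.map_map, hφ, Polynomial.map_C, Polynomial.map_id, Polynomial.map_id,
    Polynomial.coe_evalRingHom, Polynomial.eval_X, Polynomial.C_0, zero_mul, sub_zero] at h1
  rw [Polynomial.map_id] at h1
  refine h1.symm.trans ?_
  have h3 := Polynomial.resultant_eq_prod_eval fr.A H n hH (IsAlgClosed.splits _)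
  rwa [fr.natDegree_A] at h3

/-- The product over the fiber `A = 0`, at a value `y` of the other affine coordinate. -/
theorem prod_eval_roots_A [IsAlgClosed K] [CharZero K] (fr : LocalFrame n d f F p G) (hn : n ≠ 0)
    (hf : IsProperParam n f) (hF : F.IsHomogeneous n) (hFf : MvPolynomial.aeval f F = 0) (y : K) :
    (fr.A.roots.map fr.C.eval).prod * (lineRestrict F p fr.e₂).eval y
      = MvPolynomial.eval fr.e₂ F *
        (fr.A.roots.map (Polynomial.C y * fr.C - fr.B).eval).prod := by
  let Ω := AlgebraicClosure (RatFunc K)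
  obtain ⟨r, hr⟩ : ∃ r : Ω, Transcendental K r := by
    refine ⟨algebraMap (RatFunc K) Ω RatFunc.X, ?_⟩
    rw [transcendental_algebraMap_iff (FaithfulSMul.algebraMap_injective _ _)]
    exact RatFunc.transcendental_X
  obtain ⟨E, hE⟩ : ∃ E : Polynomial K, E = MvPolynomial.eval₂ Polynomial.C (fun u =>
      Polynomial.C (p u) + Polynomial.C (fr.e₁ u) * Polynomial.X
        + Polynomial.C (fr.e₂ u) * Polynomial.C y) F := ⟨_, rfl⟩
  obtain ⟨R, hR⟩ : ∃ R : Polynomial K → Polynomial K, R = fun H => Polynomial.resultant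
      (fr.A.map Polynomial.C - Polynomial.C Polynomial.X * fr.C.map Polynomial.C)
      (H.map Polynomial.C) n n := ⟨_, rfl⟩
  have hCdeg := fr.natDegree_C_le hf
  have hBdeg : (Polynomial.C y * fr.C - fr.B).natDegree ≤ n :=
    (Polynomial.natDegree_sub_le _ _).trans (max_le
      ((Polynomial.natDegree_C_mul_le _ _).trans hCdeg) (fr.natDegree_B_le hf))
  have key : R fr.C * E = Polynomial.C (MvPolynomial.eval fr.e₂ F) *
      R (Polynomial.C y * fr.C - fr.B) := by
    apply transcendental_iff_injective.1 hr
    rw [map_mul, map_mul, hR]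
    simp only
    rw [fr.aeval_resultant_fiber hn hf hr _ hCdeg, fr.aeval_resultant_fiber hn hf hr _ hBdeg]
    have hE' : Polynomial.aeval r E = MvPolynomial.eval₂ (algebraMap K Ω) (fun u =>
        algebraMap K Ω (p u) + algebraMap K Ω (fr.e₁ u) * r
          + algebraMap K Ω (fr.e₂ u) * algebraMap K Ω y) F := by
      rw [hE, ← AlgHom.coe_toRingHom, MvPolynomial.hom_eval₂]
      congr 1
      · ext; simp
      · funext u; simp
    have := fr.prod_eval_fiber hn hf hF hFf hr (algebraMap K Ω y)
    rw [hE', mul_assoc, this, Polynomial.aeval_C, mul_left_comm]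
    simp only [map_sub, map_mul, Polynomial.aeval_C]
  have k0 := congrArg (Polynomial.eval 0) key
  have hE0 : E.eval 0 = (lineRestrict F p fr.e₂).eval y := by
    rw [hE, lineRestrict, ← Polynomial.coe_evalRingHom, ← Polynomial.coe_evalRingHom,
      MvPolynomial.hom_eval₂, MvPolynomial.hom_eval₂]
    congr 1
    · ext; simp
    · funext u; simp
  rw [Polynomial.eval_mul, Polynomial.eval_mul, hE0, Polynomial.eval_C, hR] at k0
  simp only at k0
  rw [fr.eval_zero_resultant_fiber _ hCdeg, fr.eval_zero_resultant_fiber _ hBdeg] at k0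
  have hlc : fr.A.leadingCoeff ^ n ≠ 0 :=
    pow_ne_zero _ (Polynomial.leadingCoeff_ne_zero.2 (fr.A_ne_zero hn))
  refine mul_left_cancel₀ hlc ?_
  linear_combination k0

/-- At a double point the gcd of the cross differences is a quadratic form. -/
theorem degree_eq_two [IsAlgClosed K] [CharZero K] (fr : LocalFrame n d f F p G) (hn : n ≠ 0)
    (hf : IsProperParam n f) (hF : F.IsHomogeneous n) (hFf : MvPolynomial.aeval f F = 0)
    (h2 : (Polynomial.X : Polynomial K) ^ 2 ∣ lineRestrict F p fr.e₂) : d = 2 := by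
  have hid : Polynomial.C ((fr.A.roots.map fr.C.eval).prod) * lineRestrict F p fr.e₂
      = Polynomial.C (MvPolynomial.eval fr.e₂ F) * (fr.A.roots.map fun τ =>
        Polynomial.C (fr.C.eval τ) * Polynomial.X - Polynomial.C (fr.B.eval τ)).prod := by
    refine Polynomial.funext fun y => ?_
    rw [Polynomial.eval_mul, Polynomial.eval_mul, Polynomial.eval_C, Polynomial.eval_C,
      fr.prod_eval_roots_A hn hf hF hFf, Polynomial.eval_multiset_prod, Multiset.map_map]
    refine congrArg _ (congrArg _ (Multiset.map_congr rfl fun τ _ => ?_))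
    simp only [Function.comp, Polynomial.eval_sub, Polynomial.eval_mul, Polynomial.eval_C,
      Polynomial.eval_X]
    ring
  have hA0 := fr.A_ne_zero hn
  have hroots : fr.A.roots = fr.Γ.roots + fr.A'.roots := by
    have : fr.A = fr.Γ * fr.A' := fr.eq_A
    rw [this, Polynomial.roots_mul (this ▸ hA0)]
  have hC0 {τ : K} (hτ : τ ∈ fr.A.roots) : fr.C.eval τ ≠ 0 :=
    fr.eval_C_ne_zero hf hF hFf ((Polynomial.mem_roots hA0).1 hτ)
  have hcard : fr.Γ.roots.card = d := by
    rw [← Polynomial.Splits.natDegree_eq_card_roots (IsAlgClosed.splits _)]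
    exact fr.natDegree_gcd
  have hΓ : (fr.Γ.roots.map fun τ =>
      Polynomial.C (fr.C.eval τ) * Polynomial.X - Polynomial.C (fr.B.eval τ)).prod
      = Polynomial.C ((fr.Γ.roots.map fr.C.eval).prod) * Polynomial.X ^ d := by
    have h1 : fr.Γ.roots.map (fun τ => Polynomial.C (fr.C.eval τ) * Polynomial.X
        - Polynomial.C (fr.B.eval τ)) = fr.Γ.roots.map (fun τ => Polynomial.C (fr.C.eval τ) *
          Polynomial.X) := by
      refine Multiset.map_congr rfl fun τ hτ => ?_
      have hB : fr.B.eval τ = 0 := by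
        have : fr.B = fr.Γ * fr.B' := fr.eq_B
        rw [this, Polynomial.eval_mul, (Polynomial.mem_roots (fr.Γ_ne_zero hn)).1 hτ, zero_mul]
      rw [hB, Polynomial.C_0, sub_zero]
    rw [h1, Multiset.prod_map_mul, Multiset.map_const', Multiset.prod_replicate, hcard,
      map_multiset_prod, Multiset.map_map]
    rfl
  obtain ⟨u, hu⟩ : ∃ u : Polynomial K, u = (fr.A'.roots.map fun τ =>
      Polynomial.C (fr.C.eval τ) * Polynomial.X - Polynomial.C (fr.B.eval τ)).prod := ⟨_, rfl⟩
  have hu0 : u.coeff 0 ≠ 0 := by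
    rw [Polynomial.coeff_zero_eq_eval_zero, hu, Polynomial.eval_multiset_prod, Multiset.map_map]
    refine Multiset.prod_ne_zero fun h0 => ?_
    obtain ⟨τ, hτ, h⟩ := Multiset.mem_map.1 h0
    have hA' : fr.A'.eval τ = 0 := (Polynomial.mem_roots (fr.A'_ne_zero hn)).1 hτ
    have hB : fr.B = fr.Γ * fr.B' := fr.eq_B
    simp [hB, fr.eval_B'_ne_zero τ hA'] at h
    exact fr.eval_A'_ne_zero τ h hA'
  have hκ : (fr.A.roots.map fr.C.eval).prod ≠ 0 := by
    refine Multiset.prod_ne_zero fun h0 => ?_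
    obtain ⟨τ, hτ, h⟩ := Multiset.mem_map.1 h0
    exact hC0 hτ h
  have hκ' : (fr.Γ.roots.map fr.C.eval).prod ≠ 0 := by
    refine Multiset.prod_ne_zero fun h0 => ?_
    obtain ⟨τ, hτ, h⟩ := Multiset.mem_map.1 h0
    exact hC0 (by rw [hroots]; exact Multiset.mem_add.2 (Or.inl hτ)) h
  rw [hroots, Multiset.map_add, Multiset.map_add, Multiset.prod_add, Multiset.prod_add, hΓ, ← hu,
    ← Multiset.prod_add, ← Multiset.map_add, ← hroots] at hid
  have hid' : Polynomial.C ((fr.A.roots.map fr.C.eval).prod) * lineRestrict F p fr.e₂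
      = Polynomial.C (MvPolynomial.eval fr.e₂ F * (fr.Γ.roots.map fr.C.eval).prod) * u *
        Polynomial.X ^ d := by
    rw [hid, map_mul]; ring
  apply le_antisymm
  · by_contra! hlt
    have := congrArg (fun q => Polynomial.coeff q 2) hid'
    simp only [Polynomial.coeff_C_mul] at this
    rw [Polynomial.coeff_mul_X_pow', if_neg (by omega)] at this
    exact mul_ne_zero hκ fr.coeff_two_ne_zero this
  · by_contra! hlt
    obtain ⟨w, hw⟩ := h2
    have := congrArg (fun q => Polynomial.coeff q d) hid'
    simp only [Polynomial.coeff_C_mul] at this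
    rw [Polynomial.coeff_mul_X_pow', if_pos le_rfl, Nat.sub_self, hw,
      Polynomial.coeff_X_pow_mul', if_neg (by omega), mul_zero, Polynomial.coeff_C_mul] at this
    exact mul_ne_zero (mul_ne_zero fr.eval_e₂_ne_zero hκ') hu0 this.symm

end LocalFrame

end

section

/-- The coefficient rows of the products of the quadratic form with coefficients `x` by the
monomials of degree `N`. -/
def quadRow {D : Type*} [CommRing D] (N : ℕ) (x : Fin 3 → D) (j : Fin (N + 1))
    (c : Fin (N + 3)) : D :=
  if h : (j : ℕ) ≤ (c : ℕ) ∧ (c : ℕ) ≤ (j : ℕ) + 2 then x ⟨(c : ℕ) - (j : ℕ), by omega⟩ else 0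

/-- The values at `σ` of the monomials of degree `N + 2`. -/
def monomialValues {D : Type*} [CommRing D] (N : ℕ) (σ : Fin 2 → D) (c : Fin (N + 3)) : D :=
  σ 0 ^ (N + 2 - (c : ℕ)) * σ 1 ^ (c : ℕ)

/-- The coefficients of the quadratic form with roots `σ` and `τ`. -/
def quadOf {D : Type*} [CommRing D] (σ τ : Fin 2 → D) : Fin 3 → D :=
  ![σ 1 * τ 1, -(σ 0 * τ 1 + τ 0 * σ 1), σ 0 * τ 0]

/-- The columns, split into the first `N + 1` and the last two. -/
def colEquiv (N : ℕ) : Fin (N + 1) ⊕ Fin 2 ≃ Fin (N + 3) :=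
  finSumFinEquiv (m := N + 1) (n := 2)

theorem val_colEquiv_inl {N : ℕ} (c : Fin (N + 1)) : (colEquiv N (Sum.inl c) : ℕ) = c := rfl

theorem val_colEquiv_inr {N : ℕ} (c : Fin 2) : (colEquiv N (Sum.inr c) : ℕ) = N + 1 + c := rfl

/-- The square matrix with the rows `quadRow N x` and the two additional rows `h`. -/
def quadStack {D : Type*} [CommRing D] {N : ℕ} (x : Fin 3 → D) (h : Fin 2 → Fin (N + 3) → D) :
    Matrix (Fin (N + 1) ⊕ Fin 2) (Fin (N + 1) ⊕ Fin 2) D :=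
  fun i c => Sum.elim (quadRow N x) h i (colEquiv N c)

section

variable {D : Type*} [CommRing D] {N : ℕ}

theorem quadRow_eq_sum (x : Fin 3 → D) (j : Fin (N + 1)) (c : Fin (N + 3)) :
    quadRow N x j c = ∑ i : Fin 3, if (c : ℕ) = (j : ℕ) + (i : ℕ) then x i else 0 := by
  rw [quadRow]
  split_ifs with h
  · rw [Finset.sum_eq_single (⟨(c : ℕ) - (j : ℕ), by omega⟩ : Fin 3)]
    · rw [if_pos]
      simp only
      omega
    · intro b _ hb
      rw [if_neg]
      intro h'
      apply hb
      ext
      simp only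
      omega
    · simp
  · refine (Finset.sum_eq_zero fun i _ => if_neg ?_).symm
    have := i.isLt
    omega

theorem sum_quadRow_mul (x : Fin 3 → D) (j : Fin (N + 1)) (w : Fin (N + 3) → D) :
    ∑ c, quadRow N x j c * w c = ∑ i : Fin 3, x i * w ⟨(j : ℕ) + (i : ℕ), by omega⟩ := by
  simp only [quadRow_eq_sum, Finset.sum_mul]
  rw [Finset.sum_comm]
  refine Finset.sum_congr rfl fun i _ => ?_
  rw [Finset.sum_eq_single (⟨(j : ℕ) + (i : ℕ), by omega⟩ : Fin (N + 3))]
  · simp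
  · intro b _ hb
    rw [if_neg, zero_mul]
    intro h
    exact hb (Fin.ext h)
  · simp

theorem sum_quadRow_mul_monomialValues (x : Fin 3 → D) (j : Fin (N + 1)) (σ : Fin 2 → D) :
    ∑ c, quadRow N x j c * monomialValues N σ c
      = σ 0 ^ (N - (j : ℕ)) * σ 1 ^ (j : ℕ) *
        (x 0 * σ 0 ^ 2 + x 1 * (σ 0 * σ 1) + x 2 * σ 1 ^ 2) := by
  have hj := j.isLt
  rw [sum_quadRow_mul, Fin.sum_univ_three]
  simp only [monomialValues, Fin.val_zero, Fin.val_one, Fin.val_two, add_zero]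
  rw [show N + 2 - (j : ℕ) = N - j + 2 by omega, show N + 2 - ((j : ℕ) + 1) = N - j + 1 by omega,
    show N + 2 - ((j : ℕ) + 2) = N - j by omega]
  ring

theorem sum_quadRow_quadOf_left (σ τ : Fin 2 → D) (j : Fin (N + 1)) :
    ∑ c, quadRow N (quadOf σ τ) j c * monomialValues N σ c = 0 := by
  rw [sum_quadRow_mul_monomialValues]
  simp only [quadOf, Matrix.cons_val_zero, Matrix.cons_val_one, Matrix.cons_val]
  ring

theorem sum_quadRow_quadOf_right (σ τ : Fin 2 → D) (j : Fin (N + 1)) :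
    ∑ c, quadRow N (quadOf σ τ) j c * monomialValues N τ c = 0 := by
  rw [sum_quadRow_mul_monomialValues]
  simp only [quadOf, Matrix.cons_val_zero, Matrix.cons_val_one, Matrix.cons_val]
  ring

theorem det_quadStack_aux (σ : Fin 2 → Fin 2 → D) (h : Fin 2 → Fin (N + 3) → D) :
    (quadStack (quadOf (σ 0) (σ 1)) h).det *
      ((σ 0 1 * σ 1 1) ^ (N + 1) * (σ 0 0 * σ 1 1 - σ 1 0 * σ 0 1))
    = (σ 0 1 * σ 1 1) ^ (N + 1) *
      ((∑ c, h 0 c * monomialValues N (σ 0) c) * (∑ c, h 1 c * monomialValues N (σ 1) c)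
        - (∑ c, h 0 c * monomialValues N (σ 1) c) * (∑ c, h 1 c * monomialValues N (σ 0) c)) := by
  let W₁ : Matrix (Fin (N + 1)) (Fin 2) D :=
    fun c i => monomialValues N (σ i) (colEquiv N (Sum.inl c))
  let W₂ : Matrix (Fin 2) (Fin 2) D :=
    fun c i => monomialValues N (σ i) (colEquiv N (Sum.inr c))
  let W : Matrix (Fin (N + 1) ⊕ Fin 2) (Fin (N + 1) ⊕ Fin 2) D := Matrix.fromBlocks 1 W₁ 0 W₂
  let S := quadStack (quadOf (σ 0) (σ 1)) h
  have hmul (i) (k : Fin 2) : (S * W) i (Sum.inr k)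
      = ∑ c, Sum.elim (quadRow N (quadOf (σ 0) (σ 1))) h i c * monomialValues N (σ k) c := by
    rw [Matrix.mul_apply, ← (colEquiv N).sum_comp]
    refine Finset.sum_congr rfl fun c _ => ?_
    rcases c with c | c <;> rfl
  have hmul' (i) (k : Fin (N + 1)) : (S * W) i (Sum.inl k) = S i (Sum.inl k) := by
    rw [Matrix.mul_apply, Fintype.sum_sum_type]
    simp [W, Matrix.one_apply]
  have hSW : S * W = Matrix.fromBlocks (Matrix.of fun j k => S (Sum.inl j) (Sum.inl k)) 0
      (Matrix.of fun j k => S (Sum.inr j) (Sum.inl k))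
      (Matrix.of fun j k => ∑ c, h j c * monomialValues N (σ k) c) := by
    ext i k
    rcases k with k | k
    · rw [hmul']
      rcases i with i | i <;> rfl
    · rw [hmul]
      rcases i with i | i
      · fin_cases k
        · exact sum_quadRow_quadOf_left _ _ _
        · exact sum_quadRow_quadOf_right _ _ _
      · rfl
  have hdetW : W.det = (σ 0 1 * σ 1 1) ^ (N + 1) * (σ 0 0 * σ 1 1 - σ 1 0 * σ 0 1) := by
    rw [Matrix.det_fromBlocks_zero₂₁, Matrix.det_one, one_mul, Matrix.det_fin_two]
    simp only [W₂, monomialValues, val_colEquiv_inr, Fin.val_zero, Fin.val_one, add_zero]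
    rw [show N + 2 - (N + 1) = 1 by omega, show N + 2 - (N + 1 + 1) = 0 by omega]
    ring
  have hdetQ : (Matrix.of fun j k : Fin (N + 1) => S (Sum.inl j) (Sum.inl k)).det
      = (σ 0 1 * σ 1 1) ^ (N + 1) := by
    rw [Matrix.det_of_isUpperTriangular]
    · rw [Finset.prod_congr rfl (g := fun _ => σ 0 1 * σ 1 1), Finset.prod_const,
        Finset.card_univ, Fintype.card_fin]
      intro j _
      simp [S, quadStack, quadRow, quadOf, val_colEquiv_inl]
    · intro j k hjk
      simp only [id] at hjk
      simp only [Matrix.of_apply, S, quadStack, Sum.elim_inl, quadRow]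
      rw [dif_neg]
      rw [val_colEquiv_inl]
      have : (k : ℕ) < j := hjk
      omega
  have := congrArg Matrix.det hSW
  rw [Matrix.det_mul, hdetW, Matrix.det_fromBlocks_zero₁₂, Matrix.det_fin_two] at this
  refine this.trans ?_
  exact congrArg (· * _) hdetQ

theorem map_quadStack {D' : Type*} [CommRing D'] (φ : D →+* D') (x : Fin 3 → D)
    (h : Fin 2 → Fin (N + 3) → D) :
    (quadStack x h).map φ = quadStack (fun i => φ (x i)) (fun i c => φ (h i c)) := by
  ext i c
  rcases i with i | i
  · simp only [Matrix.map_apply, quadStack, Sum.elim_inl, quadRow]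
    split_ifs
    · rfl
    · exact map_zero φ
  · rfl

/-- The determinant of the multiples of a quadratic form and two further forms, in terms of the
values at the roots of the quadratic form. -/
theorem det_quadStack [IsDomain D] (σ τ : Fin 2 → D) (h : Fin 2 → Fin (N + 3) → D) :
    (quadStack (quadOf σ τ) h).det * (σ 0 * τ 1 - τ 0 * σ 1)
    = (∑ c, h 0 c * monomialValues N σ c) * (∑ c, h 1 c * monomialValues N τ c)
        - (∑ c, h 0 c * monomialValues N τ c) * (∑ c, h 1 c * monomialValues N σ c) := by
  let P := MvPolynomial (Fin 2 × Fin 2) D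
  let Y : Fin 2 → Fin 2 → P := fun i j => MvPolynomial.X (i, j)
  have key := det_quadStack_aux Y (fun i c => (MvPolynomial.C (h i c) : P))
  have hX (i j) : Y i j ≠ 0 := MvPolynomial.X_ne_zero _
  rw [mul_left_comm] at key
  replace key := mul_left_cancel₀ (pow_ne_zero _ (mul_ne_zero (hX 0 1) (hX 1 1))) key
  let φ : P →+* D := MvPolynomial.eval fun ij => (![σ, τ] : Fin 2 → Fin 2 → D) ij.1 ij.2
  have hφ0 (j) : φ (Y 0 j) = σ j := MvPolynomial.eval_X _
  have hφ1 (j) : φ (Y 1 j) = τ j := MvPolynomial.eval_X _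
  have hφC (c : D) : φ (MvPolynomial.C c) = c := MvPolynomial.eval_C _
  have hq : (fun i => φ (quadOf (Y 0) (Y 1) i)) = quadOf σ τ := by
    funext i
    fin_cases i <;> simp [quadOf, hφ0, hφ1]
  replace key := congrArg φ key
  rw [map_mul, RingHom.map_det, RingHom.mapMatrix_apply, map_quadStack, hq] at key
  simpa only [monomialValues, map_sub, map_mul, map_sum, map_pow, hφ0, hφ1, hφC] using key

/-- A binary form vanishing at a unimodular vector is divisible by the corresponding linear
form. -/
theorem linear_dvd_of_eval_eq_zero {H : MvPolynomial (Fin 2) D} {n : ℕ} (hH : H.IsHomogeneous n)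
    {σ : Fin 2 → D} {a b : D} (hab : a * σ 0 + b * σ 1 = 1) (h0 : MvPolynomial.eval σ H = 0) :
    MvPolynomial.C (σ 1) * MvPolynomial.X 0 - MvPolynomial.C (σ 0) * MvPolynomial.X 1 ∣ H := by
  obtain ⟨V, hV⟩ : ∃ V : MvPolynomial (Fin 2) D, V = MvPolynomial.C (σ 1) * MvPolynomial.X 0
    - MvPolynomial.C (σ 0) * MvPolynomial.X 1 := ⟨_, rfl⟩
  rw [← hV, ← Ideal.mem_span_singleton, ← Ideal.Quotient.eq_zero_iff_mem]
  let mk := Ideal.Quotient.mk (Ideal.span {V})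
  let U : MvPolynomial (Fin 2) D :=
    MvPolynomial.C a * MvPolynomial.X 0 + MvPolynomial.C b * MvPolynomial.X 1
  have hC : MvPolynomial.C a * MvPolynomial.C (σ 0) + MvPolynomial.C b * MvPolynomial.C (σ 1)
      = (1 : MvPolynomial (Fin 2) D) := by
    rw [← map_mul, ← map_mul, ← map_add, hab, map_one]
  have hX (j : Fin 2) : mk (MvPolynomial.X j) = mk (MvPolynomial.C (σ j)) * mk U := by
    rw [← map_mul, Ideal.Quotient.eq, Ideal.mem_span_singleton, hV]
    fin_cases j
    · exact ⟨MvPolynomial.C b, by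
        simp only [Fin.zero_eta, U]; linear_combination (-MvPolynomial.X 0) * hC⟩
    · exact ⟨-MvPolynomial.C a, by
        simp only [Fin.mk_one, U]; linear_combination (-MvPolynomial.X 1) * hC⟩
  have h1 := MvPolynomial.hom_eval₂ H MvPolynomial.C mk MvPolynomial.X
  rw [MvPolynomial.eval₂_eta] at h1
  refine h1.trans ?_
  simp only [hX]
  rw [eval₂_mul_of_isHomogeneous _ hH]
  have h2 := MvPolynomial.hom_eval₂ H (RingHom.id D) (mk.comp MvPolynomial.C) σ
  rw [MvPolynomial.eval₂_id, h0, map_zero] at h2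
  rw [RingHom.comp_id] at h2
  exact (congrArg _ h2.symm).trans (mul_zero _)

theorem quadOf_dvd_of_eval_eq_zero [IsDomain D] {H : MvPolynomial (Fin 2) D} {n : ℕ}
    (hH : H.IsHomogeneous n) {σ τ : Fin 2 → D} {a b a' b' : D} (hab : a * σ 0 + b * σ 1 = 1)
    (hab' : a' * τ 0 + b' * τ 1 = 1) (hne : σ 0 * τ 1 - τ 0 * σ 1 ≠ 0)
    (hσ : MvPolynomial.eval σ H = 0) (hτ : MvPolynomial.eval τ H = 0) :
    MvPolynomial.C (quadOf σ τ 0) * MvPolynomial.X 0 ^ 2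
      + MvPolynomial.C (quadOf σ τ 1) * (MvPolynomial.X 0 * MvPolynomial.X 1)
      + MvPolynomial.C (quadOf σ τ 2) * MvPolynomial.X 1 ^ 2 ∣ H := by
  by_cases hH0 : H = 0
  · rw [hH0]; exact dvd_zero _
  obtain ⟨H₁, hH₁⟩ := linear_dvd_of_eval_eq_zero hH hab hσ
  obtain ⟨d, hd⟩ := hH.exists_of_dvd hH0 (Dvd.intro_left _ hH₁.symm)
  have h1 : MvPolynomial.eval τ H₁ = 0 := by
    rw [hH₁] at hτ
    simp only [map_mul, map_sub, MvPolynomial.eval_C, MvPolynomial.eval_X] at hτ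
    refine (mul_eq_zero.1 hτ).resolve_left fun h => hne ?_
    linear_combination -h
  obtain ⟨H₂, hH₂⟩ := linear_dvd_of_eval_eq_zero hd hab' h1
  refine ⟨H₂, ?_⟩
  rw [hH₁, hH₂]
  simp only [quadOf, Matrix.cons_val_zero, Matrix.cons_val_one, Matrix.cons_val, map_mul, map_neg,
    map_add]
  ring

end

end

section

section

variable {K : Type*} [Field K] {N : ℕ}

theorem eq_sum_monomial_bcoeff {n : ℕ} {g : MvPolynomial (Fin 2) K} (hg : g.IsHomogeneous n) :
    g = ∑ c : Fin (n + 1), MvPolynomial.monomial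
      (Finsupp.single 0 (n - (c : ℕ)) + Finsupp.single 1 (c : ℕ)) (bcoeff n g c) := by
  ext m
  rw [MvPolynomial.coeff_sum]
  simp only [MvPolynomial.coeff_monomial]
  have hexp (c : Fin (n + 1)) : (Finsupp.single (0 : Fin 2) (n - (c : ℕ)) +
      Finsupp.single 1 (c : ℕ) = m) ↔ (n - (c : ℕ) = m 0 ∧ (c : ℕ) = m 1) := by
    rw [Finsupp.ext_iff, Fin.forall_fin_two]
    simp
  by_cases hm : MvPolynomial.coeff m g = 0
  · rw [hm]
    refine (Finset.sum_eq_zero fun c _ => ?_).symm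
    split_ifs with h
    · rw [bcoeff, h, hm]
    · rfl
  · have hdeg := hg hm
    rw [Finsupp.weight_apply, Finsupp.sum_fintype _ _ (by simp), Fin.sum_univ_two] at hdeg
    simp only [Pi.one_apply, smul_eq_mul, mul_one] at hdeg
    rw [Finset.sum_eq_single (⟨m 1, by omega⟩ : Fin (n + 1))]
    · have h := (hexp ⟨m 1, by omega⟩).2 ⟨by simp only; omega, rfl⟩
      rw [if_pos h, bcoeff, h]
    · intro c _ hc
      rw [if_neg]
      intro h
      exact hc (Fin.ext ((hexp c).1 h).2)
    · simp

theorem aeval_eq_sum_monomialValues {D : Type*} [CommRing D] [Algebra K D]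
    {g : MvPolynomial (Fin 2) K} (hg : g.IsHomogeneous (N + 2)) (σ : Fin 2 → D) :
    MvPolynomial.aeval σ g
      = ∑ c, algebraMap K D (bcoeff (N + 2) g c) * monomialValues N σ c := by
  conv_lhs => rw [eq_sum_monomial_bcoeff hg]
  rw [map_sum]
  refine Finset.sum_congr rfl fun c _ => ?_
  rw [MvPolynomial.aeval_monomial, Finsupp.prod_fintype _ _ (by simp), Fin.prod_univ_two]
  simp [monomialValues]

theorem coeff_quad_mul {D : Type*} [CommRing D] (x : Fin 3 → D) (H : MvPolynomial (Fin 2) D)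
    (c : Fin (N + 3)) :
    MvPolynomial.coeff (Finsupp.single 0 (N + 2 - (c : ℕ)) + Finsupp.single 1 (c : ℕ))
      ((MvPolynomial.C (x 0) * MvPolynomial.X 0 ^ 2
        + MvPolynomial.C (x 1) * (MvPolynomial.X 0 * MvPolynomial.X 1)
        + MvPolynomial.C (x 2) * MvPolynomial.X 1 ^ 2) * H)
    = ∑ j : Fin (N + 1), MvPolynomial.coeff
        (Finsupp.single 0 (N - (j : ℕ)) + Finsupp.single 1 (j : ℕ)) H * quadRow N x j c := by
  have hc := c.isLt
  have hq : MvPolynomial.C (x 0) * MvPolynomial.X 0 ^ 2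
        + MvPolynomial.C (x 1) * (MvPolynomial.X 0 * MvPolynomial.X 1)
        + MvPolynomial.C (x 2) * MvPolynomial.X 1 ^ 2
      = ∑ i : Fin 3, MvPolynomial.monomial (Finsupp.single (0 : Fin 2) (2 - (i : ℕ))
          + Finsupp.single 1 (i : ℕ)) (x i) := by
    rw [Fin.sum_univ_three]
    simp only [MvPolynomial.monomial_add_single,
      Fin.val_zero, Fin.val_one, Fin.val_two]
    simp only [MvPolynomial.monomial_eq, Finsupp.prod_single_index, pow_zero]
    simp
    ring
  rw [hq, Finset.sum_mul, MvPolynomial.coeff_sum]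
  simp only [quadRow_eq_sum, Finset.mul_sum]
  rw [Finset.sum_comm]
  refine Finset.sum_congr rfl fun i _ => ?_
  have hi := i.isLt
  rw [MvPolynomial.coeff_monomial_mul']
  split_ifs with h
  · have h0 := h 0
    have h1 := h 1
    simp at h0 h1
    rw [Finset.sum_eq_single (⟨(c : ℕ) - (i : ℕ), by omega⟩ : Fin (N + 1))]
    · rw [if_pos (by simp only; omega), mul_comm]
      congr 2
      ext k
      fin_cases k
      · simp; omega
      · simp
    · intro j _ hj
      rw [if_neg, mul_zero]
      intro h'
      apply hj
      ext
      simp only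
      omega
    · simp
  · refine (Finset.sum_eq_zero fun j _ => ?_).symm
    have hj := j.isLt
    rw [if_neg, mul_zero]
    intro h'
    apply h
    intro k
    fin_cases k
    · simp; omega
    · simp; omega

/-- A form vanishing at the roots of a quadratic form is, in coefficients, a combination of the
multiples of the quadratic form. -/
theorem exists_quadRow_combination {D : Type*} [CommRing D] [IsDomain D]
    {H : MvPolynomial (Fin 2) D} (hH : H.IsHomogeneous (N + 2)) {σ τ : Fin 2 → D} {a b a' b' : D}
    (hab : a * σ 0 + b * σ 1 = 1) (hab' : a' * τ 0 + b' * τ 1 = 1)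
    (hne : σ 0 * τ 1 - τ 0 * σ 1 ≠ 0)
    (hσ : MvPolynomial.eval σ H = 0) (hτ : MvPolynomial.eval τ H = 0) :
    ∃ l : Fin (N + 1) → D, ∀ c : Fin (N + 3),
      MvPolynomial.coeff (Finsupp.single 0 (N + 2 - (c : ℕ)) + Finsupp.single 1 (c : ℕ)) H
        = ∑ j, l j * quadRow N (quadOf σ τ) j c := by
  obtain ⟨H', hH'⟩ := quadOf_dvd_of_eval_eq_zero hH hab hab' hne hσ hτ
  refine ⟨fun j => MvPolynomial.coeff
    (Finsupp.single 0 (N - (j : ℕ)) + Finsupp.single 1 (j : ℕ)) H', fun c => ?_⟩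
  rw [hH', coeff_quad_mul]

/-- The rows of `M_2`, indexed by the multiples of the quadratic form and the three
parameterizing forms. -/
def fullRows (N : ℕ) (f : Fin 3 → MvPolynomial (Fin 2) K) :
    Fin (N + 1) ⊕ Fin 3 → Fin (N + 3) → MvPolynomial (Fin 3) K :=
  Sum.elim (quadRow N MvPolynomial.X) fun u c => MvPolynomial.C (bcoeff (N + 2) (f u) c)

/-- The rows of `M_2`, split into the first `N + 1` and the last three. -/
def rowEquiv (N : ℕ) : Fin (N + 1) ⊕ Fin 3 ≃ Fin (N + 4) :=
  finSumFinEquiv (m := N + 1) (n := 3)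

theorem val_rowEquiv_inl (c : Fin (N + 1)) : (rowEquiv N (Sum.inl c) : ℕ) = c := rfl

theorem val_rowEquiv_inr (c : Fin 3) : (rowEquiv N (Sum.inr c) : ℕ) = N + 1 + c := rfl

theorem Mmat_rowEquiv (f : Fin 3 → MvPolynomial (Fin 2) K) (i : Fin (N + 1) ⊕ Fin 3)
    (c : Fin (N + 3)) : Mmat (N + 2) 2 f (rowEquiv N i) c = fullRows N f i c := by
  rcases i with i | i
  · have hi := i.isLt
    rw [Mmat, dif_pos (by rw [val_rowEquiv_inl]; omega)]
    simp only [val_rowEquiv_inl]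
    rfl
  · rw [Mmat, dif_neg (by rw [val_rowEquiv_inr]; omega)]
    simp only [fullRows, Sum.elim_inr]
    congr 3
    ext
    simp only [val_rowEquiv_inr]
    omega

theorem exists_of_mem_minorsSet {f : Fin 3 → MvPolynomial (Fin 2) K} {g : MvPolynomial (Fin 3) K}
    (hg : g ∈ minorsSet (N + 2) 2 f) :
    ∃ (r : Fin (N + 1) ⊕ Fin 2 → Fin (N + 1) ⊕ Fin 3)
      (c : Equiv.Perm (Fin (N + 1) ⊕ Fin 2)),
      g = (Matrix.of fun i k => fullRows N f (r i) (colEquiv N (c k))).det := by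
  obtain ⟨r, c, -, hc, rfl⟩ := hg
  change Fin (N + 3) → Fin (N + 4) at r
  change Fin (N + 3) → Fin (N + 3) at c
  have hc' : Function.Bijective c := Finite.injective_iff_bijective.1 hc
  refine ⟨fun i => (rowEquiv N).symm (r (colEquiv N i)),
    ((colEquiv N).trans (Equiv.ofBijective c hc')).trans (colEquiv N).symm, ?_⟩
  rw [← Matrix.det_submatrix_equiv_self (colEquiv N)]
  congr 1
  ext i k : 2
  rw [Matrix.of_apply, ← Mmat_rowEquiv, Equiv.apply_symm_apply]
  simp only [Equiv.trans_apply, Equiv.apply_symm_apply, Equiv.ofBijective_apply]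
  rfl

theorem det_quadStack_mem_minorsSet (f : Fin 3 → MvPolynomial (Fin 2) K) {u w : Fin 3}
    (huw : u ≠ w) :
    (quadStack (N := N) MvPolynomial.X fun i c =>
      MvPolynomial.C (bcoeff (N + 2) (f ((![u, w] : Fin 2 → Fin 3) i)) c)).det
      ∈ minorsSet (N + 2) 2 f := by
  have huw' : Function.Injective (![u, w] : Fin 2 → Fin 3) := by
    intro i j hij
    fin_cases i <;> fin_cases j <;> simp_all [huw.symm]
  refine ⟨fun i => rowEquiv N (Sum.map id ![u, w] ((colEquiv N).symm i)), id, ?_,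
    Function.injective_id, ?_⟩
  · exact (rowEquiv N).injective.comp
      ((Sum.map_injective.2 ⟨Function.injective_id, huw'⟩).comp (colEquiv N).symm.injective)
  · rw [← Matrix.det_submatrix_equiv_self (colEquiv N).symm]
    congr 1
    refine Matrix.ext fun i k => ?_
    rw [Matrix.submatrix_apply, Matrix.submatrix_apply]
    refine Eq.trans ?_ (Mmat_rowEquiv f _ _).symm
    rw [quadStack, Equiv.apply_symm_apply]
    rcases (colEquiv N).symm i with j | j
    · rfl
    · rfl

theorem bcoeff_linComb {n : ℕ} (ℓ : Fin 3 → K) (f : Fin 3 → MvPolynomial (Fin 2) K)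
    (c : Fin (n + 1)) : bcoeff n (linComb ℓ f) c = ∑ u, ℓ u * bcoeff n (f u) c := by
  simp only [bcoeff, linComb, MvPolynomial.coeff_sum, MvPolynomial.coeff_C_mul]

/-- The rows of coefficients of two forms, as rows over a `K`-algebra. -/
def coeffRows (N : ℕ) (D : Type*) [CommRing D] [Algebra K D] (g h : MvPolynomial (Fin 2) K) :
    Fin 2 → Fin (N + 3) → D :=
  fun i c => algebraMap K D (bcoeff (N + 2) ((![g, h] : Fin 2 → MvPolynomial (Fin 2) K) i) c)

theorem det_quadStack_linComb_left {D : Type*} [CommRing D] [Algebra K D] (x : Fin 3 → D)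
    (ℓ : Fin 3 → K) (f : Fin 3 → MvPolynomial (Fin 2) K) (h : MvPolynomial (Fin 2) K) :
    (quadStack x (coeffRows N D (linComb ℓ f) h)).det
      = ∑ u, algebraMap K D (ℓ u) * (quadStack x (coeffRows N D (f u) h)).det := by
  let L := (Matrix.detRowAlternating (R := D)
      (n := Fin (N + 1) ⊕ Fin 2)).toMultilinearMap.toLinearMap
    (quadStack x (coeffRows N D 0 h)) (Sum.inr 0)
  have hL (g : MvPolynomial (Fin 2) K) : (quadStack x (coeffRows N D g h)).det
      = L (fun k => algebraMap K D (bcoeff (N + 2) g (colEquiv N k))) := by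
    change Matrix.det _ = Matrix.det _
    congr 1
    refine Matrix.ext fun i k => ?_
    rcases i with i | i
    · exact (congrFun (Function.update_of_ne
        (show (Sum.inl i : Fin (N + 1) ⊕ Fin 2) ≠ Sum.inr 0 by simp) _ _) k).symm
    · fin_cases i
      · exact (congrFun (Function.update_self _ _ _) k).symm
      · exact (congrFun (Function.update_of_ne
          (show (Sum.inr 1 : Fin (N + 1) ⊕ Fin 2) ≠ Sum.inr 0 by simp) _ _) k).symm
  simp only [hL]
  simp only [← smul_eq_mul, ← map_smul, ← map_sum]
  congr 1
  funext k
  simp [bcoeff_linComb, Algebra.smul_def]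

theorem det_quadStack_linComb_right {D : Type*} [CommRing D] [Algebra K D] (x : Fin 3 → D)
    (ℓ : Fin 3 → K) (f : Fin 3 → MvPolynomial (Fin 2) K) (h : MvPolynomial (Fin 2) K) :
    (quadStack x (coeffRows N D h (linComb ℓ f))).det
      = ∑ u, algebraMap K D (ℓ u) * (quadStack x (coeffRows N D h (f u))).det := by
  let L := (Matrix.detRowAlternating (R := D)
      (n := Fin (N + 1) ⊕ Fin 2)).toMultilinearMap.toLinearMap
    (quadStack x (coeffRows N D h 0)) (Sum.inr 1)
  have hL (g : MvPolynomial (Fin 2) K) : (quadStack x (coeffRows N D h g)).det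
      = L (fun k => algebraMap K D (bcoeff (N + 2) g (colEquiv N k))) := by
    change Matrix.det _ = Matrix.det _
    congr 1
    refine Matrix.ext fun i k => ?_
    rcases i with i | i
    · exact (congrFun (Function.update_of_ne
        (show (Sum.inl i : Fin (N + 1) ⊕ Fin 2) ≠ Sum.inr 1 by simp) _ _) k).symm
    · fin_cases i
      · exact (congrFun (Function.update_of_ne
          (show (Sum.inr 0 : Fin (N + 1) ⊕ Fin 2) ≠ Sum.inr 1 by simp) _ _) k).symm
      · exact (congrFun (Function.update_self _ _ _) k).symm
  simp only [hL]
  simp only [← smul_eq_mul, ← map_smul, ← map_sum]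
  congr 1
  funext k
  simp [bcoeff_linComb, Algebra.smul_def]

theorem det_quadStack_mem_span (f : Fin 3 → MvPolynomial (Fin 2) K) (ℓ ℓ' : Fin 3 → K) :
    (quadStack MvPolynomial.X (coeffRows N (MvPolynomial (Fin 3) K) (linComb ℓ f)
      (linComb ℓ' f))).det ∈ Ideal.span (minorsSet (N + 2) 2 f) := by
  rw [det_quadStack_linComb_left]
  refine Ideal.sum_mem _ fun u _ => Ideal.mul_mem_left _ _ ?_
  rw [det_quadStack_linComb_right]
  refine Ideal.sum_mem _ fun w _ => Ideal.mul_mem_left _ _ ?_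
  by_cases huw : u = w
  · rw [Matrix.det_zero_of_row_eq (i := Sum.inr 0) (j := Sum.inr 1) (by simp)]
    · exact Ideal.zero_mem _
    · subst huw
      rfl
  · have hrows : coeffRows N (MvPolynomial (Fin 3) K) (f u) (f w) = fun i c =>
        MvPolynomial.C (bcoeff (N + 2) (f ((![u, w] : Fin 2 → Fin 3) i)) c) := by
      funext i c
      fin_cases i <;> rfl
    rw [hrows]
    exact Ideal.subset_span (det_quadStack_mem_minorsSet f huw)

theorem aeval_det_quadStack {D : Type*} [CommRing D] [Algebra K D] (x : Fin 3 → D)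
    (g h : MvPolynomial (Fin 2) K) :
    MvPolynomial.aeval x (quadStack MvPolynomial.X
      (coeffRows N (MvPolynomial (Fin 3) K) g h)).det = (quadStack x (coeffRows N D g h)).det := by
  rw [← AlgHom.coe_toRingHom, RingHom.map_det, RingHom.mapMatrix_apply, map_quadStack]
  congr 2
  · funext i
    exact MvPolynomial.aeval_X x i
  · funext i c
    exact MvPolynomial.aeval_C x _

/-- The minors of `M_2` at a point of an arc all are multiples of a single one. -/
theorem det_quadStack_dvd_aeval_of_mem_minorsSet {D : Type*} [CommRing D] [Algebra K D]
    {x : Fin 3 → D} {f : Fin 3 → MvPolynomial (Fin 2) K} {g h : MvPolynomial (Fin 2) K}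
    (hf : ∀ u, ∃ (l : Fin (N + 1) → D) (l₀ l₁ : D), ∀ c : Fin (N + 3),
      algebraMap K D (bcoeff (N + 2) (f u) c) = ∑ j, l j * quadRow N x j c
        + l₀ * algebraMap K D (bcoeff (N + 2) g c) + l₁ * algebraMap K D (bcoeff (N + 2) h c))
    {m : MvPolynomial (Fin 3) K} (hm : m ∈ minorsSet (N + 2) 2 f) :
    (quadStack x (coeffRows N D g h)).det ∣ MvPolynomial.aeval x m := by
  obtain ⟨r, c, rfl⟩ := exists_of_mem_minorsSet hm
  choose l l₀ l₁ hl using hf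
  let L : Matrix (Fin (N + 1) ⊕ Fin 3) (Fin (N + 1) ⊕ Fin 2) D := fun i =>
    Sum.elim (fun j => Sum.elim (fun j' => if j = j' then 1 else 0) 0)
      (fun u => Sum.elim (l u) ![l₀ u, l₁ u]) i
  have hrow (i : Fin (N + 1) ⊕ Fin 3) (k : Fin (N + 1) ⊕ Fin 2) :
      MvPolynomial.aeval x (fullRows N f i (colEquiv N k))
        = (L * quadStack x (coeffRows N D g h)) i k := by
    rw [Matrix.mul_apply, Fintype.sum_sum_type, Fin.sum_univ_two]
    rcases i with i | u
    · simp only [fullRows, Sum.elim_inl, L, quadStack, Sum.elim_inr, Pi.zero_apply, zero_mul,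
        add_zero, ite_mul, one_mul, Finset.sum_ite_eq, Finset.mem_univ, if_true, quadRow]
      split_ifs
      · exact MvPolynomial.aeval_X _ _
      · exact map_zero _
    · simp only [fullRows, Sum.elim_inr, L, quadStack, Sum.elim_inl]
      rw [MvPolynomial.aeval_C, hl]
      simp only [coeffRows, Matrix.cons_val_zero, Matrix.cons_val_one, add_assoc]
  have hdet : MvPolynomial.aeval x
      (Matrix.of fun i k => fullRows N f (r i) (colEquiv N (c k))).det
      = ((Matrix.of fun i k => L (r i) k) *
        (quadStack x (coeffRows N D g h)).submatrix id c).det := by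
    rw [← AlgHom.coe_toRingHom, RingHom.map_det]
    congr 1
    ext i k : 2
    exact hrow (r i) (c k)
  rw [hdet, Matrix.det_mul, Matrix.det_permute', mul_left_comm, ← mul_assoc]
  exact Dvd.intro_left _ rfl

end

end

section

section

variable {K : Type*} [Field K] {N : ℕ}

/-- The point of an affine line over an algebra with parameter `s`. -/
def linePoint {D : Type*} [CommRing D] [Algebra K D] (v v' : Fin 2 → K) (s : D) : Fin 2 → D :=
  fun i => algebraMap K D (v i) * s + algebraMap K D (v' i)

theorem quadOf_smul_left {D : Type*} [CommRing D] (u : D) (σ τ : Fin 2 → D) (i : Fin 3) :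
    quadOf (fun i => u * σ i) τ i = u * quadOf σ τ i := by
  fin_cases i <;> simp [quadOf] <;> ring

theorem map_quadOf {D D' : Type*} [CommRing D] [CommRing D'] (φ : D →+* D') (σ τ : Fin 2 → D)
    (i : Fin 3) : φ (quadOf σ τ i) = quadOf (fun i => φ (σ i)) (fun i => φ (τ i)) i := by
  fin_cases i <;> simp [quadOf]

theorem constantCoeff_algebraMap (c : K) :
    PowerSeries.constantCoeff (algebraMap K (PowerSeries K) c) = c := by
  simp

theorem constantCoeff_linePoint (v v' : Fin 2 → K) (s : PowerSeries K) (i : Fin 2) :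
    PowerSeries.constantCoeff (linePoint v v' s i)
      = linePoint v v' (PowerSeries.constantCoeff s) i := by
  simp only [linePoint, map_add, map_mul, constantCoeff_algebraMap]
  rfl

theorem constantCoeff_quadOf_linePoint (v v' : Fin 2 → K) (s₁ s₂ : PowerSeries K) (i : Fin 3) :
    PowerSeries.constantCoeff (quadOf (linePoint v v' s₁) (linePoint v v' s₂) i)
      = quadOf (linePoint v v' (PowerSeries.constantCoeff s₁))
        (linePoint v v' (PowerSeries.constantCoeff s₂)) i := by
  rw [map_quadOf]
  simp only [constantCoeff_linePoint]

variable (v v' : Fin 2 → K) (s₁ s₂ : PowerSeries K) (cc : Fin 3)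

/-- The factor normalizing the coordinate `cc` of the quadratic form with given roots. -/
def arcScale : PowerSeries K := (quadOf (linePoint v v' s₁) (linePoint v v' s₂) cc)⁻¹

/-- The coefficients of the quadratic form with given roots, normalized at `cc`. -/
def arcVec : Fin 3 → PowerSeries K :=
  quadOf (fun i => arcScale v v' s₁ s₂ cc * linePoint v v' s₁ i) (linePoint v v' s₂)

/-- The arc in the affine chart `cc` of the quadratic forms with given roots. -/
def arcHom : MvPolynomial (Fin 2) K →ₐ[K] PowerSeries K :=
  MvPolynomial.aeval fun i => arcVec v v' s₁ s₂ cc (chartEmb cc i)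

variable {v v' s₁ s₂ cc}

theorem arcVec_apply (i : Fin 3) : arcVec v v' s₁ s₂ cc i
    = arcScale v v' s₁ s₂ cc * quadOf (linePoint v v' s₁) (linePoint v v' s₂) i :=
  quadOf_smul_left _ _ _ _

theorem constantCoeff_arcHom (y : MvPolynomial (Fin 2) K) :
    PowerSeries.constantCoeff (arcHom v v' s₁ s₂ cc y) = MvPolynomial.eval
      (affOf (quadOf (linePoint v v' (PowerSeries.constantCoeff s₁))
        (linePoint v v' (PowerSeries.constantCoeff s₂))) cc) y := by
  rw [arcHom, MvPolynomial.aeval_def, MvPolynomial.hom_eval₂, MvPolynomial.eval,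
    MvPolynomial.coe_eval₂Hom]
  have hid : PowerSeries.constantCoeff.comp (algebraMap K (PowerSeries K)) = RingHom.id K :=
    RingHom.ext constantCoeff_algebraMap
  rw [hid]
  congr 1
  funext i
  rw [arcVec_apply, map_mul, constantCoeff_quadOf_linePoint, arcScale,
    PowerSeries.constantCoeff_inv, constantCoeff_quadOf_linePoint, affOf, div_eq_inv_mul]

theorem aeval_linePoint {D : Type*} [CommRing D] [Algebra K D] (s : D)
    (g : MvPolynomial (Fin 2) K) :
    MvPolynomial.aeval (linePoint v v' s) g = Polynomial.aeval s (restrictLine v v' g) := by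
  rw [aeval_restrictLine]
  rfl

theorem aeval_smul_linePoint {D : Type*} [CommRing D] [Algebra K D] (s u : D) {n : ℕ}
    {g : MvPolynomial (Fin 2) K} (hg : g.IsHomogeneous n) :
    MvPolynomial.aeval (fun i => u * linePoint v v' s i) g
      = u ^ n * Polynomial.aeval s (restrictLine v v' g) := by
  rw [← aeval_linePoint, MvPolynomial.aeval_def, MvPolynomial.aeval_def,
    ← eval₂_mul_of_isHomogeneous _ hg]
  simp only [mul_comm]

theorem arcVec_self
    (hcc : quadOf (linePoint v v' (PowerSeries.constantCoeff s₁))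
      (linePoint v v' (PowerSeries.constantCoeff s₂)) cc ≠ 0)
    : arcVec v v' s₁ s₂ cc cc = 1 := by
  rw [arcVec_apply, arcScale, PowerSeries.inv_mul_cancel]
  rwa [constantCoeff_quadOf_linePoint]

theorem constantCoeff_arcScale_ne_zero
    (hcc : quadOf (linePoint v v' (PowerSeries.constantCoeff s₁))
      (linePoint v v' (PowerSeries.constantCoeff s₂)) cc ≠ 0)
    :
    PowerSeries.constantCoeff (arcScale v v' s₁ s₂ cc) ≠ 0 := by
  rw [arcScale, PowerSeries.constantCoeff_inv, constantCoeff_quadOf_linePoint]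
  exact inv_ne_zero hcc

theorem arcScale_ne_zero
    (hcc : quadOf (linePoint v v' (PowerSeries.constantCoeff s₁))
      (linePoint v v' (PowerSeries.constantCoeff s₂)) cc ≠ 0)
    : arcScale v v' s₁ s₂ cc ≠ 0 := fun h =>
  constantCoeff_arcScale_ne_zero hcc (by rw [h, map_zero])

theorem arcHom_aeval_dehomMap
    (hcc : quadOf (linePoint v v' (PowerSeries.constantCoeff s₁))
      (linePoint v v' (PowerSeries.constantCoeff s₂)) cc ≠ 0)
    (g : MvPolynomial (Fin 3) K) :
    arcHom v v' s₁ s₂ cc (MvPolynomial.aeval (dehomMap cc) g)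
      = MvPolynomial.aeval (arcVec v v' s₁ s₂ cc) g := by
  have h := eval₂_aeval_dehomMap (algebraMap K (PowerSeries K))
    (w := arcVec v v' s₁ s₂ cc) (c := cc) (wi := 1) (by rw [arcVec_self hcc, one_mul]) g
  simp only [mul_one] at h
  exact h

theorem det_quadStack_arcVec
    (hcc : quadOf (linePoint v v' (PowerSeries.constantCoeff s₁))
      (linePoint v v' (PowerSeries.constantCoeff s₂)) cc ≠ 0)
    {g h : MvPolynomial (Fin 2) K} (hg : g.IsHomogeneous (N + 2))
    (hh : h.IsHomogeneous (N + 2)) :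
    (quadStack (arcVec v v' s₁ s₂ cc) (coeffRows N (PowerSeries K) g h)).det
      * (algebraMap K _ (v 0 * v' 1 - v 1 * v' 0) * (s₁ - s₂))
    = arcScale v v' s₁ s₂ cc ^ (N + 1) *
      (Polynomial.aeval s₁ (restrictLine v v' g) * Polynomial.aeval s₂ (restrictLine v v' h)
        - Polynomial.aeval s₂ (restrictLine v v' g)
          * Polynomial.aeval s₁ (restrictLine v v' h)) := by
  have key := det_quadStack (N := N) (fun i => arcScale v v' s₁ s₂ cc * linePoint v v' s₁ i)
    (linePoint v v' s₂) (coeffRows N (PowerSeries K) g h)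
  have hsum (σ : Fin 2 → PowerSeries K) :
      ((∑ c, coeffRows N (PowerSeries K) g h 0 c * monomialValues N σ c)
        = MvPolynomial.aeval σ g) ∧
      ((∑ c, coeffRows N (PowerSeries K) g h 1 c * monomialValues N σ c)
        = MvPolynomial.aeval σ h) :=
    ⟨(aeval_eq_sum_monomialValues hg σ).symm, (aeval_eq_sum_monomialValues hh σ).symm⟩
  simp only [(hsum _).1, (hsum _).2, aeval_smul_linePoint _ _ hg, aeval_smul_linePoint _ _ hh,
    aeval_linePoint] at key
  refine mul_left_cancel₀ (arcScale_ne_zero hcc) ?_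
  change (quadStack (arcVec v v' s₁ s₂ cc) (coeffRows N (PowerSeries K) g h)).det * _ = _ at key
  simp only [linePoint] at key
  rw [map_sub, map_mul, map_mul]
  linear_combination key

end

end

section

namespace LocalFrame

variable {K : Type*} [Field K] {N d : ℕ} {f : Fin 3 → MvPolynomial (Fin 2) K}
  {F : MvPolynomial (Fin 3) K} {p : Fin 3 → K} {G : MvPolynomial (Fin 2) K}

/-- Two arcs on the source of the parameterization with common first coordinate `X ^ 2`, whose
second coordinates are `a ± X ^ (2 * k + e) η` for series `a`, `η` in `X ^ 2`. -/
structure ArcPair {n : ℕ} (fr : LocalFrame n d f F p G) (s₁ s₂ : PowerSeries K) (e k : ℕ) :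
    Prop where
  A₁ : Polynomial.aeval s₁ fr.A = PowerSeries.X ^ 2 * Polynomial.aeval s₁ fr.C
  A₂ : Polynomial.aeval s₂ fr.A = PowerSeries.X ^ 2 * Polynomial.aeval s₂ fr.C
  C₁ : PowerSeries.constantCoeff (Polynomial.aeval s₁ fr.C) ≠ 0
  C₂ : PowerSeries.constantCoeff (Polynomial.aeval s₂ fr.C) ≠ 0
  sum_even : ∃ a, s₁ + s₂ = PowerSeries.expand 2 two_ne_zero a
  prod_even : ∃ a, s₁ * s₂ = PowerSeries.expand 2 two_ne_zero a
  diff : ∃ ω, PowerSeries.constantCoeff ω ≠ 0 ∧ s₁ - s₂ = PowerSeries.X ^ e * ω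
  transverse : ∃ ω, PowerSeries.constantCoeff ω ≠ 0 ∧
    (s₁ - PowerSeries.C (PowerSeries.constantCoeff s₁)) *
      (s₂ - PowerSeries.C (PowerSeries.constantCoeff s₁)) = PowerSeries.X ^ 2 * ω
  B : ∃ a η, PowerSeries.constantCoeff a = 0 ∧ PowerSeries.constantCoeff η ≠ 0 ∧
    Polynomial.aeval s₁ fr.B = (PowerSeries.expand 2 two_ne_zero a
      + PowerSeries.X ^ (2 * k + e) * PowerSeries.expand 2 two_ne_zero η)
        * Polynomial.aeval s₁ fr.C ∧
    Polynomial.aeval s₂ fr.B = (PowerSeries.expand 2 two_ne_zero a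
      - PowerSeries.X ^ (2 * k + e) * PowerSeries.expand 2 two_ne_zero η)
        * Polynomial.aeval s₂ fr.C

/-- The minor of the coordinates `ℓ` and `ℓ'`, in the chart `cc`. -/
def chartMinor (N : ℕ) (f : Fin 3 → MvPolynomial (Fin 2) K) (cc : Fin 3) (ℓ ℓ' : Fin 3 → K) :
    MvPolynomial (Fin 2) K :=
  MvPolynomial.aeval (dehomMap cc) (quadStack MvPolynomial.X
    (coeffRows N (MvPolynomial (Fin 3) K) (linComb ℓ f) (linComb ℓ' f))).det

theorem chartMinor_mem (cc : Fin 3) (ℓ ℓ' : Fin 3 → K) :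
    chartMinor N f cc ℓ ℓ' ∈ dehomIdeal cc (Ideal.span (minorsSet (N + 2) 2 f)) :=
  Ideal.mem_map_of_mem _ (det_quadStack_mem_span f ℓ ℓ')

theorem arcHom_chartMinor {v v' : Fin 2 → K} {s₁ s₂ : PowerSeries K} {cc : Fin 3}
    (hcc : quadOf (linePoint v v' (PowerSeries.constantCoeff s₁))
      (linePoint v v' (PowerSeries.constantCoeff s₂)) cc ≠ 0) (ℓ ℓ' : Fin 3 → K) :
    arcHom v v' s₁ s₂ cc (chartMinor N f cc ℓ ℓ') = (quadStack (arcVec v v' s₁ s₂ cc)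
      (coeffRows N (PowerSeries K) (linComb ℓ f) (linComb ℓ' f))).det := by
  rw [chartMinor, arcHom_aeval_dehomMap hcc, aeval_det_quadStack]

theorem constantCoeff_aeval (P : Polynomial K) (s : PowerSeries K) :
    PowerSeries.constantCoeff (Polynomial.aeval s P)
      = P.eval (PowerSeries.constantCoeff s) := by
  rw [Polynomial.aeval_def, Polynomial.hom_eval₂, Polynomial.eval]
  congr 1

/-- The minor of the coordinates `C` and `A` is regular at a point of `X_2`. -/
theorem chartMinor_notMem_sq (fr : LocalFrame (N + 2) d f F p G)
    (hf : ∀ u, (f u).IsHomogeneous (N + 2)) {κ α β : K} (hκ : κ ≠ 0)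
    (hΓ : fr.Γ = Polynomial.C κ * ((Polynomial.X - Polynomial.C α)
      * (Polynomial.X - Polynomial.C β))) (hCβ : fr.C.eval β ≠ 0) {cc : Fin 3}
    (hcc : quadOf (linePoint fr.v fr.v' α) (linePoint fr.v fr.v' β) cc ≠ 0) :
    chartMinor N f cc fr.ℓ₀ fr.ℓ₁
      ∉ mAt (affOf (quadOf (linePoint fr.v fr.v' α) (linePoint fr.v fr.v' β)) cc) ^ 2 := by
  intro hmem
  obtain ⟨s₁, hs₁⟩ : ∃ s : PowerSeries K, s = PowerSeries.C α + PowerSeries.X := ⟨_, rfl⟩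
  obtain ⟨s₂, hs₂⟩ : ∃ s : PowerSeries K, s = PowerSeries.C β + PowerSeries.X ^ 2 := ⟨_, rfl⟩
  have h₁ : PowerSeries.constantCoeff s₁ = α := by simp [hs₁]
  have h₂ : PowerSeries.constantCoeff s₂ = β := by simp [hs₂]
  rw [← h₁, ← h₂] at hcc hmem
  have hX : PowerSeries.X ^ 2 ∣ arcHom fr.v fr.v' s₁ s₂ cc (chartMinor N f cc fr.ℓ₀ fr.ℓ₁) := by
    have := Ideal.mem_map_of_mem (arcHom fr.v fr.v' s₁ s₂ cc) hmem
    rw [Ideal.map_pow] at this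
    rw [← Ideal.mem_span_singleton, ← Ideal.span_singleton_pow]
    refine Ideal.pow_right_mono ?_ 2 this
    rw [Ideal.map_le_iff_le_comap]
    intro y hy
    rw [Ideal.mem_comap, Ideal.mem_span_singleton, PowerSeries.X_dvd_iff, constantCoeff_arcHom]
    exact hy
  rw [arcHom_chartMinor hcc] at hX
  have hdet := det_quadStack_arcVec hcc (isHomogeneous_linComb hf fr.ℓ₀)
    (isHomogeneous_linComb hf fr.ℓ₁)
  have hA (s : PowerSeries K) : Polynomial.aeval s fr.A = PowerSeries.C κ *
      ((s - PowerSeries.C α) * (s - PowerSeries.C β)) * Polynomial.aeval s fr.A' := by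
    rw [show fr.A = fr.Γ * fr.A' from fr.eq_A, map_mul, hΓ]
    simp only [map_mul, map_sub, Polynomial.aeval_C, Polynomial.aeval_X]
    rfl
  have hA' : fr.A'.eval α ≠ 0 := fr.eval_A'_ne_zero α (by
    change fr.Γ.eval α = 0
    rw [hΓ]; simp)
  have hu := constantCoeff_arcScale_ne_zero hcc
  have hc (e : ℕ) (ω : PowerSeries K) (hω : PowerSeries.constantCoeff ω ≠ 0)
      (hdiff : PowerSeries.X ^ e ∣ s₁ - s₂)
      (heq : Polynomial.aeval s₁ fr.C * Polynomial.aeval s₂ fr.A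
        - Polynomial.aeval s₂ fr.C * Polynomial.aeval s₁ fr.A
          = PowerSeries.X ^ (1 + e) * ω) : False := by
    rw [heq] at hdet
    have h1 : PowerSeries.X ^ (2 + e) ∣ arcScale fr.v fr.v' s₁ s₂ cc ^ (N + 1) *
        (PowerSeries.X ^ (1 + e) * ω) := by
      rw [← hdet, pow_add]
      exact mul_dvd_mul hX (Dvd.dvd.mul_left hdiff _)
    have h2 : PowerSeries.X ^ (1 + e) * PowerSeries.X ∣ PowerSeries.X ^ (1 + e) *
        (arcScale fr.v fr.v' s₁ s₂ cc ^ (N + 1) * ω) := by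
      convert h1 using 1 <;> ring
    have h3 := (mul_dvd_mul_iff_left (pow_ne_zero _ PowerSeries.X_ne_zero)).1 h2
    rw [PowerSeries.X_dvd_iff, map_mul, map_pow] at h3
    exact mul_ne_zero (pow_ne_zero _ hu) hω h3
  by_cases hαβ : α = β
  · refine hc 1 (PowerSeries.X ^ 2 * Polynomial.aeval s₁ fr.C * (PowerSeries.C κ *
      Polynomial.aeval s₂ fr.A') - Polynomial.aeval s₂ fr.C * (PowerSeries.C κ *
      Polynomial.aeval s₁ fr.A')) ?_ ?_ ?_
    · simp only [map_sub, map_mul, map_pow, constantCoeff_aeval, h₁, h₂,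
        PowerSeries.constantCoeff_C, PowerSeries.constantCoeff_X]
      simp [hCβ, hκ, hA']
    · rw [hs₁, hs₂, hαβ]
      exact ⟨1 - PowerSeries.X, by ring⟩
    · rw [hA, hA, ← hαβ]
      simp only [show s₁ - PowerSeries.C α = PowerSeries.X by rw [hs₁]; ring,
        show s₂ - PowerSeries.C α = PowerSeries.X ^ 2 by rw [hs₂, hαβ]; ring]
      ring
  · refine hc 0 (PowerSeries.X * Polynomial.aeval s₁ fr.C * (PowerSeries.C κ *
      (s₂ - PowerSeries.C α) * Polynomial.aeval s₂ fr.A') - Polynomial.aeval s₂ fr.C *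
      (PowerSeries.C κ * (s₁ - PowerSeries.C β) * Polynomial.aeval s₁ fr.A')) ?_ ?_ ?_
    · simp only [map_sub, map_mul, constantCoeff_aeval, h₁, h₂,
        PowerSeries.constantCoeff_C, PowerSeries.constantCoeff_X]
      simp [hCβ, hκ, hA', sub_eq_zero, hαβ]
    · simp
    · rw [hA, hA]
      have e₁ : s₁ - PowerSeries.C α = PowerSeries.X := by rw [hs₁]; ring
      have e₂ : s₂ - PowerSeries.C β = PowerSeries.X ^ 2 := by rw [hs₂]; ring
      rw [e₁, e₂]
      ring

end LocalFrame

end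

section

namespace LocalFrame

variable {K : Type*} [Field K] {N d : ℕ} {f : Fin 3 → MvPolynomial (Fin 2) K}
  {F : MvPolynomial (Fin 3) K} {p : Fin 3 → K} {G : MvPolynomial (Fin 2) K}

theorem exists_expand_quadOf_linePoint (v v' : Fin 2 → K) {s₁ s₂ P S : PowerSeries K}
    (hS : s₁ + s₂ = PowerSeries.expand 2 two_ne_zero S)
    (hP : s₁ * s₂ = PowerSeries.expand 2 two_ne_zero P) (i : Fin 3) :
    ∃ a, quadOf (linePoint v v' s₁) (linePoint v v' s₂) i
      = PowerSeries.expand 2 two_ne_zero a := by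
  fin_cases i
  · refine ⟨algebraMap K _ (v 1 ^ 2) * P + algebraMap K _ (v 1 * v' 1) * S
      + algebraMap K _ (v' 1 ^ 2), ?_⟩
    simp only [map_add, map_mul, AlgHom.commutes, ← hS, ← hP, map_pow]
    simp [quadOf, linePoint]
    ring
  · refine ⟨-(algebraMap K _ (2 * v 0 * v 1) * P + algebraMap K _ (v 0 * v' 1 + v 1 * v' 0) * S
      + algebraMap K _ (2 * v' 0 * v' 1)), ?_⟩
    simp only [map_add, map_mul, map_neg, AlgHom.commutes, ← hS, ← hP, map_ofNat]
    simp [quadOf, linePoint]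
    ring
  · refine ⟨algebraMap K _ (v 0 ^ 2) * P + algebraMap K _ (v 0 * v' 0) * S
      + algebraMap K _ (v' 0 ^ 2), ?_⟩
    simp only [map_add, map_mul, AlgHom.commutes, ← hS, ← hP, map_pow]
    simp [quadOf, linePoint]
    ring

theorem sq_dvd_arcHom {v v' : Fin 2 → K} {s₁ s₂ P S : PowerSeries K} {cc : Fin 3}
    (hcc : quadOf (linePoint v v' (PowerSeries.constantCoeff s₁))
      (linePoint v v' (PowerSeries.constantCoeff s₂)) cc ≠ 0)
    (hS : s₁ + s₂ = PowerSeries.expand 2 two_ne_zero S)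
    (hP : s₁ * s₂ = PowerSeries.expand 2 two_ne_zero P) {y : MvPolynomial (Fin 2) K}
    (hy : y ∈ mAt (affOf (quadOf (linePoint v v' (PowerSeries.constantCoeff s₁))
      (linePoint v v' (PowerSeries.constantCoeff s₂))) cc)) :
    PowerSeries.X ^ 2 ∣ arcHom v v' s₁ s₂ cc y := by
  choose a ha using exists_expand_quadOf_linePoint v v' hS hP
  have hacc : PowerSeries.constantCoeff (a cc) ≠ 0 := by
    rw [← constantCoeff_quadOf_linePoint, ha, PowerSeries.constantCoeff_expand] at hcc
    exact hcc
  have hscale : arcScale v v' s₁ s₂ cc = PowerSeries.expand 2 two_ne_zero (a cc)⁻¹ := by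
    refine (PowerSeries.inv_eq_iff_mul_eq_one ?_).2 ?_
    · rwa [constantCoeff_quadOf_linePoint]
    · rw [ha, ← map_mul, PowerSeries.inv_mul_cancel _ hacc, map_one]
  have hcomp : arcHom v v' s₁ s₂ cc = (PowerSeries.expand 2 two_ne_zero).comp
      (MvPolynomial.aeval fun i => (a cc)⁻¹ * a (chartEmb cc i)) := by
    refine MvPolynomial.algHom_ext fun i => ?_
    rw [AlgHom.comp_apply, MvPolynomial.aeval_X, map_mul, ← hscale, ← ha, ← arcVec_apply, arcHom,
      MvPolynomial.aeval_X]
  have h0 : PowerSeries.constantCoeff (arcHom v v' s₁ s₂ cc y) = 0 := by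
    rw [constantCoeff_arcHom]
    exact hy
  rw [hcomp, AlgHom.comp_apply] at h0 ⊢
  rw [PowerSeries.constantCoeff_expand, ← PowerSeries.X_dvd_iff] at h0
  have := map_dvd (PowerSeries.expand 2 two_ne_zero) h0
  rwa [PowerSeries.expand_X] at this

theorem ArcPair.exists_row (fr : LocalFrame (N + 2) d f F p G)
    (hf : ∀ u, (f u).IsHomogeneous (N + 2)) {s₁ s₂ : PowerSeries K} {e k : ℕ}
    (h : fr.ArcPair s₁ s₂ e k) {cc : Fin 3}
    (hcc : quadOf (linePoint fr.v fr.v' (PowerSeries.constantCoeff s₁))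
      (linePoint fr.v fr.v' (PowerSeries.constantCoeff s₂)) cc ≠ 0) :
    ∃ l : Fin (N + 1) → PowerSeries K, ∀ c : Fin (N + 3),
      algebraMap K (PowerSeries K) (bcoeff (N + 2) (linComb fr.ℓ₁ f) c)
        = ∑ j, l j * quadRow N (arcVec fr.v fr.v' s₁ s₂ cc) j c
          + PowerSeries.X ^ 2 * algebraMap K _ (bcoeff (N + 2) (linComb fr.ℓ₀ f) c) := by
  obtain ⟨H, hHdef⟩ : ∃ H : MvPolynomial (Fin 2) (PowerSeries K),
      H = MvPolynomial.map (algebraMap K _) (linComb fr.ℓ₁ f)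
        - MvPolynomial.C (PowerSeries.X ^ 2)
          * MvPolynomial.map (algebraMap K _) (linComb fr.ℓ₀ f) := ⟨_, rfl⟩
  have hH : H.IsHomogeneous (N + 2) := by
    rw [hHdef]
    exact ((isHomogeneous_linComb hf fr.ℓ₁).map _).sub
      (((isHomogeneous_linComb hf fr.ℓ₀).map _).C_mul _)
  have heval (σ : Fin 2 → PowerSeries K) : MvPolynomial.eval σ H
      = MvPolynomial.aeval σ (linComb fr.ℓ₁ f)
        - PowerSeries.X ^ 2 * MvPolynomial.aeval σ (linComb fr.ℓ₀ f) := by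
    rw [hHdef]
    simp only [map_sub, map_mul, MvPolynomial.eval_C, MvPolynomial.eval_map, MvPolynomial.aeval_def]
  have hdet : algebraMap K (PowerSeries K) (fr.v 0) * algebraMap K _ (fr.v' 1)
      - algebraMap K _ (fr.v 1) * algebraMap K _ (fr.v' 0)
      = algebraMap K _ (fr.v 0 * fr.v' 1 - fr.v 1 * fr.v' 0) := by
    simp only [map_sub, map_mul]
  obtain ⟨δ, hδ⟩ : ∃ δ : PowerSeries K,
      δ * algebraMap K _ (fr.v 0 * fr.v' 1 - fr.v 1 * fr.v' 0) = 1 :=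
    ⟨algebraMap K _ (fr.v 0 * fr.v' 1 - fr.v 1 * fr.v' 0)⁻¹, by
      rw [← map_mul, inv_mul_cancel₀ fr.det_ne_zero, map_one]⟩
  have hu : (arcScale fr.v fr.v' s₁ s₂ cc)⁻¹ * arcScale fr.v fr.v' s₁ s₂ cc = 1 :=
    PowerSeries.inv_mul_cancel _ (constantCoeff_arcScale_ne_zero hcc)
  obtain ⟨ui, hui⟩ : ∃ ui, ui * arcScale fr.v fr.v' s₁ s₂ cc = 1 := ⟨_, hu⟩
  obtain ⟨ω, hω, hdiff⟩ := h.diff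
  have hne : s₁ - s₂ ≠ 0 := by
    rw [hdiff]
    refine mul_ne_zero (pow_ne_zero _ PowerSeries.X_ne_zero) ?_
    rintro rfl
    exact hω (map_zero _)
  obtain ⟨l, hl⟩ := exists_quadRow_combination hH
    (σ := fun i => arcScale fr.v fr.v' s₁ s₂ cc * linePoint fr.v fr.v' s₁ i)
    (τ := linePoint fr.v fr.v' s₂)
    (a := -(ui * δ * algebraMap K _ (fr.v 1))) (b := ui * δ * algebraMap K _ (fr.v 0))
    (a' := -(δ * algebraMap K _ (fr.v 1))) (b' := δ * algebraMap K _ (fr.v 0))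
    (by
      simp only [linePoint]
      linear_combination ui * arcScale fr.v fr.v' s₁ s₂ cc * (δ * hdet + hδ) + hui)
    (by
      simp only [linePoint]
      linear_combination δ * hdet + hδ)
    (by
      have h1 : arcScale fr.v fr.v' s₁ s₂ cc * (algebraMap K _
          (fr.v 0 * fr.v' 1 - fr.v 1 * fr.v' 0) * (s₁ - s₂)) ≠ 0 :=
        mul_ne_zero (arcScale_ne_zero hcc) (mul_ne_zero (right_ne_zero_of_mul_eq_one hδ) hne)
      convert h1 using 1
      simp only [linePoint]
      rw [← hdet]
      ring)
    (by
      rw [heval, aeval_smul_linePoint _ _ (isHomogeneous_linComb hf fr.ℓ₁),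
        aeval_smul_linePoint _ _ (isHomogeneous_linComb hf fr.ℓ₀)]
      linear_combination arcScale fr.v fr.v' s₁ s₂ cc ^ (N + 2) * h.A₁)
    (by
      rw [heval, aeval_linePoint, aeval_linePoint]
      linear_combination h.A₂)
  refine ⟨l, fun c => ?_⟩
  have := hl c
  rw [hHdef, MvPolynomial.coeff_sub, MvPolynomial.coeff_C_mul, MvPolynomial.coeff_map,
    MvPolynomial.coeff_map, sub_eq_iff_eq_add] at this
  exact this

theorem bcoeff_eq {n : ℕ} (fr : LocalFrame n d f F p G) {m : ℕ} (u : Fin 3) (c : Fin (m + 1)) :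
    bcoeff m (f u) c = p u * bcoeff m (linComb fr.ℓ₀ f) c
      + fr.e₁ u * bcoeff m (linComb fr.ℓ₁ f) c + fr.e₂ u * bcoeff m (linComb fr.ℓ₂ f) c := by
  simp only [bcoeff_linComb, Finset.mul_sum, ← Finset.sum_add_distrib]
  have h (j : Fin 3) : p u * (fr.ℓ₀ j * bcoeff m (f j) c) + fr.e₁ u * (fr.ℓ₁ j * bcoeff m (f j) c)
      + fr.e₂ u * (fr.ℓ₂ j * bcoeff m (f j) c) = if u = j then bcoeff m (f j) c else 0 := by
    have := fr.expand u j
    split_ifs at this ⊢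
    · linear_combination this * bcoeff m (f j) c
    · linear_combination this * bcoeff m (f j) c
  simp only [h, Finset.sum_ite_eq, Finset.mem_univ, if_true]

/-- The length of `X_2` at the quadratic form whose roots are the origins of the two arcs. -/
theorem ArcPair.lengthAt_eq [CharZero K] {fr : LocalFrame (N + 2) d f F p G}
    (hf : ∀ u, (f u).IsHomogeneous (N + 2)) {s₁ s₂ : PowerSeries K} {e k : ℕ}
    (h : fr.ArcPair s₁ s₂ e k) {κ : K} (hκ : κ ≠ 0)
    (hΓ : fr.Γ = Polynomial.C κ * ((Polynomial.X - Polynomial.C (PowerSeries.constantCoeff s₁))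
      * (Polynomial.X - Polynomial.C (PowerSeries.constantCoeff s₂)))) {cc : Fin 3}
    (hcc : quadOf (linePoint fr.v fr.v' (PowerSeries.constantCoeff s₁))
      (linePoint fr.v fr.v' (PowerSeries.constantCoeff s₂)) cc ≠ 0) :
    lengthAt (dehomIdeal cc (Ideal.span (minorsSet (N + 2) 2 f)))
      (affOf (quadOf (linePoint fr.v fr.v' (PowerSeries.constantCoeff s₁))
        (linePoint fr.v fr.v' (PowerSeries.constantCoeff s₂))) cc) = k := by
  obtain ⟨S, hS⟩ := h.sum_even
  obtain ⟨P, hP⟩ := h.prod_even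
  obtain ⟨ω, hω, hdiff⟩ := h.diff
  obtain ⟨ωt, hωt, htrans⟩ := h.transverse
  obtain ⟨a, η, -, hη, hB₁, hB₂⟩ := h.B
  have hu := constantCoeff_arcScale_ne_zero hcc
  have hω0 : ω ≠ 0 := by
    rintro rfl
    exact hω (map_zero _)
  have hdet0 : algebraMap K (PowerSeries K) (fr.v 0 * fr.v' 1 - fr.v 1 * fr.v' 0) ≠ 0 := by
    rw [Ne, map_eq_zero_iff _ (algebraMap K (PowerSeries K)).injective]
    exact fr.det_ne_zero
  have hmem (y : MvPolynomial (Fin 2) K) (hy : PowerSeries.constantCoeff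
      (arcHom fr.v fr.v' s₁ s₂ cc y) = 0) :
      y ∈ mAt (affOf (quadOf (linePoint fr.v fr.v' (PowerSeries.constantCoeff s₁))
        (linePoint fr.v fr.v' (PowerSeries.constantCoeff s₂))) cc) := by
    rw [constantCoeff_arcHom] at hy
    exact hy
  -- the transverse coordinate
  obtain ⟨ρ, hρ⟩ : ∃ ρ : Fin 2 → K, ρ = linePoint fr.v fr.v' (PowerSeries.constantCoeff s₁) :=
    ⟨_, rfl⟩
  obtain ⟨z, hz⟩ : ∃ z : MvPolynomial (Fin 2) K, z = MvPolynomial.aeval (dehomMap cc)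
      (MvPolynomial.C (ρ 0 ^ 2)
    * MvPolynomial.X 0 + MvPolynomial.C (ρ 0 * ρ 1) * MvPolynomial.X 1
    + MvPolynomial.C (ρ 1 ^ 2) * MvPolynomial.X 2 : MvPolynomial (Fin 3) K) := ⟨_, rfl⟩
  have hθz : arcHom fr.v fr.v' s₁ s₂ cc z = PowerSeries.X ^ 2 *
      (arcScale fr.v fr.v' s₁ s₂ cc
        * algebraMap K _ (fr.v 0 * fr.v' 1 - fr.v 1 * fr.v' 0) ^ 2 * ωt) := by
    rw [hz, arcHom_aeval_dehomMap hcc]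
    simp only [map_add, map_mul, MvPolynomial.aeval_C, MvPolynomial.aeval_X, arcVec_apply, hρ,
      map_pow, map_sub]
    simp [quadOf, linePoint]
    linear_combination (arcScale fr.v fr.v' s₁ s₂ cc *
      (PowerSeries.C (fr.v 0) * PowerSeries.C (fr.v' 1)
        - PowerSeries.C (fr.v 1) * PowerSeries.C (fr.v' 0)) ^ 2) * htrans
  -- the two minors
  have hdiff' : s₁ - s₂ ≠ 0 := by
    rw [hdiff]
    exact mul_ne_zero (pow_ne_zero _ PowerSeries.X_ne_zero) hω0
  have hθb₁ : arcHom fr.v fr.v' s₁ s₂ cc (chartMinor N f cc fr.ℓ₀ fr.ℓ₁) = 0 := by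
    rw [arcHom_chartMinor hcc]
    have hdet := det_quadStack_arcVec hcc (isHomogeneous_linComb hf fr.ℓ₀)
      (isHomogeneous_linComb hf fr.ℓ₁)
    refine (mul_eq_zero.1 (hdet.trans ?_)).resolve_right (mul_ne_zero hdet0 hdiff')
    have h₁ := h.A₁
    have h₂ := h.A₂
    rw [h₁, h₂]
    ring
  have hη' : PowerSeries.constantCoeff (PowerSeries.expand 2 two_ne_zero η) ≠ 0 := by
    rwa [PowerSeries.constantCoeff_expand]
  obtain ⟨ω', hω', hθb₂⟩ : ∃ ω', PowerSeries.constantCoeff ω' ≠ 0 ∧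
      arcHom fr.v fr.v' s₁ s₂ cc (chartMinor N f cc fr.ℓ₀ fr.ℓ₂)
        = PowerSeries.X ^ (2 * k) * ω' := by
    rw [arcHom_chartMinor hcc]
    have hdet := det_quadStack_arcVec hcc (isHomogeneous_linComb hf fr.ℓ₀)
      (isHomogeneous_linComb hf fr.ℓ₂)
    obtain ⟨δ, hδ⟩ : ∃ δ : PowerSeries K,
        (algebraMap K _ (fr.v 0 * fr.v' 1 - fr.v 1 * fr.v' 0) * ω) * δ = 1 :=
      ⟨_, PowerSeries.mul_inv_cancel _ (by
        rw [map_mul, constantCoeff_algebraMap]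
        exact mul_ne_zero fr.det_ne_zero hω)⟩
    have hδ0 : PowerSeries.constantCoeff δ ≠ 0 := fun h0 => by
      have := congrArg PowerSeries.constantCoeff hδ
      rw [map_mul, h0, mul_zero, map_one] at this
      exact zero_ne_one this
    refine ⟨-(δ * arcScale fr.v fr.v' s₁ s₂ cc ^ (N + 1) * (2 * PowerSeries.expand 2 two_ne_zero η
      * Polynomial.aeval s₁ fr.C * Polynomial.aeval s₂ fr.C)), ?_, ?_⟩
    · simp only [map_neg, map_mul, map_pow, map_ofNat]
      exact neg_ne_zero.2 (mul_ne_zero (mul_ne_zero hδ0 (pow_ne_zero _ hu))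
        (mul_ne_zero (mul_ne_zero (mul_ne_zero two_ne_zero hη') h.C₁) h.C₂))
    · have hXe : (PowerSeries.X ^ e : PowerSeries K) ≠ 0 := pow_ne_zero _ PowerSeries.X_ne_zero
      refine mul_right_cancel₀ hXe ?_
      rw [hB₁, hB₂, hdiff] at hdet
      linear_combination δ * hdet - (quadStack (arcVec fr.v fr.v' s₁ s₂ cc)
        (coeffRows N (PowerSeries K) (linComb fr.ℓ₀ f) (linComb fr.ℓ₂ f))).det
          * PowerSeries.X ^ e * hδ
  have hCβ : fr.C.eval (PowerSeries.constantCoeff s₂) ≠ 0 := by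
    rw [← constantCoeff_aeval]
    exact h.C₂
  refine lengthAt_eq_of_arc _ _ (arcHom fr.v fr.v' s₁ s₂ cc)
    (fun y hy => sq_dvd_arcHom hcc hS hP hy) (hmem z ?_) ?_ hθz
    (chartMinor_mem cc fr.ℓ₀ fr.ℓ₁) (hmem _ ?_)
    (fr.chartMinor_notMem_sq hf hκ hΓ hCβ hcc) hθb₁ ?_ (chartMinor_mem cc fr.ℓ₀ fr.ℓ₂) hω' hθb₂
  · rw [hθz]
    simp
  · simp only [map_mul, map_pow, constantCoeff_algebraMap]
    exact mul_ne_zero (mul_ne_zero hu (pow_ne_zero _ fr.det_ne_zero)) hωt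
  · rw [hθb₁, map_zero]
  · have hle : dehomIdeal cc (Ideal.span (minorsSet (N + 2) 2 f)) ≤
        (Ideal.span {PowerSeries.X ^ (2 * k)}).comap (arcHom fr.v fr.v' s₁ s₂ cc) := by
      rw [dehomIdeal, Ideal.map_le_iff_le_comap, Ideal.span_le]
      intro m hm
      rw [SetLike.mem_coe, Ideal.mem_comap, Ideal.mem_comap, Ideal.mem_span_singleton,
        arcHom_aeval_dehomMap hcc]
      rw [arcHom_chartMinor hcc] at hθb₂
      refine (Dvd.intro _ hθb₂.symm).trans (det_quadStack_dvd_aeval_of_mem_minorsSet ?_ hm)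
      intro u
      obtain ⟨l, hl⟩ := h.exists_row fr hf hcc
      refine ⟨fun j => algebraMap K _ (fr.e₁ u) * l j, algebraMap K _ (p u)
        + algebraMap K _ (fr.e₁ u) * PowerSeries.X ^ 2, algebraMap K _ (fr.e₂ u), fun c => ?_⟩
      rw [fr.bcoeff_eq u c]
      simp only [map_add, map_mul, hl, mul_assoc, ← Finset.mul_sum]
      ring
    intro j hj
    exact Ideal.mem_span_singleton.1 (hle hj)

end LocalFrame

end

section

namespace LocalFrame

variable {K : Type*} [Field K] {n d : ℕ} {f : Fin 3 → MvPolynomial (Fin 2) K}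
  {F : MvPolynomial (Fin 3) K} {p : Fin 3 → K} {G : MvPolynomial (Fin 2) K}

/-- The type of a singularity whose two branches are the images of a pair of arcs. -/
theorem ArcPair.isAsSing [CharZero K] {fr : LocalFrame n d f F p G} (hF : F.IsHomogeneous n)
    (hFf : MvPolynomial.aeval f F = 0) {s₁ s₂ : PowerSeries K} {e k s : ℕ}
    (h : fr.ArcPair s₁ s₂ e k) (hs : s + 1 = 2 * k + e) : IsAsSing F p s := by
  obtain ⟨a, η, ha, hη, hB₁, hB₂⟩ := h.B
  rw [← hs] at hB₁ hB₂
  have hne {C : PowerSeries K} (hC : PowerSeries.constantCoeff C ≠ 0) : C ≠ 0 := by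
    rintro rfl
    exact hC (map_zero _)
  obtain ⟨q, hq, hFw⟩ := exists_cusp_factorization fr.coeff_two_ne_zero ha hη
    (b := s + 1) (by omega) (e₁ := fr.e₁) (by
      intro ε hε
      rcases sq_eq_one_iff.1 hε with rfl | rfl
      · refine fr.eval₂_affine_eq_zero hF hFf (hne h.C₁) h.A₁ ?_
        rw [hB₁, one_mul]
      · refine fr.eval₂_affine_eq_zero hF hFf (hne h.C₂) h.A₂ ?_
        rw [hB₂]
        ring)
  exact isAsSing_of_expansion hF fr.h1p fr.h11 fr.h12 fr.h2p fr.h21 fr.h22 ha hη hq hFw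

end LocalFrame

end

section

namespace PowerSeries

variable {K : Type*} [Field K]

theorem exists_pow_eq [IsAlgClosed K] [CharZero K] {e : ℕ} (he : e ≠ 0) {u : PowerSeries K}
    (hu : constantCoeff u ≠ 0) : ∃ w : PowerSeries K, w ^ e = u ∧ constantCoeff w ≠ 0 := by
  obtain ⟨c, hc⟩ := IsAlgClosed.exists_pow_nat_eq (constantCoeff u) (Nat.pos_of_ne_zero he)
  have hc0 : c ≠ 0 := by
    rintro rfl
    rw [zero_pow he] at hc
    exact hu hc.symm
  have : HenselianRing (PowerSeries K) (Ideal.span {X}) := inferInstance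
  have hdiv (a : PowerSeries K) (ha : constantCoeff a = 0) : a ∈ Ideal.span {(X : PowerSeries K)} :=
    Ideal.mem_span_singleton.2 (X_dvd_iff.2 ha)
  obtain ⟨w, hw, hw'⟩ := HenselianRing.is_henselian (I := Ideal.span {(X : PowerSeries K)})
    (Polynomial.X ^ e - Polynomial.C u) (Polynomial.monic_X_pow_sub_C u he) (C c)
    (hdiv _ (by simp [hc])) (by
      have : IsUnit (((e : PowerSeries K)) * (C c) ^ (e - 1)) := by
        rw [isUnit_iff_constantCoeff]
        simp [hc0, he]
      simpa [Polynomial.derivative_X_pow] using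
        this.map (Ideal.Quotient.mk (Ideal.span {(X : PowerSeries K)})))
  refine ⟨w, ?_, ?_⟩
  · simpa [Polynomial.IsRoot, sub_eq_zero] using hw
  · have := X_dvd_iff.1 (Ideal.mem_span_singleton.1 hw')
    rw [map_sub, constantCoeff_C, sub_eq_zero] at this
    rwa [this]

theorem aeval_C_add_X_constantCoeff (α : K) (P : Polynomial K) :
    constantCoeff (Polynomial.aeval (C α + X : PowerSeries K) P) = P.eval α := by
  rw [LocalFrame.constantCoeff_aeval]
  simp

/-- A local solution of `A / D = X ^ e` at a zero of order `e` of `A`. -/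
theorem exists_ramified_arc [IsAlgClosed K] [CharZero K] {A D Q : Polynomial K} {α : K} {e : ℕ}
    (he : e ≠ 0) (hA : A = (Polynomial.X - Polynomial.C α) ^ e * Q) (hQ : Q.eval α ≠ 0)
    (hD : D.eval α ≠ 0) : ∃ ω : PowerSeries K, constantCoeff ω ≠ 0 ∧
      Polynomial.aeval (C α + X * ω) A = X ^ e * Polynomial.aeval (C α + X * ω) D := by
  have hD' : constantCoeff (Polynomial.aeval (C α + X : PowerSeries K) D) ≠ 0 := by
    rwa [aeval_C_add_X_constantCoeff]
  obtain ⟨w, hw, hw0⟩ := exists_pow_eq he (u := Polynomial.aeval (C α + X : PowerSeries K) Q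
    * (Polynomial.aeval (C α + X : PowerSeries K) D)⁻¹) (by
      rw [map_mul, constantCoeff_inv, aeval_C_add_X_constantCoeff, aeval_C_add_X_constantCoeff]
      exact mul_ne_zero hQ (inv_ne_zero hD))
  have hP1 : coeff 1 (X * w) ≠ 0 := by
    rw [← zero_add 1, coeff_succ_X_mul, coeff_zero_eq_constantCoeff_apply]
    exact hw0
  let : Invertible (coeff 1 (X * w)) := invertibleOfNonzero hP1
  obtain ⟨S, hS⟩ : ∃ S, S = substInv (X * w) := ⟨_, rfl⟩
  have hsub : HasSubst S := hS ▸ HasSubst.substInv _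
  have hPS : (X * w).subst S = X := by
    rw [hS]
    exact subst_substInv_right _ (by simp)
  have hS0 : constantCoeff S = 0 := by rw [hS, constantCoeff_substInv]
  have hS1 : coeff 1 S ≠ 0 := by
    rw [hS, coeff_one_substInv]
    rw [invOf_eq_inv]
    exact inv_ne_zero hP1
  obtain ⟨ω, hω⟩ := X_dvd_iff.2 hS0
  refine ⟨ω, ?_, ?_⟩
  · rw [hω, ← zero_add 1, coeff_succ_X_mul, coeff_zero_eq_constantCoeff_apply] at hS1
    exact hS1
  · have hs : substAlgHom (R := K) hsub (C α + X) = C α + X * ω := by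
      rw [map_add, coe_substAlgHom, subst_X hsub, ← hω]
      congr 1
      exact subst_C α
    have key : Polynomial.aeval (C α + X : PowerSeries K) A
        = (X * w) ^ e * Polynomial.aeval (C α + X : PowerSeries K) D := by
      rw [mul_pow, hw, mul_assoc, mul_assoc, PowerSeries.inv_mul_cancel _ hD', mul_one, hA, map_mul,
          map_pow,
        map_sub, Polynomial.aeval_X, Polynomial.aeval_C]
      congr 2
      exact add_sub_cancel_left _ _
    have := congrArg (substAlgHom (R := K) hsub) key
    rwa [← Polynomial.aeval_algHom_apply, map_mul, map_pow, ← Polynomial.aeval_algHom_apply, hs,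
      coe_substAlgHom, hPS] at this

theorem transcendental_of_ne_C [IsAlgClosed K] {s : PowerSeries K} (hs : ∀ c, s ≠ C c) :
    Transcendental K s := by
  intro halg
  obtain ⟨τ, hτ⟩ : ∃ τ, algebraMap K _ τ = s :=
    minpoly.mem_range_of_degree_eq_one K s (IsAlgClosed.degree_eq_one_of_irreducible K
      (minpoly.irreducible halg.isIntegral))
  exact hs τ hτ.symm

/-- The involution `X ↦ -X`. -/
abbrev negHom : PowerSeries K →ₐ[K] PowerSeries K :=
  AlgHom.mk' (rescale (-1 : K)) (fun c x => by ext n; simp; ring)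

theorem coeff_negHom (s : PowerSeries K) (n : ℕ) : coeff n (negHom s) = (-1) ^ n * coeff n s := by
  simp [negHom]

theorem exists_expand_of_negHom [CharZero K] {s : PowerSeries K} (hs : negHom s = s) :
    ∃ a, s = expand 2 two_ne_zero a := by
  refine ⟨mk fun n => coeff (2 * n) s, ?_⟩
  ext n
  rw [coeff_expand]
  split_ifs with h
  · obtain ⟨m, rfl⟩ := h
    simp
  · have := congrArg (coeff n) hs
    rw [coeff_negHom, Odd.neg_one_pow (by rwa [← Nat.not_even_iff_odd, even_iff_two_dvd])] at this
    have h2 : (2 : K) * coeff n s = 0 := by linear_combination -this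
    simpa using h2

theorem eq_X_pow_mul_of_ne_zero {s : PowerSeries K} (hs : s ≠ 0) :
    ∃ k η, constantCoeff η ≠ 0 ∧ s = X ^ k * η := by
  refine ⟨s.order.toNat, divXPowOrder s, ?_, X_pow_order_mul_divXPowOrder.symm⟩
  rw [constantCoeff_divXPowOrder]
  exact coeff_order hs

end PowerSeries

end

section

namespace PowerSeries

variable {K : Type*} [Field K]

theorem negHom_X : negHom (X : PowerSeries K) = -X := by
  simp [negHom]

theorem negHom_C (c : K) : negHom (C c : PowerSeries K) = C c :=
  negHom.commutes c

theorem negHom_negHom (s : PowerSeries K) : negHom (negHom s) = s := by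
  ext n
  rw [coeff_negHom, coeff_negHom, ← mul_assoc, ← mul_pow]
  simp

theorem constantCoeff_negHom (s : PowerSeries K) :
    constantCoeff (negHom s) = constantCoeff s := by
  rw [← coeff_zero_eq_constantCoeff_apply, coeff_negHom]
  simp

theorem coeff_one_C_add_X_mul (c : K) (ω : PowerSeries K) :
    coeff 1 (C c + X * ω) = constantCoeff ω := by
  rw [map_add, ← zero_add 1, coeff_succ_X_mul, coeff_zero_eq_constantCoeff_apply, coeff_C]
  simp

theorem transcendental_C_add_X_mul [IsAlgClosed K] (c : K) {ω : PowerSeries K}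
    (hω : constantCoeff ω ≠ 0) : Transcendental K (C c + X * ω) := by
  refine transcendental_of_ne_C fun b hb => hω ?_
  rw [← coeff_one_C_add_X_mul c, hb, coeff_C]
  simp

theorem pos_of_constantCoeff_X_pow_mul {k : ℕ} {η : PowerSeries K} (hη : constantCoeff η ≠ 0)
    (h : constantCoeff (X ^ k * η) = 0) : 1 ≤ k := by
  by_contra! hk
  obtain rfl : k = 0 := by omega
  exact hη (by simpa using h)

theorem C_half_mul_two [CharZero K] : (C (1 / 2 : K) : PowerSeries K) * 2 = 1 := by
  have h : (2 : PowerSeries K) = C (2 : K) := (map_ofNat C 2).symm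
  rw [h, ← map_mul]
  norm_num

theorem aeval_negHom (s : PowerSeries K) (P : Polynomial K) :
    Polynomial.aeval (negHom s) P = negHom (Polynomial.aeval s P) :=
  Polynomial.aeval_algHom_apply _ _ _

end PowerSeries

namespace LocalFrame

variable {K : Type*} [Field K] {n d : ℕ} {f : Fin 3 → MvPolynomial (Fin 2) K}
  {F : MvPolynomial (Fin 3) K} {p : Fin 3 → K} {G : MvPolynomial (Fin 2) K}

theorem exists_arcPair_of_ne [IsAlgClosed K] [CharZero K] (fr : LocalFrame n d f F p G)
    (hn : n ≠ 0) (hf : IsProperParam n f) (hF : F.IsHomogeneous n)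
    (hFf : MvPolynomial.aeval f F = 0) {κ α β : K} (hκ : κ ≠ 0)
    (hΓ : fr.Γ = Polynomial.C κ * ((Polynomial.X - Polynomial.C α)
      * (Polynomial.X - Polynomial.C β))) (hαβ : α ≠ β) :
    ∃ s₁ s₂ k, 1 ≤ k ∧ PowerSeries.constantCoeff s₁ = α ∧ PowerSeries.constantCoeff s₂ = β ∧
        fr.ArcPair s₁ s₂ 0 k := by
  have hA : fr.A = fr.Γ * fr.A' := fr.eq_A
  have hB : fr.B = fr.Γ * fr.B' := fr.eq_B
  have hΓα : fr.Γ.eval α = 0 := by simp [hΓ]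
  have hΓβ : fr.Γ.eval β = 0 := by simp [hΓ]
  have hCα : fr.C.eval α ≠ 0 := fr.eval_C_ne_zero hf hF hFf (by
    rw [hA, Polynomial.eval_mul, hΓα, zero_mul])
  have hCβ : fr.C.eval β ≠ 0 := fr.eval_C_ne_zero hf hF hFf (by
    rw [hA, Polynomial.eval_mul, hΓβ, zero_mul])
  obtain ⟨ω₁, hω₁, h₁⟩ := PowerSeries.exists_ramified_arc (A := fr.A) (D := fr.C)
      (α := α) one_ne_zero
    (Q := Polynomial.C κ * (Polynomial.X - Polynomial.C β) * fr.A') (by rw [hA, hΓ]; ring)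
    (by simpa [hκ, sub_eq_zero, hαβ] using fr.eval_A'_ne_zero α hΓα) hCα
  obtain ⟨ω₂, hω₂, h₂⟩ := PowerSeries.exists_ramified_arc (A := fr.A) (D := fr.C)
      (α := β) one_ne_zero
    (Q := Polynomial.C κ * (Polynomial.X - Polynomial.C α) * fr.A') (by rw [hA, hΓ]; ring)
    (by simpa [hκ, sub_eq_zero, hαβ.symm] using fr.eval_A'_ne_zero β hΓβ) hCβ
  have htr₁ := PowerSeries.transcendental_C_add_X_mul α hω₁
  have htr₂ := PowerSeries.transcendental_C_add_X_mul β hω₂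
  obtain ⟨t₁, ht₁⟩ : ∃ t, t = PowerSeries.C α + PowerSeries.X * ω₁ := ⟨_, rfl⟩
  obtain ⟨t₂, ht₂⟩ : ∃ t, t = PowerSeries.C β + PowerSeries.X * ω₂ := ⟨_, rfl⟩
  rw [← ht₁] at h₁ htr₁
  rw [← ht₂] at h₂ htr₂
  have hc₁ : PowerSeries.constantCoeff t₁ = α := by simp [ht₁]
  have hc₂ : PowerSeries.constantCoeff t₂ = β := by simp [ht₂]
  have hC₁ : PowerSeries.constantCoeff (Polynomial.aeval t₁ fr.C) ≠ 0 := by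
    rwa [constantCoeff_aeval, hc₁]
  have hC₂ : PowerSeries.constantCoeff (Polynomial.aeval t₂ fr.C) ≠ 0 := by
    rwa [constantCoeff_aeval, hc₂]
  have hB₁ : PowerSeries.constantCoeff (Polynomial.aeval t₁ fr.B) = 0 := by
    rw [constantCoeff_aeval, hc₁, hB, Polynomial.eval_mul, hΓα, zero_mul]
  have hB₂ : PowerSeries.constantCoeff (Polynomial.aeval t₂ fr.B) = 0 := by
    rw [constantCoeff_aeval, hc₂, hB, Polynomial.eval_mul, hΓβ, zero_mul]
  obtain ⟨y₁, hy₁⟩ : ∃ y, y = Polynomial.aeval t₁ fr.B * (Polynomial.aeval t₁ fr.C)⁻¹ := ⟨_, rfl⟩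
  obtain ⟨y₂, hy₂⟩ : ∃ y, y = Polynomial.aeval t₂ fr.B * (Polynomial.aeval t₂ fr.C)⁻¹ := ⟨_, rfl⟩
  have hyB₁ : Polynomial.aeval t₁ fr.B = y₁ * Polynomial.aeval t₁ fr.C := by
    rw [hy₁, mul_assoc, PowerSeries.inv_mul_cancel _ hC₁, mul_one]
  have hyB₂ : Polynomial.aeval t₂ fr.B = y₂ * Polynomial.aeval t₂ fr.C := by
    rw [hy₂, mul_assoc, PowerSeries.inv_mul_cancel _ hC₂, mul_one]
  have hy₁0 : PowerSeries.constantCoeff y₁ = 0 := by rw [hy₁, map_mul, hB₁, zero_mul]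
  have hy₂0 : PowerSeries.constantCoeff y₂ = 0 := by rw [hy₂, map_mul, hB₂, zero_mul]
  have hhalf : PowerSeries.C (1 / 2 : K) ≠ (0 : PowerSeries K) := by
    intro h
    have := PowerSeries.C_half_mul_two (K := K)
    rw [h, zero_mul] at this
    exact zero_ne_one this
  have hδ : PowerSeries.C (1 / 2 : K) * (y₁ - y₂) ≠ 0 := by
    refine mul_ne_zero hhalf fun h => hαβ ?_
    rw [sub_eq_zero] at h
    rw [← hc₁, ← hc₂, fr.eq_of_affine_eq hn hf hF hFf htr₁ htr₂ (by rw [h₁, h₂]; ring)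
      (by rw [hyB₁, hyB₂, h]; ring)]
  obtain ⟨k, η, hη, hk⟩ := PowerSeries.eq_X_pow_mul_of_ne_zero hδ
  have e₁ : y₁ = PowerSeries.C (1 / 2 : K) * (y₁ + y₂) + PowerSeries.X ^ k * η := by
    rw [← hk]
    linear_combination -y₁ * PowerSeries.C_half_mul_two (K := K)
  have e₂ : y₂ = PowerSeries.C (1 / 2 : K) * (y₁ + y₂) - PowerSeries.X ^ k * η := by
    rw [← hk]
    linear_combination -y₂ * PowerSeries.C_half_mul_two (K := K)
  have hE (P : Polynomial K) (t : PowerSeries K) :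
      Polynomial.aeval (PowerSeries.expand 2 two_ne_zero t) P
        = PowerSeries.expand 2 two_ne_zero (Polynomial.aeval t P) :=
    Polynomial.aeval_algHom_apply _ _ _
  refine ⟨PowerSeries.expand 2 two_ne_zero t₁, PowerSeries.expand 2 two_ne_zero t₂, k,
    PowerSeries.pos_of_constantCoeff_X_pow_mul hη
      (by rw [← hk, map_mul, map_sub, hy₁0, hy₂0]; simp),
    by rw [PowerSeries.constantCoeff_expand, hc₁], by rw [PowerSeries.constantCoeff_expand, hc₂],
    ?_⟩
  have hs₁ : PowerSeries.constantCoeff (PowerSeries.expand 2 two_ne_zero t₁) = α := by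
    rw [PowerSeries.constantCoeff_expand, hc₁]
  refine
    { A₁ := by rw [hE, hE, h₁, map_mul, pow_one, PowerSeries.expand_X]
      A₂ := by rw [hE, hE, h₂, map_mul, pow_one, PowerSeries.expand_X]
      C₁ := by rwa [hE, PowerSeries.constantCoeff_expand]
      C₂ := by rwa [hE, PowerSeries.constantCoeff_expand]
      sum_even := ⟨t₁ + t₂, (map_add _ _ _).symm⟩
      prod_even := ⟨t₁ * t₂, (map_mul _ _ _).symm⟩
      diff := ⟨_, ?_, (by rw [pow_zero, one_mul])⟩
      transverse := ⟨PowerSeries.expand 2 two_ne_zero (ω₁ * (t₂ - PowerSeries.C α)), ?_, ?_⟩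
      B := ⟨PowerSeries.C (1 / 2 : K) * (y₁ + y₂), η, ?_, hη, ?_, ?_⟩ }
  · rw [map_sub, PowerSeries.constantCoeff_expand, PowerSeries.constantCoeff_expand, hc₁, hc₂]
    exact sub_ne_zero.2 hαβ
  · rw [PowerSeries.constantCoeff_expand, map_mul, map_sub, hc₂, PowerSeries.constantCoeff_C]
    exact mul_ne_zero hω₁ (sub_ne_zero.2 hαβ.symm)
  · have hCE : (PowerSeries.C α : PowerSeries K)
      = PowerSeries.expand 2 two_ne_zero (PowerSeries.C α) := (PowerSeries.expand_C _ _ _).symm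
    rw [hs₁, ht₁, map_add, map_mul, PowerSeries.expand_X, map_mul, map_sub, ← hCE]
    ring
  · rw [map_mul, map_add, hy₁0, hy₂0]
    simp
  · rw [hE, hE, hyB₁, map_mul]
    congr 1
    conv_lhs => rw [e₁]
    rw [map_add, map_mul _ (PowerSeries.X ^ k), map_pow, PowerSeries.expand_X, ← pow_mul, add_zero]
  · rw [hE, hE, hyB₂, map_mul]
    congr 1
    conv_lhs => rw [e₂]
    rw [map_sub, map_mul _ (PowerSeries.X ^ k), map_pow, PowerSeries.expand_X, ← pow_mul, add_zero]

theorem exists_arcPair_of_sq [IsAlgClosed K] [CharZero K] (fr : LocalFrame n d f F p G)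
    (hn : n ≠ 0) (hf : IsProperParam n f) (hF : F.IsHomogeneous n)
    (hFf : MvPolynomial.aeval f F = 0) {κ α : K} (hκ : κ ≠ 0)
    (hΓ : fr.Γ = Polynomial.C κ * ((Polynomial.X - Polynomial.C α)
      * (Polynomial.X - Polynomial.C α))) :
    ∃ s₁ s₂ k, 1 ≤ k ∧ PowerSeries.constantCoeff s₁ = α ∧ PowerSeries.constantCoeff s₂ = α ∧
        fr.ArcPair s₁ s₂ 1 k := by
  have hA : fr.A = fr.Γ * fr.A' := fr.eq_A
  have hB : fr.B = fr.Γ * fr.B' := fr.eq_B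
  have hΓα : fr.Γ.eval α = 0 := by simp [hΓ]
  have hCα : fr.C.eval α ≠ 0 := fr.eval_C_ne_zero hf hF hFf (by
    rw [hA, Polynomial.eval_mul, hΓα, zero_mul])
  obtain ⟨ω, hω, h⟩ := PowerSeries.exists_ramified_arc (A := fr.A) (D := fr.C) (α := α) two_ne_zero
    (Q := Polynomial.C κ * fr.A') (by rw [hA, hΓ]; ring)
    (by simpa [hκ] using fr.eval_A'_ne_zero α hΓα) hCα
  have hneg : PowerSeries.negHom (PowerSeries.C α + PowerSeries.X * ω) = PowerSeries.C α
      + PowerSeries.X * (-PowerSeries.negHom ω) := by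
    rw [map_add, map_mul, PowerSeries.negHom_C, PowerSeries.negHom_X]
    ring
  have htr := PowerSeries.transcendental_C_add_X_mul α hω
  have htr' : Transcendental K (PowerSeries.negHom (PowerSeries.C α + PowerSeries.X * ω)) := by
    rw [hneg]
    exact PowerSeries.transcendental_C_add_X_mul α (by rwa [map_neg,
        PowerSeries.constantCoeff_negHom, neg_ne_zero])
  obtain ⟨t, ht⟩ : ∃ t, t = PowerSeries.C α + PowerSeries.X * ω := ⟨_, rfl⟩
  rw [← ht] at h htr htr' hneg
  have hc : PowerSeries.constantCoeff t = α := by simp [ht]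
  have h' : Polynomial.aeval (PowerSeries.negHom t) fr.A = PowerSeries.X ^ 2
      * Polynomial.aeval (PowerSeries.negHom t) fr.C := by
    rw [PowerSeries.aeval_negHom, PowerSeries.aeval_negHom, h, map_mul, map_pow,
        PowerSeries.negHom_X, neg_sq]
  have hC : PowerSeries.constantCoeff (Polynomial.aeval t fr.C) ≠ 0 := by
    rwa [constantCoeff_aeval, hc]
  have hC' : PowerSeries.constantCoeff (Polynomial.aeval (PowerSeries.negHom t) fr.C) ≠ 0 := by
    rwa [constantCoeff_aeval, PowerSeries.constantCoeff_negHom, hc]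
  obtain ⟨z, hz⟩ : ∃ z, z = PowerSeries.C κ * ω ^ 2 * Polynomial.aeval t fr.B'
    * (Polynomial.aeval t fr.C)⁻¹ := ⟨_, rfl⟩
  have hyB : Polynomial.aeval t fr.B = PowerSeries.X ^ 2 * z * Polynomial.aeval t fr.C := by
    rw [hz, mul_assoc, mul_assoc, PowerSeries.inv_mul_cancel _ hC, mul_one, hB, hΓ]
    simp only [map_mul, map_sub, Polynomial.aeval_X, Polynomial.aeval_C]
    have : t - algebraMap K (PowerSeries K) α = PowerSeries.X * ω := by
      rw [ht]
      exact add_sub_cancel_left _ _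
    rw [this, show algebraMap K (PowerSeries K) κ = PowerSeries.C κ from rfl]
    ring
  have hyB' : Polynomial.aeval (PowerSeries.negHom t) fr.B
      = PowerSeries.X ^ 2 * PowerSeries.negHom z
          * Polynomial.aeval (PowerSeries.negHom t) fr.C := by
    rw [PowerSeries.aeval_negHom, PowerSeries.aeval_negHom, hyB, map_mul, map_mul, map_pow,
        PowerSeries.negHom_X, neg_sq]
  have hhalf : PowerSeries.C (1 / 2 : K) ≠ (0 : PowerSeries K) := fun h0 => by
    have := PowerSeries.C_half_mul_two (K := K)
    rw [h0, zero_mul] at this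
    exact zero_ne_one this
  have hδ : PowerSeries.C (1 / 2 : K) * (z - PowerSeries.negHom z) ≠ 0 := by
    refine mul_ne_zero hhalf fun h0 => hω ?_
    rw [sub_eq_zero] at h0
    have := fr.eq_of_affine_eq hn hf hF hFf htr htr' (by rw [h, h']; ring)
      (by rw [hyB, hyB', ← h0]; ring)
    have h1 := congrArg (PowerSeries.coeff 1) this
    rw [hneg, ht, PowerSeries.coeff_one_C_add_X_mul, PowerSeries.coeff_one_C_add_X_mul, map_neg,
      PowerSeries.constantCoeff_negHom] at h1
    exact self_eq_neg.1 h1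
  obtain ⟨q, hq⟩ : PowerSeries.X ∣ PowerSeries.C (1 / 2 : K) * (z - PowerSeries.negHom z) :=
    PowerSeries.X_dvd_iff.2 (by
    rw [map_mul, map_sub, PowerSeries.constantCoeff_negHom, sub_self, mul_zero])
  have hq0 : q ≠ 0 := by
    rintro rfl
    rw [mul_zero] at hq
    exact hδ hq
  obtain ⟨q', rfl⟩ := PowerSeries.exists_expand_of_negHom (s := q) (by
    refine mul_left_cancel₀ (PowerSeries.X_ne_zero (R := K)) ?_
    have := congrArg PowerSeries.negHom hq
    rw [map_mul, map_mul, map_sub, PowerSeries.negHom_negHom, PowerSeries.negHom_C,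
        PowerSeries.negHom_X] at this
    linear_combination this + hq)
  obtain ⟨k, η, hη, rfl⟩ := PowerSeries.eq_X_pow_mul_of_ne_zero (s := q') (by
    rintro rfl
    exact hq0 (map_zero _))
  obtain ⟨a, ha⟩ := PowerSeries.exists_expand_of_negHom
      (s := PowerSeries.X ^ 2 * (PowerSeries.C (1 / 2 : K) * (z + PowerSeries.negHom z))) (by
    rw [map_mul, map_mul, map_add, PowerSeries.negHom_negHom, PowerSeries.negHom_C, map_pow,
        PowerSeries.negHom_X]
    ring)
  have hδ' : PowerSeries.X ^ (2 * (k + 1) + 1) * PowerSeries.expand 2 two_ne_zero η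
      = PowerSeries.X ^ 2 * (PowerSeries.C (1 / 2 : K) * (z - PowerSeries.negHom z)) := by
    rw [hq, map_mul, map_pow, PowerSeries.expand_X]
    ring
  refine ⟨t, PowerSeries.negHom t, k + 1, by omega, hc, by rw [PowerSeries.constantCoeff_negHom,
      hc], ?_⟩
  refine
    { A₁ := h
      A₂ := h'
      C₁ := hC
      C₂ := hC'
      sum_even := PowerSeries.exists_expand_of_negHom (by rw [map_add, PowerSeries.negHom_negHom,
          add_comm])
      prod_even := PowerSeries.exists_expand_of_negHom (by rw [map_mul, PowerSeries.negHom_negHom,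
          mul_comm])
      diff := ⟨ω + PowerSeries.negHom ω, ?_, ?_⟩
      transverse := ⟨ω * (-PowerSeries.negHom ω), ?_, ?_⟩
      B := ⟨a, η, ?_, hη, ?_, ?_⟩ }
  · rw [map_add, PowerSeries.constantCoeff_negHom, ← two_mul]
    exact mul_ne_zero two_ne_zero hω
  · rw [hneg, ht]
    ring
  · rw [map_mul, map_neg, PowerSeries.constantCoeff_negHom]
    exact mul_ne_zero hω (neg_ne_zero.2 hω)
  · rw [hc, hneg, ht]
    ring
  · rw [← PowerSeries.constantCoeff_expand 2 two_ne_zero a, ← ha]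
    simp
  · rw [hyB, ← ha, hδ']
    linear_combination -(PowerSeries.X ^ 2 * z * Polynomial.aeval t fr.C)
        * PowerSeries.C_half_mul_two (K := K)
  · rw [hyB', ← ha, hδ']
    linear_combination
      -(PowerSeries.X ^ 2 * PowerSeries.negHom z * Polynomial.aeval (PowerSeries.negHom t) fr.C)
          * PowerSeries.C_half_mul_two (K := K)

end LocalFrame

end

section

namespace LocalFrame

variable {K : Type*} [Field K] {n d : ℕ} {f : Fin 3 → MvPolynomial (Fin 2) K}
  {F : MvPolynomial (Fin 3) K} {p : Fin 3 → K} {G : MvPolynomial (Fin 2) K}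

theorem exists_roots_gcd [IsAlgClosed K] (fr : LocalFrame n 2 f F p G) (hn : n ≠ 0) :
    ∃ κ α β, κ ≠ 0 ∧ fr.Γ = Polynomial.C κ * ((Polynomial.X - Polynomial.C α)
      * (Polynomial.X - Polynomial.C β)) := by
  have hcard : fr.Γ.roots.card = 2 := by
    rw [← Polynomial.Splits.natDegree_eq_card_roots (IsAlgClosed.splits _)]
    exact fr.natDegree_gcd
  obtain ⟨α, β, hαβ⟩ := Multiset.card_eq_two.1 hcard
  refine ⟨fr.Γ.leadingCoeff, α, β, Polynomial.leadingCoeff_ne_zero.2 (fr.Γ_ne_zero hn), ?_⟩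
  conv_lhs => rw [Polynomial.Splits.eq_prod_roots (IsAlgClosed.splits fr.Γ), hαβ]
  simp

theorem _root_.restrictLine_linFormOf_linePoint (v v' : Fin 2 → K) (α : K) :
    restrictLine v v' (linFormOf (linePoint v v' α))
      = Polynomial.C (v 0 * v' 1 - v 1 * v' 0) * (Polynomial.X - Polynomial.C α) := by
  simp only [restrictLine, linFormOf, linePoint, MvPolynomial.eval₂_sub, MvPolynomial.eval₂_mul,
    MvPolynomial.eval₂_C, MvPolynomial.eval₂_X, Algebra.algebraMap_self, RingHom.id_apply]
  simp only [map_add, map_sub, map_mul]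
  ring

theorem _root_.isHomogeneous_linFormOf (σ : Fin 2 → K) : (linFormOf σ).IsHomogeneous 1 :=
  (MvPolynomial.isHomogeneous_C_mul_X _ _).sub (MvPolynomial.isHomogeneous_C_mul_X _ _)

theorem exists_eq_linFormOf_mul [Infinite K] (fr : LocalFrame n d f F p G)
    (hG : G.IsHomogeneous 2) {κ α β : K} (hκ : κ ≠ 0)
    (hΓ : fr.Γ = Polynomial.C κ * ((Polynomial.X - Polynomial.C α)
      * (Polynomial.X - Polynomial.C β))) :
    ∃ c, c ≠ 0 ∧ G = MvPolynomial.C c * (linFormOf (linePoint fr.v fr.v' α)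
      * linFormOf (linePoint fr.v fr.v' β)) := by
  have hdet := fr.det_ne_zero
  obtain ⟨δ, hδ⟩ : ∃ δ, δ = fr.v 0 * fr.v' 1 - fr.v 1 * fr.v' 0 := ⟨_, rfl⟩
  have hδ0 : δ ≠ 0 := by rwa [hδ]
  refine ⟨κ / δ ^ 2, div_ne_zero hκ (pow_ne_zero _ hδ0), ?_⟩
  rw [← sub_eq_zero]
  refine eq_zero_of_restrictLine (n := 2) (hG.sub ?_) hdet ?_
  · exact ((isHomogeneous_linFormOf _).mul (isHomogeneous_linFormOf _)).C_mul _
  · have hsub (g h : MvPolynomial (Fin 2) K) : restrictLine fr.v fr.v' (g - h)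
        = restrictLine fr.v fr.v' g - restrictLine fr.v fr.v' h := MvPolynomial.eval₂_sub _ _ _
    have hC (c : K) : restrictLine fr.v fr.v' (MvPolynomial.C c) = Polynomial.C c :=
      MvPolynomial.eval₂_C _ _ _
    rw [hsub, restrictLine_mul, restrictLine_mul, restrictLine_linFormOf_linePoint,
      restrictLine_linFormOf_linePoint, hC, ← hδ, show restrictLine fr.v fr.v' G = _ from hΓ]
    have : Polynomial.C κ = Polynomial.C (κ / δ ^ 2) * Polynomial.C δ * Polynomial.C δ := by
      rw [← map_mul, ← map_mul]
      congr 1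
      field_simp
    rw [this]
    ring

theorem _root_.single_add_single_inj {a b a' b' : ℕ} :
    (Finsupp.single 0 a + Finsupp.single 1 b : Fin 2 →₀ ℕ)
      = Finsupp.single 0 a' + Finsupp.single 1 b' ↔ a = a' ∧ b = b' := by
  constructor
  · intro h
    have h0 := DFunLike.congr_fun h 0
    have h1 := DFunLike.congr_fun h 1
    simp at h0 h1
    exact ⟨h0, h1⟩
  · rintro ⟨rfl, rfl⟩
    rfl

theorem _root_.bcoeff_linFormOf_mul (c : K) (σ τ : Fin 2 → K) (i : Fin 3) :
    bcoeff 2 (MvPolynomial.C c * (linFormOf σ * linFormOf τ)) i = c * quadOf σ τ i := by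
  have h : MvPolynomial.C c * (linFormOf σ * linFormOf τ)
      = MvPolynomial.monomial (Finsupp.single 0 2 + Finsupp.single 1 0) (c * quadOf σ τ 0)
      + MvPolynomial.monomial (Finsupp.single 0 1 + Finsupp.single 1 1) (c * quadOf σ τ 1)
      + MvPolynomial.monomial (Finsupp.single 0 0 + Finsupp.single 1 2) (c * quadOf σ τ 2) := by
    have hm (a b : ℕ) (r : K) : MvPolynomial.monomial (Finsupp.single (0 : Fin 2) a
        + Finsupp.single 1 b) r = MvPolynomial.C r * MvPolynomial.X 0 ^ a
            * MvPolynomial.X 1 ^ b := by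
      rw [MvPolynomial.X_pow_eq_monomial, MvPolynomial.X_pow_eq_monomial,
        MvPolynomial.C_mul_monomial, MvPolynomial.monomial_mul]
      simp
    rw [hm, hm, hm]
    simp only [linFormOf, quadOf, Matrix.cons_val_zero, Matrix.cons_val_one, Matrix.cons_val,
      map_mul, map_neg, map_add]
    ring
  rw [h, bcoeff]
  simp only [MvPolynomial.coeff_add, MvPolynomial.coeff_monomial, single_add_single_inj]
  fin_cases i <;> simp

theorem exists_sq_iff [IsAlgClosed K] (fr : LocalFrame n d f F p G) (hn : n ≠ 0)
    (hG : G.IsHomogeneous 2) {κ α β : K} (hκ : κ ≠ 0)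
    (hΓ : fr.Γ = Polynomial.C κ * ((Polynomial.X - Polynomial.C α)
      * (Polynomial.X - Polynomial.C β))) :
    (∃ a b : K, G = (MvPolynomial.C a * MvPolynomial.X 0
      + MvPolynomial.C b * MvPolynomial.X 1) ^ 2) ↔ α = β := by
  constructor
  · rintro ⟨a, b, hab⟩
    by_contra hne
    have hΓ' : fr.Γ = (Polynomial.C (a * fr.v 0 + b * fr.v 1) * Polynomial.X
        + Polynomial.C (a * fr.v' 0 + b * fr.v' 1)) ^ 2 := by
      refine (congrArg (restrictLine fr.v fr.v') hab).trans ?_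
      simp only [restrictLine]
      simp only [MvPolynomial.eval₂_pow, MvPolynomial.eval₂_add, MvPolynomial.eval₂_mul,
        MvPolynomial.eval₂_C, MvPolynomial.eval₂_X, map_add, map_mul]
      ring
    have hroot (τ : K) (hτ : fr.Γ.eval τ = 0) :
        (a * fr.v 0 + b * fr.v 1) * τ + (a * fr.v' 0 + b * fr.v' 1) = 0 := by
      rw [hΓ'] at hτ
      simpa using hτ
    have hα := hroot α (by simp [hΓ])
    have hβ := hroot β (by simp [hΓ])
    have h1 : a * fr.v 0 + b * fr.v 1 = 0 :=
      (mul_eq_zero.1 (by linear_combination hα - hβ :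
        (a * fr.v 0 + b * fr.v 1) * (α - β) = 0)).resolve_right (sub_ne_zero.2 hne)
    rw [h1, zero_mul, zero_add] at hα
    apply fr.Γ_ne_zero hn
    rw [hΓ', h1, hα]
    simp
  · rintro rfl
    obtain ⟨c, -, hc⟩ := fr.exists_eq_linFormOf_mul hG hκ hΓ
    obtain ⟨r, hr⟩ := IsAlgClosed.exists_pow_nat_eq c two_pos
    refine ⟨r * linePoint fr.v fr.v' α 1, -(r * linePoint fr.v fr.v' α 0), ?_⟩
    refine hc.trans ?_
    rw [← hr, linFormOf]
    simp only [map_mul, map_neg, map_pow]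
    ring

/-- At a double point, the type of the singularity is read off from the two roots of the gcd and
the length of `X_2`. -/
theorem exists_isAsSing_and_lengthAt [IsAlgClosed K] [CharZero K] {N : ℕ}
    (fr : LocalFrame (N + 2) 2 f F p G) (hf : IsProperParam (N + 2) f)
    (hF : F.IsHomogeneous (N + 2)) (hFf : MvPolynomial.aeval f F = 0) (hG : G.IsHomogeneous 2) :
    ∃ e k, 1 ≤ k ∧ e ≤ 1 ∧ ((∃ a b : K, G = (MvPolynomial.C a * MvPolynomial.X 0
        + MvPolynomial.C b * MvPolynomial.X 1) ^ 2) ↔ e = 1) ∧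
      IsAsSing F p (2 * k + e - 1) ∧
      ∀ cc : Fin 3, bcoeff 2 G cc ≠ 0 →
        lengthAt (dehomIdeal cc (Ideal.span (minorsSet (N + 2) 2 f)))
          (affOf (fun i => bcoeff 2 G i) cc) = k := by
  have hn : N + 2 ≠ 0 := by omega
  obtain ⟨κ, α, β, hκ, hΓ⟩ := fr.exists_roots_gcd hn
  obtain ⟨e, s₁, s₂, k, he, hsq, hk, h₁, h₂, harc⟩ : ∃ e s₁ s₂ k, e ≤ 1 ∧ (α = β ↔ e = 1) ∧
      1 ≤ k ∧ PowerSeries.constantCoeff s₁ = α ∧ PowerSeries.constantCoeff s₂ = β ∧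
      fr.ArcPair s₁ s₂ e k := by
    by_cases hαβ : α = β
    · subst hαβ
      obtain ⟨s₁, s₂, k, h⟩ := fr.exists_arcPair_of_sq hn hf hF hFf hκ hΓ
      exact ⟨1, s₁, s₂, k, le_rfl, by simp, h⟩
    · obtain ⟨s₁, s₂, k, h⟩ := fr.exists_arcPair_of_ne hn hf hF hFf hκ hΓ hαβ
      exact ⟨0, s₁, s₂, k, zero_le_one, by simp [hαβ], h⟩
  refine ⟨e, k, hk, he, (fr.exists_sq_iff hn hG hκ hΓ).trans hsq,
    harc.isAsSing hF hFf (by omega), fun cc hcc => ?_⟩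
  obtain ⟨c, hc0, hc⟩ := fr.exists_eq_linFormOf_mul hG hκ hΓ
  have hb (i : Fin 3) : bcoeff 2 G i
      = c * quadOf (linePoint fr.v fr.v' α) (linePoint fr.v fr.v' β) i :=
    (congrArg (fun g => bcoeff 2 g i) hc).trans (bcoeff_linFormOf_mul _ _ _ _)
  rw [hb] at hcc
  have haff : affOf (fun i => bcoeff 2 G i) cc
      = affOf (quadOf (linePoint fr.v fr.v' α) (linePoint fr.v fr.v' β)) cc := by
    funext i
    simp only [affOf]
    rw [hb, hb, mul_div_mul_left _ _ hc0]
  rw [haff]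
  subst h₁ h₂
  exact harc.lengthAt_eq hf.homog hκ hΓ (right_ne_zero_of_mul hcc)

end LocalFrame

theorem exists_bcoeff_two_ne_zero {K : Type*} [Field K] {G : MvPolynomial (Fin 2) K}
    (hG : G.IsHomogeneous 2) (h0 : G ≠ 0) : ∃ cc : Fin 3, bcoeff 2 G cc ≠ 0 := by
  by_contra! h
  apply h0
  refine (eq_sum_monomial_bcoeff hG).trans ?_
  exact Finset.sum_eq_zero fun i _ => by rw [h i, map_zero]

end

/-- Assume every singular point of `C` has multiplicity `2` and let `P` be a singular point.
Then `P` is an `A_{2m-1}` singularity iff `G_P` is not the square of a linear form and the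
length of `X_2` at `[G_P]` is `m`; and `P` is an `A_{2m}` singularity iff `G_P` is the square
of a linear form and the length of `X_2` at `[G_P]` is `m`. -/
theorem statement_12 {K : Type*} [Field K] [IsAlgClosed K] [CharZero K]
    (n : ℕ) (hn : 3 ≤ n) (f : Fin 3 → MvPolynomial (Fin 2) K)
    (hf : IsProperParam n f)
    (F : MvPolynomial (Fin 3) K) (hFirr : Irreducible F) (hFhom : F.IsHomogeneous n)
    (hFf : MvPolynomial.aeval f F = 0)
    (hmult2 : ∀ q : Fin 3 → K, q ≠ 0 → multAt F q ≤ 2)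
    (p : Fin 3 → K) (hp : p ≠ 0) (hsing : 2 ≤ multAt F p)
    (m : ℕ) (hm : 1 ≤ m)
    (G : MvPolynomial (Fin 2) K) (hG : IsGcdOfCross f p G) :
    (IsAsSing F p (2 * m - 1) ↔
      (¬ ∃ a b : K, G = (MvPolynomial.C a * MvPolynomial.X 0
          + MvPolynomial.C b * MvPolynomial.X 1) ^ 2) ∧
      (∀ cc : Fin 3, bcoeff 2 G cc ≠ 0 →
        lengthAt (dehomIdeal cc (Ideal.span (minorsSet n 2 f)))
          (affOf (fun i => bcoeff 2 G i) cc) = m)) ∧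
    (IsAsSing F p (2 * m) ↔
      (∃ a b : K, G = (MvPolynomial.C a * MvPolynomial.X 0
          + MvPolynomial.C b * MvPolynomial.X 1) ^ 2) ∧
      (∀ cc : Fin 3, bcoeff 2 G cc ≠ 0 →
        lengthAt (dehomIdeal cc (Ideal.span (minorsSet n 2 f)))
          (affOf (fun i => bcoeff 2 G i) cc) = m)) := by
  have hF0 : F ≠ 0 := hFirr.ne_zero
  have hmult : multAt F p = 2 := le_antisymm (hmult2 p hp) hsing
  obtain ⟨d, hGd, ⟨fr⟩⟩ := exists_localFrame hf hFhom hF0 hp hmult hG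
  obtain rfl : d = 2 := fr.degree_eq_two (by omega) hf hFhom hFf
    ((exists_lineRestrict_coeff_two hFhom hp hmult).1 _)
  obtain ⟨N, rfl⟩ : ∃ N, n = N + 2 := ⟨n - 2, by omega⟩
  obtain ⟨e, k, hk, he, hsq, hsing, hlen⟩ :=
    fr.exists_isAsSing_and_lengthAt hf hFhom hFf hGd
  obtain ⟨cc, hcc⟩ := exists_bcoeff_two_ne_zero hGd (hG.ne_zero hf hp)
  rw [hsq]
  refine ⟨⟨fun h => ?_, ?_⟩, ⟨fun h => ?_, ?_⟩⟩
  · have := hsing.unique hp (by omega) (by omega) h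
    exact ⟨by omega, fun c hc => (hlen c hc).trans (by omega)⟩
  · rintro ⟨h0, h⟩
    have := (hlen cc hcc).symm.trans (h cc hcc)
    rwa [show 2 * m - 1 = 2 * k + e - 1 by omega]
  · have := hsing.unique hp (by omega) (by omega) h
    exact ⟨by omega, fun c hc => (hlen c hc).trans (by omega)⟩
  · rintro ⟨h0, h⟩
    have := (hlen cc hcc).symm.trans (h cc hcc)
    rwa [show 2 * m = 2 * k + e - 1 by omega]

end
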